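/- Let d be a squarefree positive integer and let h(d) denote the class number of the imaginary quadratic field ℚ(√−d). Then h(d) = 1 if and only if d ∈ {1, 2, 3, 7, 11, 19, 43, 67, 163}. -/

import Mathlib

theorem isSquare_of_mul_eq_two_mul_sq {a b z : ℤ} (hab : IsCoprime a b) (hb : Odd b) (hb0 : 0 < b)
    (h : a * b = 2 * z ^ 2) : ∃ c, b = c ^ 2 := by
  have h2 : (2 : ℤ) ∣ a := by
    have : (2 : ℤ) ∣ a * b := ⟨_, h⟩
    rcases Int.prime_two.dvd_or_dvd this with h | h
    · exact h
    · exact absurd (even_iff_two_dvd.2 h) (Int.not_even_iff_odd.2 hb)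
  obtain ⟨a', rfl⟩ := h2
  have h' : b * a' = z ^ 2 := by linarith
  have hc : IsCoprime b a' := (IsCoprime.of_mul_left_right hab).symm
  obtain ⟨c, hc | hc⟩ := Int.sq_of_isCoprime hc h'
  · exact ⟨c, hc⟩
  · nlinarith [sq_nonneg c]

theorem sq_le_one_of_pow_six_add_one {s z : ℤ} (h : s ^ 6 + 1 = 2 * z ^ 2) : s ^ 2 ≤ 1 := by
  have hcop : IsCoprime (s ^ 2 + 1) (s ^ 4 - s ^ 2 + 1) := by
    have h3 : ¬ (3 : ℤ) ∣ s ^ 2 + 1 := by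
      intro h3
      have : s % 3 = 0 ∨ s % 3 = 1 ∨ s % 3 = 2 := by omega
      rcases this with h | h | h <;> (have := Int.emod_emod_of_dvd (s^2+1) (dvd_refl 3)) <;>
      simp [Int.dvd_iff_emod_eq_zero, pow_two, Int.add_emod, Int.mul_emod, h] at h3
    have h3' : IsCoprime (s ^ 2 + 1) 3 :=
      ((Int.prime_three.coprime_iff_not_dvd).2 h3).symm
    have : s ^ 4 - s ^ 2 + 1 = 3 + (s ^ 2 - 2) * (s ^ 2 + 1) := by ring
    rw [this]
    exact h3'.add_mul_right_right _
  have hodd : Odd (s ^ 4 - s ^ 2 + 1) := by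
    have : Even (s ^ 4 - s ^ 2) := by
      rcases Int.even_or_odd s with h | h <;> simp [h, parity_simps]
    exact this.add_one
  have hpos : 0 < s ^ 4 - s ^ 2 + 1 := by nlinarith [sq_nonneg (s ^ 2 - 1), sq_nonneg s]
  obtain ⟨c, hc⟩ := isSquare_of_mul_eq_two_mul_sq hcop hodd hpos (z := z) (by rw [← h]; ring)
  by_contra! hs
  have h1 : c ^ 2 < (s ^ 2) ^ 2 := by nlinarith
  have h2 : (s ^ 2 - 1) ^ 2 < c ^ 2 := by nlinarith
  have := abs_lt_of_sq_lt_sq h1 (by positivity)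
  have h3 := abs_lt_of_sq_lt_sq (a := s ^ 2 - 1) (b := |c|) (by rwa [sq_abs]) (by positivity)
  rw [abs_of_pos (by linarith)] at h3
  omega

theorem eq_of_sq_add_self_add_one {s c : ℤ} (h : s ^ 2 + s + 1 = c ^ 2) : s = 0 ∨ s = -1 := by
  have h1 : (|2 * c| - |2 * s + 1|) * (|2 * c| + |2 * s + 1|) = 3 := by
    have := sq_abs (2 * c); have := sq_abs (2 * s + 1); nlinarith
  have h2 := abs_nonneg (2 * c)
  have h3 : 1 ≤ |2 * s + 1| := Int.one_le_abs (by omega)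
  have h4 : 0 < |2 * c| - |2 * s + 1| := by
    by_contra! h; nlinarith
  have h5 : |2 * s + 1| ≤ 1 := by nlinarith
  have := abs_le.1 h5
  omega

theorem sq_le_one_of_pow_six_sub_one {s z : ℤ} (h : s ^ 6 - 1 = 2 * z ^ 2) : s ^ 2 ≤ 1 := by
  have hodd : Odd (s ^ 4 + s ^ 2 + 1) := by
    have : Even (s ^ 4 + s ^ 2) := by
      rcases Int.even_or_odd s with h | h <;> simp [h, parity_simps]
    exact this.add_one
  by_cases h3 : (3 : ℤ) ∣ s ^ 2 - 1
  · obtain ⟨a, ha⟩ := h3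
    have h9 : (3 : ℤ) ∣ z := by
      have : (3 : ℤ) ∣ 2 * z ^ 2 := ⟨3 * a * (1 + 3 * a + 3 * a ^ 2), by
        rw [← h]
        have : s ^ 2 = 3 * a + 1 := by linarith
        rw [show s ^ 6 = (s ^ 2) ^ 3 by ring, this]; ring⟩
      rcases Int.prime_three.dvd_or_dvd this with h | h
      · omega
      · exact Int.prime_three.dvd_of_dvd_pow h
    obtain ⟨z', rfl⟩ := h9
    have hs : s ^ 2 = 3 * a + 1 := by linarith
    have he : a * (1 + 3 * a + 3 * a ^ 2) = 2 * z' ^ 2 := by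
      have : 9 * (a * (1 + 3 * a + 3 * a ^ 2)) = 9 * (2 * z' ^ 2) := by
        rw [show s ^ 6 = (s ^ 2) ^ 3 by ring, hs] at h; linarith
      linarith
    have hcop : IsCoprime a (1 + 3 * a + 3 * a ^ 2) := ⟨-(3 + 3 * a), 1, by ring⟩
    have hf : s ^ 4 + s ^ 2 + 1 = 3 * (1 + 3 * a + 3 * a ^ 2) := by
      rw [show s ^ 4 = (s ^ 2) ^ 2 by ring, hs]; ring
    have hodd' : Odd (1 + 3 * a + 3 * a ^ 2) := by
      rw [hf] at hodd; exact (Int.odd_mul.1 hodd).2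
    have hpos : 0 < 1 + 3 * a + 3 * a ^ 2 := by nlinarith [sq_nonneg (2 * a + 1)]
    obtain ⟨b, hb⟩ := isSquare_of_mul_eq_two_mul_sq hcop hodd' hpos he
    rw [hb] at hf
    have hprod : (s ^ 2 + s + 1) * (s ^ 2 - s + 1) = 3 * b ^ 2 := by rw [← hf]; ring
    have ho1 : Odd (s ^ 2 + s + 1) := by
      have : Even (s ^ 2 + s) := by
        rcases Int.even_or_odd s with h | h <;> simp [h, parity_simps]
      exact this.add_one
    have hc0 : IsCoprime (s ^ 2 + s + 1) (s ^ 2 - s + 1) := by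
      have h1 : IsCoprime (s ^ 2 + s + 1) (-2 * s) := by
        apply IsCoprime.mul_right
        · obtain ⟨k, hk⟩ := ho1
          exact ⟨1, k, by rw [hk]; ring⟩
        · exact ⟨1, -(s + 1), by ring⟩
      rw [show s ^ 2 - s + 1 = -2 * s + 1 * (s ^ 2 + s + 1) by ring]
      exact h1.add_mul_right_right 1
    have hp1 : 0 < s ^ 2 + s + 1 := by nlinarith [sq_nonneg (2 * s + 1)]
    have hp2 : 0 < s ^ 2 - s + 1 := by nlinarith [sq_nonneg (2 * s - 1)]
    have hdvd : (3 : ℤ) ∣ (s ^ 2 + s + 1) * (s ^ 2 - s + 1) := ⟨_, hprod⟩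
    rcases Int.prime_three.dvd_or_dvd hdvd with ⟨e, he⟩ | ⟨e, he⟩
    · rw [he] at hprod hc0
      have h1 : (s ^ 2 - s + 1) * e = b ^ 2 := by linarith
      obtain ⟨c, hc | hc⟩ := Int.sq_of_isCoprime (IsCoprime.of_mul_left_right hc0).symm h1
      · rcases eq_of_sq_add_self_add_one (s := -s) (c := c) (by rw [← hc]; ring) with h | h
        · nlinarith
        · have : s = 1 := by omega
          subst this; norm_num
      · nlinarith [sq_nonneg c]
    · rw [he] at hprod hc0
      have h1 : (s ^ 2 + s + 1) * e = b ^ 2 := by linarith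
      obtain ⟨c, hc | hc⟩ := Int.sq_of_isCoprime (IsCoprime.of_mul_right_right hc0) h1
      · rcases eq_of_sq_add_self_add_one hc with h | h <;> subst h <;> norm_num
      · nlinarith [sq_nonneg c]
  · have hcop : IsCoprime (s ^ 2 - 1) (s ^ 4 + s ^ 2 + 1) := by
      have h3' : IsCoprime (s ^ 2 - 1) 3 := ((Int.prime_three.coprime_iff_not_dvd).2 h3).symm
      have : s ^ 4 + s ^ 2 + 1 = 3 + (s ^ 2 + 2) * (s ^ 2 - 1) := by ring
      rw [this]
      exact h3'.add_mul_right_right _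
    have hpos : 0 < s ^ 4 + s ^ 2 + 1 := by positivity
    obtain ⟨c, hc⟩ := isSquare_of_mul_eq_two_mul_sq hcop hodd hpos (z := z) (by rw [← h]; ring)
    by_contra! hs
    have h1 : c ^ 2 < (s ^ 2 + 1) ^ 2 := by nlinarith
    have h2 : (s ^ 2) ^ 2 < c ^ 2 := by nlinarith
    have := abs_lt_of_sq_lt_sq h1 (by positivity)
    have h3 := abs_lt_of_sq_lt_sq (a := s ^ 2) (b := |c|) (by rwa [sq_abs]) (by positivity)
    rw [abs_of_pos (by linarith)] at h3
    omega

theorem exists_pow_six_of_mul_eq {a b s : ℤ} (hab : IsCoprime a b) (h : a * b = s ^ 6) :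
    ∃ x, a = x ^ 6 ∨ a = -x ^ 6 := by
  obtain ⟨x, hx⟩ := exists_associated_pow_of_mul_eq_pow' hab h
  rcases Int.associated_iff.1 hx with h | h
  · exact ⟨x, Or.inl h.symm⟩
  · exact ⟨x, Or.inr (by linarith)⟩

theorem sq_le_one_of_eight_mul_pow_six_add_one {s z : ℤ} (h : 8 * s ^ 6 + 1 = z ^ 2) :
    s ^ 2 ≤ 1 := by
  have hz : Odd z := by
    have : Odd (z ^ 2) := by rw [← h]; exact ⟨4 * s ^ 6, by ring⟩
    exact (Int.odd_pow' two_ne_zero).1 this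
  obtain ⟨m, rfl⟩ := hz
  have hm : m * (m + 1) = 2 * s ^ 6 := by linarith
  have s6 : s ^ 6 ≤ 1 → s ^ 2 ≤ 1 := by
    intro h
    by_contra! hs
    have : 2 ^ 3 ≤ (s ^ 2) ^ 3 := pow_le_pow_left₀ (by norm_num) hs 3
    rw [← pow_mul] at this; norm_num at this; linarith
  have key : ∀ x y : ℤ, (y ^ 6 - 1 = 2 * x ^ 6 ∨ y ^ 6 + 1 = 2 * x ^ 6) →
      y ^ 6 ≤ 1 ∧ x ^ 6 ≤ 1 := by
    intro x y hxy
    have hy : y ^ 2 ≤ 1 := by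
      rcases hxy with h | h
      · exact sq_le_one_of_pow_six_sub_one (z := x ^ 3) (by rw [h]; ring)
      · exact sq_le_one_of_pow_six_add_one (z := x ^ 3) (by rw [h]; ring)
    have : y ^ 6 ≤ 1 := by
      have := pow_le_one₀ (n := 3) (sq_nonneg y) hy
      rwa [← pow_mul] at this
    refine ⟨this, ?_⟩
    rcases hxy with h | h <;> linarith
  have fin : ∀ a b : ℤ, a * b = s ^ 6 → a ≤ 1 → -1 ≤ a → b ≤ 1 → -1 ≤ b → s ^ 2 ≤ 1 := by
    intro a b h h1 h2 h3 h4
    apply s6; rw [← h]; nlinarith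
  rcases Int.even_or_odd' m with ⟨k, rfl | rfl⟩
  · have h1 : k * (2 * k + 1) = s ^ 6 := by linarith
    have hc : IsCoprime k (2 * k + 1) := ⟨-2, 1, by ring⟩
    obtain ⟨x, hx⟩ := exists_pow_six_of_mul_eq hc h1
    obtain ⟨y, hy⟩ := exists_pow_six_of_mul_eq hc.symm (by rw [← h1]; ring)
    have hx0 : 0 ≤ x ^ 6 := by positivity
    have hy0 : 0 ≤ y ^ 6 := by positivity
    have h6 : y ^ 6 ≤ 1 ∧ x ^ 6 ≤ 1 := by
      apply key
      rcases hx with hx | hx <;> rcases hy with hy | hy <;> omega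
    apply fin _ _ h1 <;> omega
  · have h1 : (2 * k + 1) * (k + 1) = s ^ 6 := by linarith
    have hc : IsCoprime (2 * k + 1) (k + 1) := ⟨-1, 2, by ring⟩
    obtain ⟨y, hy⟩ := exists_pow_six_of_mul_eq hc h1
    obtain ⟨x, hx⟩ := exists_pow_six_of_mul_eq hc.symm (by rw [← h1]; ring)
    have hx0 : 0 ≤ x ^ 6 := by positivity
    have hy0 : 0 ≤ y ^ 6 := by positivity
    have h6 : y ^ 6 ≤ 1 ∧ x ^ 6 ≤ 1 := by
      apply key
      rcases hx with hx | hx <;> rcases hy with hy | hy <;> omega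
    apply fin _ _ h1 <;> omega

theorem eq_neg_one_or_zero_or_one_of_sq_le_one {s : ℤ} (h : s ^ 2 ≤ 1) :
    s = -1 ∨ s = 0 ∨ s = 1 := by
  have := abs_le_one_iff_mul_self_le_one.2 (by rwa [← pow_two] : s * s ≤ 1)
  have := abs_le.1 this
  omega

/-- The integral points on Heegner's curve that come from Pell-type equations are small. -/
theorem abs_le_twenty_of_heegner {A B N v : ℤ} (hN : N = A ^ 2 - 2 * B ^ 2)
    (hN' : N = 1 ∨ N = -1 ∨ N = 2 ∨ N = -2) (h : N ^ 2 * v ^ 3 = 32 * (A + B) * B ^ 3) :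
    |v| ≤ 20 := by
  have hN0 : N ≠ 0 := by omega
  by_cases hB : B = 0
  · have : v ^ 3 = 0 := by
      rw [hB] at h
      have : N ^ 2 * v ^ 3 = 0 := by rw [h]; ring
      simpa [hN0] using this
    simp [pow_eq_zero_iff] at this
    simp [this]
  have cube : ∀ u : ℤ, (8 * u) * B ^ 3 = v ^ 3 → ∃ w, v = 2 * B * w ∧ w ^ 3 = u := by
    intro u hu
    have : (2 * B) ^ 3 ∣ v ^ 3 := ⟨u, by rw [← hu]; ring⟩
    obtain ⟨w, hw⟩ := (Int.pow_dvd_pow_iff (by norm_num)).1 this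
    refine ⟨w, hw, ?_⟩
    have h8 : (8 * B ^ 3) * (w ^ 3) = (8 * B ^ 3) * u := by
      rw [hw] at hu; linarith
    exact mul_left_cancel₀ (by positivity) h8
  have bound : ∀ z e : ℤ, z ^ 2 ≤ e ^ 2 → 0 ≤ e → -e ≤ z ∧ z ≤ e := by
    intro z e h he
    exact abs_le.1 (abs_le_of_sq_le_sq h he)
  rw [abs_le]
  by_cases hN1 : N = 1 ∨ N = -1
  · have hN2 : N ^ 2 = 1 := by rcases hN1 with h | h <;> rw [h] <;> norm_num
    rw [hN2] at h
    obtain ⟨w, hw, hw3⟩ := cube (4 * (A + B)) (by linarith)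
    have : Even w := by
      have : Even (w ^ 3) := ⟨2 * (A + B), by rw [hw3]; ring⟩
      exact (Int.even_pow.1 this).1
    obtain ⟨c, rfl⟩ := this
    have hA : A = 2 * c ^ 3 - B := by linarith
    have hE : N = 8 * c ^ 6 - (B + 2 * c ^ 3) ^ 2 := by rw [hN, hA]; ring
    have hN1' : N = -1 := by
      rcases hN1 with h1 | h1
      · exfalso
        rw [h1] at hE
        have h4 : ((B + 2 * c ^ 3) ^ 2) % 8 = 7 := by omega
        generalize B + 2 * c ^ 3 = t at h4
        have : t % 8 = 0 ∨ t % 8 = 1 ∨ t % 8 = 2 ∨ t % 8 = 3 ∨ t % 8 = 4 ∨ t % 8 = 5 ∨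
          t % 8 = 6 ∨ t % 8 = 7 := by omega
        rcases this with h | h | h | h | h | h | h | h <;> simp [pow_two, Int.mul_emod, h] at h4
      · exact h1
    rw [hN1'] at hE
    have hc := eq_neg_one_or_zero_or_one_of_sq_le_one
      (sq_le_one_of_eight_mul_pow_six_add_one (s := c) (z := B + 2 * c ^ 3) (by linarith))
    rcases hc with rfl | rfl | rfl
    · have := bound (B + 2 * (-1) ^ 3) 3 (by linarith) (by norm_num)
      constructor <;> linarith
    · constructor <;> linarith
    · have := bound (B + 2 * 1 ^ 3) 3 (by linarith) (by norm_num)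
      constructor <;> linarith
  · have hN2 : N ^ 2 = 4 := by
      rcases hN' with h | h | h | h <;> first | omega | (rw [h]; norm_num)
    rw [hN2] at h
    obtain ⟨u, hu, hu3⟩ := cube (A + B) (by linarith)
    have hA : A = u ^ 3 - B := by linarith
    have hE : N = 2 * u ^ 6 - (u ^ 3 + B) ^ 2 := by rw [hN, hA]; ring
    have : Even (u ^ 3 + B) := by
      have : Even ((u ^ 3 + B) ^ 2) := by
        rw [Int.even_iff]
        omega
      exact (Int.even_pow.1 this).1
    obtain ⟨z, hz⟩ := this
    rw [hz] at hE
    have hc : u = -1 ∨ u = 0 ∨ u = 1 := by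
      apply eq_neg_one_or_zero_or_one_of_sq_le_one
      rcases hN' with h | h | h | h
      · omega
      · omega
      · exact sq_le_one_of_pow_six_sub_one (z := z) (by linarith)
      · exact sq_le_one_of_pow_six_add_one (z := z) (by linarith)
    rcases hc with rfl | rfl | rfl
    · have := bound z 1 (by rcases hN' with h | h | h | h <;> nlinarith) (by norm_num)
      constructor <;> linarith
    · constructor <;> linarith
    · have := bound z 1 (by rcases hN' with h | h | h | h <;> nlinarith) (by norm_num)
      constructor <;> linarith

theorem abs_exp_sub_one_sub_le {z : ℝ} (hz : |z| ≤ 1) : |Real.exp z - 1 - z| ≤ z ^ 2 :=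
  Real.abs_exp_sub_one_sub_id_le hz

theorem abs_exp_sub_cubic_le {z : ℝ} (hz : |z| ≤ 1) :
    |Real.exp z - (1 + z + z ^ 2 / 2 + z ^ 3 / 6)| ≤ z ^ 4 := by
  have := Real.exp_bound hz (n := 4) (by norm_num)
  norm_num [Finset.sum_range_succ, Nat.factorial] at this
  have h4 : |z| ^ 4 = z ^ 4 := by
    rw [show (4 : ℕ) = 2 * 2 by rfl, pow_mul, pow_mul, sq_abs]
  rw [h4] at this
  refine this.trans ?_
  nlinarith [sq_nonneg (z ^ 2)]

theorem abs_exp_sub_quadratic_le {z : ℝ} (hz : |z| ≤ 1) :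
    |Real.exp z - (1 + z + z ^ 2 / 2)| ≤ |z| ^ 3 := by
  have := Real.exp_bound hz (n := 3) (by norm_num)
  norm_num [Finset.sum_range_succ, Nat.factorial] at this
  refine this.trans ?_
  nlinarith [pow_nonneg (abs_nonneg z) 3]

set_option maxHeartbeats 800000 in
/-- Asymptotic expansion of the first Heegner coordinate. -/
theorem abs_cube_sub_le_of_exp {t e v : ℝ} (ht0 : t ≠ 0) (ht : |t| ≤ 1 / 1000)
    (he : |e| ≤ 100 * t ^ 4)
    (hv : t * v = Real.exp (t + t ^ 3 / 3 + e) - t ^ 2 / 2 * Real.exp (-(t + t ^ 3 / 3 + e)) - t) :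
    |v ^ 3 - (1 / t ^ 3 + 3)| ≤ 400 * |t| := by
  set T := |t| with hT
  have hT0 : 0 < T := abs_pos.2 ht0
  have h2 : t ^ 2 = T ^ 2 := (sq_abs t).symm
  have h4 : t ^ 4 = T ^ 4 := by
    rw [show (4 : ℕ) = 2 * 2 by rfl, pow_mul, pow_mul, h2]
  rw [h4] at he
  have hTT : T ^ 2 ≤ 1 / 10 ^ 6 := by
    calc T ^ 2 ≤ (1 / 1000) ^ 2 := by gcongr
      _ = _ := by norm_num
  have hTTT : T ^ 3 ≤ T * (1 / 10 ^ 6) := by rw [pow_succ']; gcongr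
  set y := t ^ 3 / 3 + e with hy
  have hy1 : |y| ≤ T ^ 3 := by
    refine (abs_add_le _ _).trans ?_
    rw [abs_div, abs_pow, abs_of_pos (by norm_num : (0 : ℝ) < 3)]
    have : T ^ 4 ≤ T ^ 3 * (1 / 1000) := by rw [pow_succ]; gcongr
    linarith [pow_pos hT0 3]
  rw [add_assoc t, ← hy] at hv
  have hyT : |y| ≤ T / 1000 := hy1.trans (by linarith)
  have hX : |t + y| ≤ 11 / 10 * T := (abs_add_le _ _).trans (by linarith)
  have hr1 := abs_exp_sub_cubic_le (z := t + y) (by linarith)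
  have hr2 := abs_exp_sub_one_sub_le (z := -(t + y)) (by rw [abs_neg]; linarith)
  set r1 := Real.exp (t + y) - (1 + (t + y) + (t + y) ^ 2 / 2 + (t + y) ^ 3 / 6) with hr1'
  set r2 := Real.exp (-(t + y)) - 1 - (-(t + y)) with hr2'
  have hX2 : (t + y) ^ 2 ≤ 2 * T ^ 2 := by
    rw [← sq_abs (t + y)]
    calc |t + y| ^ 2 ≤ (11 / 10 * T) ^ 2 := by gcongr
      _ = 121 / 100 * T ^ 2 := by ring
      _ ≤ 2 * T ^ 2 := by gcongr; norm_num
  have hr1b : |r1| ≤ 4 * T ^ 4 := hr1.trans (by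
    calc (t + y) ^ 4 = ((t + y) ^ 2) ^ 2 := by ring
      _ ≤ (2 * T ^ 2) ^ 2 := by gcongr
      _ = 4 * T ^ 4 := by ring)
  have hr2b : |r2| ≤ 2 * T ^ 2 := hr2.trans (by rw [neg_sq]; exact hX2)
  set ρ := t * v - (1 + t ^ 3) with hρ
  have hρe : ρ = e + t * y + y ^ 2 / 2 + t ^ 2 * y + t * y ^ 2 / 2 + y ^ 3 / 6 + r1
      - t ^ 2 * r2 / 2 := by
    rw [hρ, hv]
    have : e = y - t ^ 3 / 3 := by rw [hy]; ring
    rw [this, hr1', hr2']; ring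
  have hy2 : |y ^ 2| ≤ T ^ 4 := by
    rw [abs_pow]
    calc |y| ^ 2 ≤ (T ^ 3) ^ 2 := pow_le_pow_left₀ (abs_nonneg _) hy1 2
      _ = T ^ 4 * T ^ 2 := by ring
      _ ≤ T ^ 4 * 1 := by gcongr; linarith
      _ = T ^ 4 := by ring
  have b1 : |t * y| ≤ T ^ 4 := by
    rw [abs_mul]
    calc T * |y| ≤ T * T ^ 3 := by gcongr
      _ = _ := by ring
  have b3 : |t ^ 2 * y| ≤ T ^ 4 := by
    rw [pow_two, mul_assoc, abs_mul]
    exact (mul_le_of_le_one_left (abs_nonneg _) (by linarith)).trans b1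
  have b4 : |t * y ^ 2| ≤ T ^ 4 := by
    rw [abs_mul]
    exact (mul_le_of_le_one_left (abs_nonneg _) (by linarith)).trans hy2
  have b5 : |y ^ 3| ≤ T ^ 4 := by
    rw [pow_succ, abs_mul]
    exact (mul_le_of_le_one_right (abs_nonneg _) (by linarith)).trans hy2
  have b6 : |t ^ 2 * r2| ≤ 2 * T ^ 4 := by
    rw [abs_mul, abs_pow]
    calc T ^ 2 * |r2| ≤ T ^ 2 * (2 * T ^ 2) := by gcongr
      _ = _ := by ring
  have hρb : |ρ| ≤ 120 * T ^ 4 := by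
    rw [hρe]
    have hT4 := pow_pos hT0 4
    clear_value T ρ r1 r2 y
    clear hv hρe hr1' hr2' hX2 hr1 hr2 hX hy1 hyT
    have c0 := abs_le.1 he
    have c1 := abs_le.1 b1
    have c2 := abs_le.1 hy2
    have c3 := abs_le.1 b3
    have c4 := abs_le.1 b4
    have c5 := abs_le.1 b5
    have c6 := abs_le.1 hr1b
    have c7 := abs_le.1 b6
    rw [abs_le]
    constructor <;> linarith
  set δ := t ^ 3 + ρ with hδ
  have hδb : |δ| ≤ 2 * T ^ 3 := by
    refine (abs_add_le _ _).trans ?_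
    rw [abs_pow]
    have : T ^ 4 ≤ T ^ 3 * (1 / 1000) := by rw [pow_succ]; gcongr
    linarith [pow_pos hT0 3]
  have key : v ^ 3 - (1 / t ^ 3 + 3) = (3 * ρ + 3 * δ ^ 2 + δ ^ 3) / t ^ 3 := by
    have : t * v = 1 + δ := by rw [hδ, hρ]; ring
    have h3 : t ^ 3 * v ^ 3 = (1 + δ) ^ 3 := by rw [← this]; ring
    have hρ' : ρ = δ - t ^ 3 := by rw [hδ]; ring
    rw [hρ']
    field_simp
    linear_combination h3
  rw [key, abs_div, abs_pow, ← hT, div_le_iff₀ (by positivity)]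
  have c1 : |δ ^ 2| ≤ T ^ 4 := by
    rw [abs_pow]
    calc |δ| ^ 2 ≤ (2 * T ^ 3) ^ 2 := pow_le_pow_left₀ (abs_nonneg _) hδb 2
      _ = T ^ 4 * (4 * T ^ 2) := by ring
      _ ≤ T ^ 4 * 1 := by gcongr; linarith
      _ = T ^ 4 := by ring
  have c2 : |δ ^ 3| ≤ T ^ 4 := by
    have : |δ| ≤ 1 := hδb.trans (by linarith)
    rw [pow_succ, abs_mul]
    exact (mul_le_of_le_one_right (abs_nonneg _) this).trans c1
  have : 400 * T * T ^ 3 = 400 * T ^ 4 := by ring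
  rw [this]
  have d1 := abs_le.1 hρb
  have d2 := abs_le.1 c1
  have d3 := abs_le.1 c2
  rw [abs_le]
  constructor <;> linarith [pow_pos hT0 4]

/-- `exp (2 * x + 2 * δ) - 2 * x * exp (x + δ)` agrees with `1` to third order. -/
theorem abs_exp_two_mul_sub_le {x δ : ℝ} (hx : |x| ≤ 1 / 10) (hδ : |δ| ≤ 1 / 10) :
    |Real.exp (2 * (x + δ)) - 2 * x * Real.exp (x + δ) - 1| ≤ 20 * |x + δ| ^ 3 + 4 * |δ| := by
  have hz : |x + δ| ≤ 1 / 5 := (abs_add_le _ _).trans (by linarith)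
  set z := x + δ with hz'
  have h1 := abs_exp_sub_quadratic_le (z := 2 * z) (by rw [abs_mul]; norm_num; linarith)
  have h2 := abs_exp_sub_one_sub_le (z := z) (by linarith)
  have h3 : |(2 * δ) * Real.exp z| ≤ 4 * |δ| := by
    have : Real.exp z ≤ 2 := by
      have := (abs_le.1 h2).2
      have := (abs_le.1 hz)
      nlinarith
    rw [abs_mul, abs_mul, abs_of_pos (Real.exp_pos z)]
    norm_num
    nlinarith [abs_nonneg δ]
  have h4 : |2 * z * (Real.exp z - 1 - z)| ≤ 2 * |z| ^ 3 := by
    rw [abs_mul, abs_mul]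
    norm_num
    calc 2 * |z| * |Real.exp z - 1 - z| ≤ 2 * |z| * z ^ 2 := by gcongr
      _ = 2 * |z| ^ 3 := by rw [← sq_abs]; ring
  have h1' : |2 * z| ^ 3 = 8 * |z| ^ 3 := by rw [abs_mul]; norm_num; ring
  rw [h1'] at h1
  have : Real.exp (2 * z) - 2 * x * Real.exp z - 1 =
      (Real.exp (2 * z) - (1 + 2 * z + (2 * z) ^ 2 / 2))
      - 2 * z * (Real.exp z - 1 - z) + (2 * δ) * Real.exp z := by
    have : x = z - δ := by rw [hz']; ring
    rw [this]; ring
  rw [this]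
  have h0 := pow_nonneg (abs_nonneg z) 3
  rw [abs_le] at *
  constructor <;> linarith

theorem exists_pow_one_add_sqrt_two (n : ℕ) : ∃ a b : ℤ, (1 + √2) ^ n = a + b * √2 ∧
    (1 - √2) ^ n = a - b * √2 := by
  induction n with
  | zero => exact ⟨1, 0, by simp, by simp⟩
  | succ n ih =>
    obtain ⟨a, b, h1, h2⟩ := ih
    have h : √2 * √2 = (2 : ℝ) := Real.mul_self_sqrt (by norm_num)
    refine ⟨a + 2 * b, a + b, ?_, ?_⟩
    · rw [pow_succ, h1]; push_cast; linear_combination b * h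
    · rw [pow_succ, h2]; push_cast; linear_combination b * h

theorem exists_pow_two_add_sqrt_three (n : ℕ) : ∃ a b : ℤ,
    (1 + √3) * (2 + √3) ^ n = a + b * √3 ∧ (1 - √3) * (2 - √3) ^ n = a - b * √3 := by
  induction n with
  | zero => exact ⟨1, 1, by simp, by simp⟩
  | succ n ih =>
    obtain ⟨a, b, h1, h2⟩ := ih
    have h : √3 * √3 = (3 : ℝ) := Real.mul_self_sqrt (by norm_num)
    refine ⟨2 * a + 3 * b, a + 2 * b, ?_, ?_⟩
    · rw [pow_succ, ← mul_assoc, h1]; push_cast; linear_combination b * h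
    · rw [pow_succ, ← mul_assoc, h2]; push_cast; linear_combination b * h

/-- The quantity `R` built from `u = (1 + √2) ^ n` that approximates the cube of the
first Heegner coordinate. -/
noncomputable def heegnerCube (σ s u : ℝ) : ℝ :=
  σ * (u - s / u) ^ 3 * ((√2 + σ) * u + s * (√2 - σ) / u) / 2

theorem exists_int_heegnerCube {σ s : ℤ} (hσ : σ = 1 ∨ σ = -1) (hs : s = 1 ∨ s = -1) (n : ℕ) :
    ∃ A B N : ℤ, N = A ^ 2 - 2 * B ^ 2 ∧ (N = 1 ∨ N = -1 ∨ N = 2 ∨ N = -2) ∧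
      (N : ℝ) ^ 2 * heegnerCube σ s ((1 + √2) ^ n) = 32 * (A + B) * B ^ 3 := by
  obtain ⟨a, b, h1, h2⟩ := exists_pow_one_add_sqrt_two n
  have h : √2 * √2 = (2 : ℝ) := Real.mul_self_sqrt (by norm_num)
  have hprod : ((1 + √2) ^ n) * (1 - √2) ^ n = ((-1) ^ n : ℝ) := by
    rw [← mul_pow]; congr 1; linear_combination -h
  have hu : 0 < (1 + √2) ^ n := by positivity
  have hnorm : a ^ 2 - 2 * b ^ 2 = (-1) ^ n := by
    rw [h1, h2] at hprod
    have : ((a ^ 2 - 2 * b ^ 2 : ℤ) : ℝ) = (((-1) ^ n : ℤ) : ℝ) := by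
      push_cast; rw [← hprod]; linear_combination b ^ 2 * h
    exact_mod_cast this
  have hσ2 : (σ : ℝ) * σ = 1 := by rcases hσ with rfl | rfl <;> norm_num
  have h4 : √2 ^ 4 = (4 : ℝ) := by linear_combination (√2 * √2 + 2) * h
  by_cases hns : (-1) ^ n = s
  · have hinv : (s : ℝ) / (1 + √2) ^ n = a - b * √2 := by
      rw [← h2, div_eq_iff hu.ne', ← hns]; push_cast; rw [← hprod]; ring
    have hσ2' : σ ^ 2 = 1 := by rcases hσ with rfl | rfl <;> norm_num
    refine ⟨σ * a, b, s, ?_, by omega, ?_⟩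
    · rw [mul_pow, hσ2', ← hns, ← hnorm]; ring
    · have hs2 : (s : ℝ) ^ 2 = 1 := by rcases hs with rfl | rfl <;> norm_num
      have e : (√2 + σ) * (1 + √2) ^ n + s * (√2 - σ) / (1 + √2) ^ n =
          (√2 + σ) * (a + b * √2) + (√2 - σ) * (a - b * √2) := by
        rw [← hinv, h1]; ring
      rw [hs2, heegnerCube, e, hinv, h1]
      push_cast
      linear_combination 8 * σ * b ^ 3 * (a + σ * b) * h4 + 32 * b ^ 4 * hσ2
  · have hns' : (-1) ^ n = -s := by
      rcases neg_one_pow_eq_or ℤ n with h | h <;> omega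
    have hinv : (s : ℝ) / (1 + √2) ^ n = -(a - b * √2) := by
      have : (s : ℝ) = - (-1) ^ n := by
        have : s = - (-1) ^ n := by omega
        exact_mod_cast this
      rw [← h2, div_eq_iff hu.ne', this, ← hprod]; ring
    have hσ2' : σ ^ 2 = 1 := by rcases hσ with rfl | rfl <;> norm_num
    refine ⟨2 * σ * b, a, 2 * s, ?_, by omega, ?_⟩
    · rw [mul_pow, mul_pow, hσ2', ← neg_neg s, ← hns', ← hnorm]; ring
    · have hs2 : (s : ℝ) ^ 2 = 1 := by rcases hs with rfl | rfl <;> norm_num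
      have e : (√2 + σ) * (1 + √2) ^ n + s * (√2 - σ) / (1 + √2) ^ n =
          (√2 + σ) * (a + b * √2) - (√2 - σ) * (a - b * √2) := by
        rw [sub_eq_add_neg _ ((√2 - σ) * (a - b * √2)), ← mul_neg, ← hinv, h1]; ring
      push_cast
      rw [mul_pow, hs2, heegnerCube, e, hinv, h1]
      linear_combination 32 * σ * a ^ 3 * b * h + 32 * a ^ 4 * hσ2

set_option maxHeartbeats 800000 in
theorem abs_heegnerCube_sub_le {σ s : ℝ} (hσ : σ = 1 ∨ σ = -1) (hs : s = 1 ∨ s = -1)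
    {u Q C ε : ℝ} (hu : 0 < u) (hQ0 : 0 < Q) (hQ : Q ≤ 1 / 10 ^ 6)
    (hC : C ^ 2 = 16 + 8 * σ * √2) (hC0 : 0 < C * (σ * s)) (hε : |ε| ≤ 100 * Q ^ 3)
    (h : 4 * Real.log u + σ * Real.log (1 + √2) =
      -2 * Real.log Q - Real.log 2 / 2 + C * Q + ε) :
    |heegnerCube σ s u - (σ / (2 * √2 * Q ^ 2) + 3)| ≤ 1000 * Q := by
  have h2 : √2 * √2 = (2 : ℝ) := Real.mul_self_sqrt (by norm_num)
  have hl : 1.41 < √2 := Real.lt_sqrt_of_sq_lt (by norm_num)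
  have hl' : √2 < 1.42 := (Real.sqrt_lt' (by norm_num)).2 (by norm_num)
  have hσ2 : σ * σ = 1 := by rcases hσ with rfl | rfl <;> norm_num
  have hs2 : s * s = 1 := by rcases hs with rfl | rfl <;> norm_num
  have hpos : 0 < √2 + σ := by rcases hσ with rfl | rfl <;> linarith
  have hpos' : 0.41 < √2 - σ := by rcases hσ with rfl | rfl <;> linarith
  have hCle : |C| ≤ 6 := by
    apply abs_le_of_sq_le_sq _ (by norm_num)
    rw [hC]; rcases hσ with rfl | rfl <;> linarith
  set g := √(1 / (√2 * Q ^ 2)) with hg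
  have hgsq : g ^ 2 = 1 / (√2 * Q ^ 2) := Real.sq_sqrt (by positivity)
  have hg0 : 0 < g := Real.sqrt_pos.2 (by positivity)
  set x := C * Q / 2 with hx
  set δ := ε / 2 with hδ
  set E := (√2 + σ) * u ^ 4 with hE
  have hlogE : Real.log E = 2 * Real.log g + 2 * (x + δ) := by
    have e1 : 2 * Real.log g = - (Real.log 2 / 2) - 2 * Real.log Q := by
      rw [← Real.log_sqrt (by norm_num : (0 : ℝ) ≤ 2)]
      have : Real.log (g ^ 2) = 2 * Real.log g := by rw [Real.log_pow]; norm_num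
      rw [← this, hgsq, one_div, Real.log_inv, Real.log_mul (by positivity) (by positivity),
        Real.log_pow]
      push_cast; ring
    have e2 : Real.log (√2 + σ) = σ * Real.log (1 + √2) := by
      rcases hσ with rfl | rfl
      · rw [one_mul, add_comm]
      · rw [neg_one_mul, ← Real.log_inv]
        congr 1
        rw [eq_comm, inv_eq_iff_eq_inv, eq_comm, inv_eq_of_mul_eq_one_right]
        linear_combination h2
    rw [hE, Real.log_mul hpos.ne' (by positivity), Real.log_pow, e2, e1, hx, hδ]
    push_cast
    linarith
  have hE0 : 0 < E := by positivity
  have hEexp : E = g ^ 2 * Real.exp (2 * (x + δ)) := by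
    rw [← Real.exp_log hE0, hlogE, Real.exp_add, ← Real.log_rpow hg0, Real.exp_log (by positivity)]
    norm_cast
  set β := √(√2 - σ) with hβ
  have hβ2 : β * β = √2 - σ := Real.mul_self_sqrt (by linarith)
  have hβ0 : 0 < β := Real.sqrt_pos.2 (by linarith)
  have hX : u ^ 2 = β * (g * Real.exp (x + δ)) := by
    have e1 : (u ^ 2) ^ 2 = (β * (g * Real.exp (x + δ))) ^ 2 := by
      have : (β * (g * Real.exp (x + δ))) ^ 2 = (√2 - σ) * E := by
        have e2 : Real.exp (2 * (x + δ)) = Real.exp (x + δ) ^ 2 := by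
          rw [two_mul, Real.exp_add, pow_two]
        rw [hEexp, ← hβ2, e2]
        generalize Real.exp (x + δ) = w
        ring
      rw [this, hE]
      linear_combination (-u ^ 4) * h2 + u ^ 4 * hσ2
    exact (pow_left_inj₀ (by positivity) (by positivity) two_ne_zero).1 e1
  have hκ : s * (2 * √2 + 4 * σ) * β = 2 * x * g := by
    have hsq : (s * (2 * √2 + 4 * σ) * β) ^ 2 = (2 * x * g) ^ 2 := by
      have e1 : (2 * x * g) ^ 2 = (16 + 8 * σ * √2) / √2 := by
        rw [mul_pow, hgsq, hx, ← hC]; field_simp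
      have e2 : (s * (2 * √2 + 4 * σ) * β) ^ 2 = (2 * √2 + 4 * σ) ^ 2 * (√2 - σ) := by
        rw [← hβ2]; linear_combination ((2 * √2 + 4 * σ) ^ 2 * (β * β)) * hs2
      rw [e1, e2, eq_div_iff (by positivity)]
      have h4 : √2 ^ 4 = (4 : ℝ) := by linear_combination (√2 * √2 + 2) * h2
      rcases hσ with rfl | rfl
      · linear_combination (12 * √2) * h2 + 4 * h4
      · linear_combination (-12 * √2) * h2 + 4 * h4
    rcases sq_eq_sq_iff_eq_or_eq_neg.1 hsq with h | h
    · exact h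
    · exfalso
      have e3 : 0 < σ * (2 * √2 + 4 * σ) := by rcases hσ with rfl | rfl <;> linarith
      have e4 : (σ * s) * (2 * x * g) = C * (σ * s) * (Q * g) := by rw [hx]; ring
      have e5 : 0 < C * (σ * s) * (Q * g) := by positivity
      have e6 : (σ * s) * (s * (2 * √2 + 4 * σ) * β) = σ * (2 * √2 + 4 * σ) * β := by
        linear_combination (σ * (2 * √2 + 4 * σ) * β) * hs2
      have e7 : 0 < σ * (2 * √2 + 4 * σ) * β := by positivity
      rw [← e6, h, mul_neg, e4] at e7
      linarith
  set W := Real.exp (2 * (x + δ)) - 2 * x * Real.exp (x + δ) - 1 with hW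
  have hQ3 : Q ^ 3 ≤ Q * (1 / 10 ^ 12) := by
    rw [pow_succ']; gcongr
    calc Q ^ 2 ≤ (1 / 10 ^ 6) ^ 2 := by gcongr
      _ = _ := by norm_num
  have hxb : |x| ≤ 3 * Q := by
    rw [hx, abs_div, abs_mul, abs_of_pos hQ0, abs_of_pos (by norm_num : (0 : ℝ) < 2)]
    have := mul_le_mul_of_nonneg_right hCle hQ0.le
    linarith
  have hδb : |δ| ≤ 50 * Q ^ 3 := by
    rw [hδ, abs_div, abs_of_pos (by norm_num : (0 : ℝ) < 2)]; linarith
  have hz : |x + δ| ≤ 4 * Q := (abs_add_le _ _).trans (by linarith)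
  have hWb : |W| ≤ 1500 * Q ^ 3 := by
    refine (abs_exp_two_mul_sub_le (by linarith) (by linarith)).trans ?_
    have : |x + δ| ^ 3 ≤ (4 * Q) ^ 3 := by gcongr
    rw [mul_pow] at this
    linarith [pow_pos hQ0 3]
  set X := u ^ 2 with hXdef
  have hX0 : 0 < X := by positivity
  have hXb : 1 ≤ 4 * Q * X := by
    have e1 : (1 / 4) ^ 2 ≤ (Q * X) ^ 2 := by
      have e2 : X ^ 2 = (√2 - σ) * (g ^ 2 * Real.exp (2 * (x + δ))) := by
        rw [← hEexp, hE, hXdef]; linear_combination (-u ^ 4) * h2 + u ^ 4 * hσ2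
      have e3 : 0.9 ≤ Real.exp (2 * (x + δ)) := by
        have := Real.add_one_le_exp (2 * (x + δ))
        have := (abs_le.1 hz).1
        linarith
      have e4 : (Q * X) ^ 2 = (√2 - σ) * Real.exp (2 * (x + δ)) / √2 := by
        rw [mul_pow, e2, hgsq]; field_simp
      rw [e4, le_div_iff₀ (by positivity)]
      have := mul_le_mul hpos'.le e3 (by norm_num) (by linarith)
      linarith
    have := (pow_le_pow_iff_left₀ (by norm_num) (by positivity) two_ne_zero).1 e1
    linarith
  have hinv : 1 / X ≤ 4 * Q := by rw [div_le_iff₀ hX0]; exact hXb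
  have hinv0 : 0 < 1 / X := by positivity
  have hR : 2 * σ * heegnerCube σ s u = E - s * X * (2 * √2 + 4 * σ) + 6 * σ
      + s * (2 * √2 - 4 * σ) * (1 / X) - (√2 - σ) * (1 / X) * (1 / X) := by
    rw [hE, hXdef, heegnerCube]
    rcases hs with rfl | rfl <;> rcases hσ with rfl | rfl <;> field_simp <;> ring
  have hE2 : E - s * X * (2 * √2 + 4 * σ) = g ^ 2 * (1 + W) := by
    rw [hEexp, hX, hW]
    linear_combination (-(g * Real.exp (x + δ))) * hκ
  have hgW : |g ^ 2 * W| ≤ 1500 / 1.41 * Q := by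
    rw [abs_mul, abs_of_pos (by positivity : 0 < g ^ 2), hgsq]
    rw [one_div, inv_mul_le_iff₀ (by positivity)]
    refine hWb.trans ?_
    have : √2 * Q ^ 2 * (1500 / 1.41 * Q) = (√2 / 1.41) * (1500 * Q ^ 3) := by ring
    rw [this]
    have : 1 ≤ √2 / 1.41 := by rw [le_div_iff₀ (by norm_num)]; linarith
    exact le_mul_of_one_le_left (by positivity) this
  have hl3 : |s * (2 * √2 - 4 * σ)| ≤ 7 := by
    rw [abs_le]
    rcases hs with rfl | rfl <;> rcases hσ with rfl | rfl <;> constructor <;> linarith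
  have ht1 : |s * (2 * √2 - 4 * σ) * (1 / X)| ≤ 28 * Q := by
    rw [abs_mul, abs_of_pos hinv0]
    have := mul_le_mul hl3 hinv hinv0.le (by norm_num)
    linarith
  have hσle : √2 - σ ≤ 3 := by rcases hσ with rfl | rfl <;> linarith
  have ht2 : |(√2 - σ) * (1 / X) * (1 / X)| ≤ Q := by
    rw [abs_of_pos (by have : 0 < √2 - σ := by linarith
                       positivity)]
    calc (√2 - σ) * (1 / X) * (1 / X) ≤ 3 * (4 * Q) * (4 * Q) := by gcongr
      _ = Q * (48 * Q) := by ring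
      _ ≤ Q * 1 := by gcongr; linarith
      _ = Q := mul_one Q
  have hfin : heegnerCube σ s u - (σ / (2 * √2 * Q ^ 2) + 3) =
      σ / 2 * (g ^ 2 * W + s * (2 * √2 - 4 * σ) * (1 / X) - (√2 - σ) * (1 / X) * (1 / X)) := by
    have e1 : heegnerCube σ s u = σ / 2 * (2 * σ * heegnerCube σ s u) := by
      linear_combination (-heegnerCube σ s u) * hσ2
    have e2 : σ / (2 * √2 * Q ^ 2) = σ / 2 * g ^ 2 := by rw [hgsq]; field_simp
    rw [e1, hR, hE2, e2]
    linear_combination 3 * hσ2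
  have hσ' : |σ / 2| = 1 / 2 := by rcases hσ with rfl | rfl <;> norm_num [abs_of_pos]
  rw [hfin, abs_mul, hσ']
  have f1 := abs_sub (g ^ 2 * W + s * (2 * √2 - 4 * σ) * (1 / X)) ((√2 - σ) * (1 / X) * (1 / X))
  have f2 := abs_add_le (g ^ 2 * W) (s * (2 * √2 - 4 * σ) * (1 / X))
  have f3 : (1500 : ℝ) / 1.41 * Q ≤ 1079 * Q := by gcongr; norm_num
  linarith

set_option maxHeartbeats 1000000 in
/-- The two logarithmic relations are incompatible when `P` and `Q` are tiny. -/
theorem false_of_log_relations {σ s : ℤ} (hσ : σ = 1 ∨ σ = -1) (hs : s = 1 ∨ s = -1)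
    {n m : ℤ} {h P Q C ε₁ ε₂ : ℝ} (h0 : 0 < h) (hh : h ≤ 1 / 10 ^ 4) (hP : P = h ^ 2)
    (hQ : Q = h ^ 3) (hC : C ^ 2 = 16 + 8 * σ * √2) (hC0 : 0 < C * (σ * s))
    (hε₁ : |ε₁| ≤ 100 * Q ^ 3) (hε₂ : |ε₂| ≤ 400 * P ^ 4)
    (hlog₁ : (4 * n + σ) * Real.log (1 + √2) =
      -2 * Real.log Q - Real.log 2 / 2 + C * Q + ε₁)
    (hlog₂ : (2 * m + 1) * Real.log (2 + √3) =
      -2 * Real.log P + σ * (2 * √2 * P + 4 * √2 / 3 * P ^ 3) + ε₂) : False := by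
  have h2 : √2 * √2 = (2 : ℝ) := Real.mul_self_sqrt (by norm_num)
  have h3 : √3 * √3 = (3 : ℝ) := Real.mul_self_sqrt (by norm_num)
  have hl : 1.41 < √2 := Real.lt_sqrt_of_sq_lt (by norm_num)
  have hl' : √2 < 1.42 := (Real.sqrt_lt' (by norm_num)).2 (by norm_num)
  have hP0 : 0 < P := by rw [hP]; positivity
  have hQ0 : 0 < Q := by rw [hQ]; positivity
  have hPle : P ≤ 1 / 10 ^ 8 := by
    rw [hP]
    calc h ^ 2 ≤ (1 / 10 ^ 4) ^ 2 := by gcongr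
      _ = _ := by norm_num
  have hQle : Q ≤ 1 / 10 ^ 12 := by
    rw [hQ]
    calc h ^ 3 ≤ (1 / 10 ^ 4) ^ 3 := by gcongr
      _ = _ := by norm_num
  have hσ2 : (σ : ℝ) * σ = 1 := by rcases hσ with rfl | rfl <;> norm_num
  have hσabs : |(σ : ℝ)| = 1 := by rcases hσ with rfl | rfl <;> norm_num
  have hlogsmall : ∀ x : ℝ, 0 < x → x ≤ 1 / 10 ^ 6 → 5 ≤ -Real.log x := by
    intro x hx hx1
    have h1 : Real.log x ≤ Real.log (Real.exp (-5)) := by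
      apply Real.log_le_log hx
      refine hx1.trans ?_
      rw [Real.exp_neg, one_div]
      apply inv_anti₀ (Real.exp_pos 5)
      have : Real.exp 5 = Real.exp 1 ^ 5 := by rw [← Real.exp_nat_mul]; norm_num
      rw [this]
      calc Real.exp 1 ^ 5 ≤ 3 ^ 5 := by
            gcongr; exact Real.exp_one_lt_d9.le.trans (by norm_num)
        _ ≤ 10 ^ 6 := by norm_num
    rw [Real.log_exp] at h1; linarith
  have hL1 : 0 < Real.log (1 + √2) := Real.log_pos (by linarith)
  have hl3 : 1 < √3 := Real.lt_sqrt_of_sq_lt (by norm_num)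
  have hL2 : 0 < Real.log (2 + √3) := Real.log_pos (by linarith)
  have hCle : |C| ≤ 6 := by
    apply abs_le_of_sq_le_sq _ (by norm_num)
    rw [hC]; rcases hσ with rfl | rfl <;> norm_num <;> linarith
  have hn : 0 ≤ n := by
    have hlog2 : Real.log 2 ≤ 1 := by
      have := Real.log_le_sub_one_of_pos (show (0 : ℝ) < 2 by norm_num); linarith
    have h1 := hlogsmall Q hQ0 (hQle.trans (by norm_num))
    have hCQ : |C * Q| ≤ 1 := by
      rw [abs_mul, abs_of_pos hQ0]
      exact (mul_le_mul hCle hQle hQ0.le (by norm_num)).trans (by norm_num)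
    have hQ3 : Q ^ 3 ≤ 1 / 1000 := by
      calc Q ^ 3 ≤ (1 / 10 ^ 12) ^ 3 := by gcongr
        _ ≤ _ := by norm_num
    have hpos : 0 < (4 * n + σ) * Real.log (1 + √2) := by
      rw [hlog₁]
      have := abs_le.1 hCQ
      have := abs_le.1 hε₁
      linarith
    have : (0 : ℝ) < 4 * n + σ := pos_of_mul_pos_left hpos hL1.le
    have : 0 < 4 * n + σ := by exact_mod_cast this
    omega
  obtain ⟨n, rfl⟩ := Int.eq_ofNat_of_zero_le hn
  set t := σ * √2 * P with ht
  have htabs : |t| = √2 * P := by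
    rw [ht, abs_mul, abs_mul, hσabs, abs_of_pos hP0, abs_of_pos (by positivity : 0 < √2), one_mul]
  have ht0 : t ≠ 0 := by
    rw [← abs_pos, htabs]; positivity
  have htle : |t| ≤ 2 / 10 ^ 8 := by
    rw [htabs]
    exact (mul_le_mul hl'.le hPle hP0.le (by norm_num)).trans (by norm_num)
  have ht2 : t ^ 2 = 2 * P ^ 2 := by
    rw [ht]; linear_combination P ^ 2 * σ * σ * h2 + 2 * P ^ 2 * hσ2
  have ht4 : t ^ 4 = 4 * P ^ 4 := by
    rw [show (4 : ℕ) = 2 * 2 by rfl, pow_mul, ht2]; ring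
  have ht3 : t ^ 3 = 2 * σ * √2 * P ^ 3 := by
    rw [pow_succ, ht2, ht]; ring
  have hlog₂' : (2 * m + 1) * Real.log (2 + √3) =
      -2 * Real.log P + 2 * (t + t ^ 3 / 3) + ε₂ := by
    rw [hlog₂, ht3, ht]; ring
  have hm : 0 ≤ m := by
    have h1 := hlogsmall P hP0 (hPle.trans (by norm_num))
    have hP3 : P ^ 3 ≤ 1 / 1000 := by
      calc P ^ 3 ≤ (1 / 10 ^ 8) ^ 3 := by gcongr
        _ ≤ _ := by norm_num
    have hP4 : P ^ 4 ≤ 1 / 1000 := by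
      calc P ^ 4 ≤ (1 / 10 ^ 8) ^ 4 := by gcongr
        _ ≤ _ := by norm_num
    have ht3' : |t ^ 3| ≤ 1 := by
      rw [abs_pow]
      exact pow_le_one₀ (abs_nonneg _) (htle.trans (by norm_num))
    have hpos : 0 < (2 * m + 1) * Real.log (2 + √3) := by
      rw [hlog₂']
      have := abs_le.1 htle
      have := abs_le.1 ht3'
      have := abs_le.1 hε₂
      linarith
    have : (0 : ℝ) < 2 * m + 1 := pos_of_mul_pos_left hpos hL2.le
    have : 0 < 2 * m + 1 := by exact_mod_cast this
    omega
  obtain ⟨m, rfl⟩ := Int.eq_ofNat_of_zero_le hm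
  push_cast at hlog₁ hlog₂'
  obtain ⟨a, b, hab, hab'⟩ := exists_pow_two_add_sqrt_three m
  set θ := (1 + √3) * (2 + √3) ^ m with hθ
  have hθ0 : 0 < θ := by positivity
  set e := ε₂ / 2 with he
  have hlogθ : Real.log θ = Real.log (√2 / P) + (t + t ^ 3 / 3 + e) := by
    have e1 : 2 * Real.log θ = Real.log 2 + (2 * m + 1) * Real.log (2 + √3) := by
      have e2 : θ ^ 2 = 2 * (2 + √3) ^ (2 * m + 1) := by
        rw [hθ, mul_pow, ← pow_mul, mul_comm m 2, pow_succ]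
        linear_combination ((2 + √3) ^ (2 * m)) * h3
      have e3 : Real.log (θ ^ 2) = 2 * Real.log θ := by
        rw [Real.log_pow]; norm_num
      rw [← e3, e2, Real.log_mul (by norm_num) (by positivity), Real.log_pow]
      push_cast; ring
    rw [Real.log_div (by positivity) hP0.ne', Real.log_sqrt (by norm_num)]
    rw [he]; linarith
  have hθexp : θ = √2 / P * Real.exp (t + t ^ 3 / 3 + e) := by
    rw [← Real.exp_log hθ0, hlogθ, Real.exp_add, Real.exp_log (by positivity)]
  have hθinv : a - b * √3 = -2 / θ := by
    rw [← hab', eq_div_iff hθ0.ne', hθ]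
    have : (1 - √3) * (2 - √3) ^ m * ((1 + √3) * (2 + √3) ^ m) =
      ((1 - √3) * (1 + √3)) * ((2 - √3) * (2 + √3)) ^ m := by rw [mul_pow]; ring
    rw [this, show (2 - √3) * (2 + √3) = 1 by linear_combination -h3, one_pow]
    linear_combination -h3
  have hainv : -2 / θ = - (√2 * P) * Real.exp (-(t + t ^ 3 / 3 + e)) := by
    rw [hθexp, Real.exp_neg]
    have := Real.exp_pos (t + t ^ 3 / 3 + e)
    field_simp
    linear_combination h2
  set v : ℤ := σ * a - 1 with hv
  have hva : t * (v : ℝ) = Real.exp (t + t ^ 3 / 3 + e)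
      - t ^ 2 / 2 * Real.exp (-(t + t ^ 3 / 3 + e)) - t := by
    have ha : (a : ℝ) = (θ + -2 / θ) / 2 := by rw [← hθinv, hab]; ring
    have e1 : P * (√2 / P) = √2 := by field_simp
    rw [hv]; push_cast
    rw [ha, hainv, hθexp, ht2]
    generalize Real.exp (t + t ^ 3 / 3 + e) = w
    generalize Real.exp (-(t + t ^ 3 / 3 + e)) = w'
    rw [ht]
    linear_combination (√2 * w / 2) * e1 + (w / 2 - P ^ 2 * w' / 2) * h2 +
      (√2 * P / 2 * (√2 / P * w - √2 * P * w')) * hσ2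
  have hvb := abs_cube_sub_le_of_exp ht0 (htle.trans (by norm_num))
    (by rw [ht4, he, abs_div, abs_of_pos (by norm_num : (0 : ℝ) < 2)]
        linarith [pow_pos hP0 4]) hva
  obtain ⟨A, B, N, hN, hN', hR⟩ := exists_int_heegnerCube hσ hs n
  have hRb := abs_heegnerCube_sub_le (σ := σ) (s := s) (u := (1 + √2) ^ n)
    (by rcases hσ with rfl | rfl <;> norm_num) (by rcases hs with rfl | rfl <;> norm_num)
    (by positivity) hQ0 (hQle.trans (by norm_num)) hC hC0 hε₁
    (by rw [Real.log_pow, ← hlog₁]; ring)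
  have hPQ : (1 : ℝ) / t ^ 3 = σ / (2 * √2 * Q ^ 2) := by
    have e1 : P ^ 3 = Q ^ 2 := by rw [hP, hQ]; ring
    rw [ht3, e1, div_eq_div_iff (by rw [← e1, ← ht3]; positivity) (by positivity)]
    linear_combination (-2 * √2 * Q ^ 2) * hσ2
  rw [hPQ] at hvb
  set R := heegnerCube σ s ((1 + √2) ^ n) with hRdef
  have hdiff : |(v : ℝ) ^ 3 - R| < 1 / 4 := by
    have := abs_sub_le ((v : ℝ) ^ 3) (σ / (2 * √2 * Q ^ 2) + 3) R
    rw [abs_sub_comm R] at hRb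
    linarith
  have hN4 : (N : ℝ) ^ 2 ≤ 4 ∧ 0 < (N : ℝ) ^ 2 := by
    rcases hN' with h | h | h | h <;> rw [h] <;> norm_num
  have heq : N ^ 2 * v ^ 3 = 32 * (A + B) * B ^ 3 := by
    have : |((N ^ 2 * v ^ 3 - 32 * (A + B) * B ^ 3 : ℤ) : ℝ)| < 1 := by
      push_cast
      rw [← hR, ← mul_sub, abs_mul, abs_of_pos hN4.2]
      have := mul_le_mul_of_nonneg_right hN4.1 (abs_nonneg ((v : ℝ) ^ 3 - R))
      linarith
    have : |N ^ 2 * v ^ 3 - 32 * (A + B) * B ^ 3| < 1 := by exact_mod_cast this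
    have := Int.abs_lt_one_iff.1 this
    linarith
  have hv20 := abs_le_twenty_of_heegner hN hN' heq
  have hv20' : |(v : ℝ)| ≤ 20 := by exact_mod_cast hv20
  have hbig : 10 ^ 6 ≤ |t * (v : ℝ) / t| := by
    have hx : |t + t ^ 3 / 3 + e| ≤ 1 / 10 := by
      have e1 : |t ^ 3 / 3| ≤ |t| := by
        rw [abs_div, abs_pow, abs_of_pos (by norm_num : (0 : ℝ) < 3)]
        have : |t| ^ 3 ≤ |t| * 1 := by
          rw [pow_succ']; gcongr
          exact pow_le_one₀ (abs_nonneg _) (htle.trans (by norm_num))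
        linarith [abs_nonneg t]
      have e2 : |e| ≤ 200 * P := by
        rw [he, abs_div, abs_of_pos (by norm_num : (0 : ℝ) < 2)]
        have : P ^ 4 ≤ P * 1 := by
          rw [pow_succ']; gcongr
          exact pow_le_one₀ hP0.le (hPle.trans (by norm_num))
        linarith
      have := abs_add_le (t + t ^ 3 / 3) e
      have := abs_add_le t (t ^ 3 / 3)
      linarith
    have f1 := abs_le.1 (abs_exp_sub_one_sub_le (hx.trans (by norm_num)))
    have f2 := abs_le.1 (abs_exp_sub_one_sub_le (z := -(t + t ^ 3 / 3 + e))
      (by rw [abs_neg]; exact hx.trans (by norm_num)))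
    have f3 := abs_le.1 hx
    have f4 := abs_le.1 htle
    have f5 : 1 / 2 ≤ t * (v : ℝ) := by
      have f6 : t ^ 2 / 2 * Real.exp (-(t + t ^ 3 / 3 + e)) ≤ 1 / 100 * 3 := by
        refine mul_le_mul ?_ ?_ (Real.exp_pos _).le (by norm_num)
        · have : P ^ 2 ≤ 1 / 100 := by
            calc P ^ 2 ≤ (1 / 10 ^ 8) ^ 2 := by gcongr
              _ ≤ _ := by norm_num
          rw [ht2]; linarith
        · have : (-(t + t ^ 3 / 3 + e)) ^ 2 ≤ 1 := by
            rw [neg_sq, ← sq_abs]; exact pow_le_one₀ (abs_nonneg _) (hx.trans (by norm_num))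
          linarith
      have f7 : (t + t ^ 3 / 3 + e) ^ 2 ≤ 1 / 100 := by
        rw [← sq_abs]
        calc |t + t ^ 3 / 3 + e| ^ 2 ≤ (1 / 10) ^ 2 := by gcongr
          _ = _ := by norm_num
      rw [hva]
      linarith
    rw [abs_div, le_div_iff₀ (abs_pos.2 ht0), abs_of_pos (by linarith : 0 < t * (v : ℝ))]
    linarith
  rw [mul_div_cancel_left₀ _ ht0] at hbig
  linarith

namespace QuadraticAlgebra

theorem four_mul_norm {a b : ℤ} (z : QuadraticAlgebra ℤ a b) :
    4 * norm z = (2 * z.re + b * z.im) ^ 2 + -(b ^ 2 + 4 * a) * z.im ^ 2 := by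
  rw [norm_def]; ring

theorem norm_nonneg_of_disc_neg {a b : ℤ} (hD : b ^ 2 + 4 * a < 0) (z : QuadraticAlgebra ℤ a b) :
    0 ≤ norm z := by
  have := four_mul_norm z
  have h1 : 0 ≤ -(b ^ 2 + 4 * a) * z.im ^ 2 := mul_nonneg (by linarith) (sq_nonneg _)
  nlinarith [sq_nonneg (2 * z.re + b * z.im)]

theorem norm_eq_zero_iff_of_disc_neg {a b : ℤ} (hD : b ^ 2 + 4 * a < 0)
    {z : QuadraticAlgebra ℤ a b} : norm z = 0 ↔ z = 0 := by
  refine ⟨fun h => ?_, fun h => by rw [h, norm_zero]⟩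
  have h4 := four_mul_norm z
  rw [h, mul_zero] at h4
  have h1 : 0 ≤ -(b ^ 2 + 4 * a) * z.im ^ 2 := mul_nonneg (by linarith) (sq_nonneg _)
  have h2 : -(b ^ 2 + 4 * a) * z.im ^ 2 = 0 := by nlinarith [sq_nonneg (2 * z.re + b * z.im)]
  have h3 : z.im = 0 := by
    rcases mul_eq_zero.1 h2 with h | h
    · linarith
    · exact pow_eq_zero_iff two_ne_zero |>.1 h
  have h5 : z.re = 0 := by
    rw [h3] at h4
    have : (2 * z.re) ^ 2 = 0 := by linarith
    have := pow_eq_zero_iff two_ne_zero |>.1 this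
    omega
  exact QuadraticAlgebra.ext h5 h3

theorem norm_pos_of_disc_neg {a b : ℤ} (hD : b ^ 2 + 4 * a < 0)
    {z : QuadraticAlgebra ℤ a b} (hz : z ≠ 0) : 0 < norm z :=
  lt_of_le_of_ne (norm_nonneg_of_disc_neg hD z)
    fun h => hz ((norm_eq_zero_iff_of_disc_neg hD).1 h.symm)

theorem intCast_dvd_iff {a b : ℤ} (m : ℤ) (z : QuadraticAlgebra ℤ a b) :
    (m : QuadraticAlgebra ℤ a b) ∣ z ↔ m ∣ z.re ∧ m ∣ z.im := by
  constructor
  · rintro ⟨w, rfl⟩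
    simp
  · rintro ⟨⟨x, hx⟩, ⟨y, hy⟩⟩
    exact ⟨⟨x, y⟩, QuadraticAlgebra.ext (by simp [hx]) (by simp [hy])⟩

theorem star_dvd_star_iff {a b : ℤ} {w z : QuadraticAlgebra ℤ a b} :
    star w ∣ star z ↔ w ∣ z := by
  constructor
  · rintro ⟨v, hv⟩
    exact ⟨star v, by rw [← star_star z, hv, star_mul, star_star, mul_comm]⟩
  · rintro ⟨v, rfl⟩
    exact ⟨star v, by rw [star_mul, mul_comm]⟩

theorem mul_star_eq_intCast_norm {a b : ℤ} (z : QuadraticAlgebra ℤ a b) :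
    z * star z = (norm z : ℤ) := by
  rw [← algebraMap_norm_eq_mul_star]; simp

theorem isDomain_of_disc_neg {a b : ℤ} (hD : b ^ 2 + 4 * a < 0) :
    IsDomain (QuadraticAlgebra ℤ a b) := by
  have : NoZeroDivisors (QuadraticAlgebra ℤ a b) := ⟨fun {x y} h => by
    have := congrArg norm h
    rw [map_mul, norm_zero] at this
    exact (mul_eq_zero.1 this).imp (norm_eq_zero_iff_of_disc_neg hD).1
      (norm_eq_zero_iff_of_disc_neg hD).1⟩
  exact NoZeroDivisors.to_isDomain _

/-- In a principal imaginary quadratic order, a rational prime dividing the norm of an element it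
does not divide is itself a norm. -/
theorem exists_norm_eq_prime {a b : ℤ} (hD : b ^ 2 + 4 * a < 0)
    [IsPrincipalIdealRing (QuadraticAlgebra ℤ a b)] {p : ℕ} (hp : p.Prime)
    {z : QuadraticAlgebra ℤ a b} (hpz : (p : ℤ) ∣ norm z)
    (hz : ¬ ((p : ℤ) : QuadraticAlgebra ℤ a b) ∣ z) :
    ∃ β : QuadraticAlgebra ℤ a b, norm β = p := by
  have := isDomain_of_disc_neg hD
  obtain ⟨β, hβ⟩ := IsPrincipalIdealRing.principal
    (Ideal.span {((p : ℤ) : QuadraticAlgebra ℤ a b), z})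
  rw [← Ideal.span] at hβ
  have hβp : β ∣ ((p : ℤ) : QuadraticAlgebra ℤ a b) := by
    rw [← Ideal.mem_span_singleton, ← hβ]
    exact Ideal.subset_span (by simp)
  have hβz : β ∣ z := by
    rw [← Ideal.mem_span_singleton, ← hβ]
    exact Ideal.subset_span (by simp)
  have hmem : β ∈ Ideal.span {((p : ℤ) : QuadraticAlgebra ℤ a b), z} := by
    rw [hβ]; exact Ideal.mem_span_singleton_self β
  obtain ⟨u, v, huv⟩ := Ideal.mem_span_pair.1 hmem
  obtain ⟨γ, hγ⟩ := hβp
  have hn : norm β * norm γ = (p : ℤ) ^ 2 := by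
    rw [← map_mul, ← hγ, norm_intCast, Int.cast_id]
  have hβ0 := norm_nonneg_of_disc_neg hD β
  have hdvd : (norm β).natAbs ∣ p ^ 2 := by
    rw [← Int.natCast_dvd_natCast, Int.natAbs_of_nonneg hβ0]
    exact ⟨norm γ, by push_cast; rw [hn]⟩
  obtain ⟨k, hk, hk'⟩ := (Nat.dvd_prime_pow hp).1 hdvd
  have hk2 : norm β = (p : ℤ) ^ k := by
    rw [← Int.natAbs_of_nonneg hβ0, hk']; push_cast; rfl
  have hp0 : (p : ℤ) ≠ 0 := by exact_mod_cast hp.ne_zero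
  interval_cases k
  · exfalso
    apply hz
    rw [← star_dvd_star_iff]
    have h1 : star z * star β * β =
        star z * (u * (p : ℤ)) * star β + v * (z * star z) * star β := by
      rw [← huv]; ring
    rw [mul_assoc, mul_comm (star β), mul_star_eq_intCast_norm, mul_star_eq_intCast_norm, hk2] at h1
    obtain ⟨m, hm⟩ := hpz
    rw [hm] at h1
    refine ⟨star z * u * star β + v * (m : ℤ) * star β, ?_⟩
    have h2 : star ((p : ℤ) : QuadraticAlgebra ℤ a b) = (p : ℤ) := by
      ext <;> simp
    rw [h2]
    push_cast at h1 ⊢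
    linear_combination h1
  · exact ⟨β, by simpa using hk2⟩
  · exfalso
    apply hz
    rw [hk2] at hn
    have hγ1 : norm γ = 1 := by
      have : (p : ℤ) ^ 2 ≠ 0 := pow_ne_zero _ hp0
      exact mul_left_cancel₀ this (by rw [hn, mul_one])
    have hu : IsUnit γ := isUnit_iff_norm_isUnit.2 (by rw [hγ1]; exact isUnit_one)
    rw [hγ]
    exact (hu.mul_right_dvd).2 hβz

end QuadraticAlgebra

namespace QuadraticAlgebra

/-- Dirichlet approximation in an imaginary quadratic order: a multiple `s • γ` with `s ≤ S` is
closer to a multiple of `n` than `n`. -/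
theorem exists_norm_sub_lt {a b : ℤ} {S : ℕ} (hS : 0 < S)
    (hSD : -(b ^ 2 + 4 * a) < 3 * (S + 1) ^ 2)
    (γ : QuadraticAlgebra ℤ a b) {n : ℤ} (hn : 0 < n) :
    ∃ (s : ℕ) (t : QuadraticAlgebra ℤ a b), 0 < s ∧ s ≤ S ∧
      norm ((s : ℤ) * γ - (n : ℤ) * t : QuadraticAlgebra ℤ a b) < n ^ 2 := by
  obtain ⟨j, k, hk0, hkS, hjk⟩ := Real.exists_int_int_abs_mul_sub_le ((γ.im : ℝ) / n) hS
  set X : ℝ := (k * γ.re : ℝ) / n + b * ((k : ℝ) * (γ.im / n) - j) / 2 with hX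
  refine ⟨k.toNat, ⟨round X, j⟩, by omega, by omega, ?_⟩
  have hkk : ((k.toNat : ℕ) : ℤ) = k := Int.toNat_of_nonneg hk0.le
  rw [hkk]
  have hround := abs_sub_round X
  set Y : ℝ := (k : ℝ) * (γ.im / n) - j with hY
  set D : ℤ := b ^ 2 + 4 * a
  have hnR : (0 : ℝ) < n := by exact_mod_cast hn
  set w : QuadraticAlgebra ℤ a b := (k : ℤ) * γ - (n : ℤ) * ⟨round X, j⟩
  have hre : (w.re : ℝ) = n * (X - round X - b * Y / 2) := by
    simp only [w, re_sub, re_mul, re_intCast, im_intCast, hX, hY]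
    push_cast
    field_simp
    ring
  have him : (w.im : ℝ) = n * Y := by
    simp only [w, im_sub, im_mul, re_intCast, im_intCast, hY]
    push_cast
    field_simp
    ring
  have h4 : (4 * (norm w : ℤ) : ℝ) = n ^ 2 * (4 * (X - round X) ^ 2 + -(D : ℝ) * Y ^ 2) := by
    have := congrArg (Int.cast (R := ℝ)) (four_mul_norm w)
    push_cast at this
    rw [this, hre, him]
    simp only [D]
    push_cast
    ring
  have hX2 : 4 * (X - round X) ^ 2 ≤ 1 := by
    have := abs_le.1 hround
    nlinarith
  have hY2 : Y ^ 2 * (S + 1) ^ 2 ≤ 1 := by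
    have h1 : |Y * (S + 1)| ≤ 1 := by
      rw [abs_mul, abs_of_pos (by positivity : (0 : ℝ) < S + 1)]
      rwa [le_div_iff₀ (by positivity)] at hjk
    rw [← mul_pow]
    exact (sq_le_one_iff_abs_le_one _).2 h1
  have hDR : -(D : ℝ) < 3 * (S + 1) ^ 2 := by exact_mod_cast hSD
  have hlt : 4 * (X - round X) ^ 2 + -(D : ℝ) * Y ^ 2 < 4 := by
    rcases eq_or_ne Y 0 with h | h
    · rw [h]; linarith
    · have : 0 < Y ^ 2 := by positivity
      nlinarith
  have : ((norm w : ℤ) : ℝ) < n ^ 2 := by nlinarith [pow_pos hnR 2]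
  exact_mod_cast this

/-- A Minkowski-type criterion: an imaginary quadratic order all of whose small rational primes
are inert is principal. -/
theorem isPrincipalIdealRing_of_inert {a b : ℤ} (hD : b ^ 2 + 4 * a < 0) {S : ℕ} (hS : 0 < S)
    (hSD : -(b ^ 2 + 4 * a) < 3 * (S + 1) ^ 2)
    (hinert : ∀ p : ℕ, p.Prime → p ≤ S → ∀ z : QuadraticAlgebra ℤ a b, (p : ℤ) ∣ norm z →
      ((p : ℤ) : QuadraticAlgebra ℤ a b) ∣ z) :
    IsPrincipalIdealRing (QuadraticAlgebra ℤ a b) := by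
  classical
  have := isDomain_of_disc_neg hD
  refine ⟨fun I => ?_⟩
  by_cases hI : I = ⊥
  · exact ⟨0, by simp [hI]⟩
  obtain ⟨β₀, hβ₀I, hβ₀⟩ := Submodule.exists_mem_ne_zero_of_ne_bot hI
  have hex : ∃ n : ℕ, ∃ β ∈ I, β ≠ 0 ∧ (norm β).toNat = n := ⟨_, β₀, hβ₀I, hβ₀, rfl⟩
  obtain ⟨β, hβI, hβ, hβn⟩ := Nat.find_spec hex
  have hmin : ∀ x ∈ I, norm x < norm β → x = 0 := by
    intro x hx hlt
    by_contra hx0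
    have h1 := Nat.find_min' hex ⟨x, hx, hx0, rfl⟩
    have := norm_nonneg_of_disc_neg hD x
    omega
  have hβpos := norm_pos_of_disc_neg hD hβ
  have hmult : ∀ α ∈ I, ∃ s : ℕ, 0 < s ∧ s ≤ S ∧ β ∣ (s : ℤ) * α := by
    intro α hα
    obtain ⟨s, t, hs0, hsS, hlt⟩ := exists_norm_sub_lt hS hSD (α * star β) hβpos
    refine ⟨s, hs0, hsS, t, ?_⟩
    have h1 : ((s : ℤ) * (α * star β) - (norm β : ℤ) * t : QuadraticAlgebra ℤ a b) =
        ((s : ℤ) * α - β * t) * star β := by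
      rw [← mul_star_eq_intCast_norm]; ring
    rw [h1, map_mul, norm_star, sq] at hlt
    have h2 := hmin _ (I.sub_mem (I.mul_mem_left _ hα) (I.mul_mem_right t hβI))
      (lt_of_mul_lt_mul_right hlt hβpos.le)
    exact sub_eq_zero.1 h2
  refine ⟨β, le_antisymm (fun α hα => ?_) ?_⟩
  · rw [← Ideal.span, Ideal.mem_span_singleton]
    have key : ∀ s : ℕ, 0 < s → s ≤ S → ∀ α ∈ I, β ∣ (s : ℤ) * α → β ∣ α := by
      intro s
      induction s using Nat.strong_induction_on with
      | _ s ih =>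
        intro hs0 hsS α hα hdvd
        rcases eq_or_ne s 1 with rfl | hs1
        · simpa using hdvd
        obtain ⟨p, hp, r, rfl⟩ := Nat.exists_prime_and_dvd hs1
        have hr0 : 0 < r := Nat.pos_of_ne_zero fun h => by simp [h] at hs0
        have hrp : r < p * r := by nlinarith [hp.two_le]
        have hpS : p ≤ S := le_trans (Nat.le_mul_of_pos_right p hr0) hsS
        refine ih r hrp hr0 (by omega) α hα ?_
        set α' : QuadraticAlgebra ℤ a b := (r : ℤ) * α with hα'
        have hα'I : α' ∈ I := I.mul_mem_left _ hα
        obtain ⟨t, ht⟩ := hdvd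
        have hpt : ((p : ℤ) : QuadraticAlgebra ℤ a b) * α' = β * t := by
          rw [← ht, hα']; push_cast; ring
        have hp0 : ((p : ℤ) : QuadraticAlgebra ℤ a b) ≠ 0 := by
          intro h
          have := congrArg re h
          rw [re_intCast] at this
          exact hp.ne_zero (by simpa using this)
        by_cases hdt : ((p : ℤ) : QuadraticAlgebra ℤ a b) ∣ t
        · obtain ⟨u, rfl⟩ := hdt
          exact ⟨u, mul_left_cancel₀ hp0 (by rw [hpt]; ring)⟩
        exfalso
        have hnt : ¬ (p : ℤ) ∣ norm t := fun h => hdt (hinert p hp hpS t h)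
        set m := norm t / p
        set e := norm t % p with he
        have hpZ : (0 : ℤ) < p := by exact_mod_cast hp.pos
        have he0 : 0 < e := lt_of_le_of_ne (Int.emod_nonneg _ hpZ.ne')
          fun h => hnt (Int.dvd_of_emod_eq_zero h.symm)
        have hep : e < p := Int.emod_lt_of_pos _ hpZ
        have hdiv : norm t = p * m + e := (Int.mul_ediv_add_emod _ _).symm
        set δ : QuadraticAlgebra ℤ a b := star t * α' - (m : ℤ) * β with hδ
        have hδI : δ ∈ I := I.sub_mem (I.mul_mem_left _ hα'I) (I.mul_mem_left _ hβI)
        have hpδ : ((p : ℤ) : QuadraticAlgebra ℤ a b) * δ = (e : ℤ) * β := by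
          have h1 : ((p : ℤ) : QuadraticAlgebra ℤ a b) * δ =
              (star t) * ((p : ℤ) * α') - ((p * m : ℤ) : QuadraticAlgebra ℤ a b) * β := by
            rw [hδ]; push_cast; ring
          rw [h1, hpt, show star t * (β * t) = (t * star t) * β by ring,
            mul_star_eq_intCast_norm, hdiv]
          push_cast
          ring
        have hnorm := congrArg norm hpδ
        rw [map_mul, map_mul, norm_intCast, norm_intCast, Int.cast_id, Int.cast_id] at hnorm
        have hlt : norm δ < norm β := by
          have h2 : e ^ 2 < (p : ℤ) ^ 2 := by nlinarith
          by_contra! h3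
          have h4 : e ^ 2 * norm β < (p : ℤ) ^ 2 * norm β := by nlinarith
          have h5 : (p : ℤ) ^ 2 * norm β ≤ (p : ℤ) ^ 2 * norm δ := by
            exact mul_le_mul_of_nonneg_left h3 (sq_nonneg _)
          linarith
        have hδ0 := hmin δ hδI hlt
        rw [hδ0, norm_zero, mul_zero] at hnorm
        have : 0 < e ^ 2 * norm β := by positivity
        linarith
    obtain ⟨s, hs0, hsS, hdvd⟩ := hmult α hα
    exact key s hs0 hsS α hα hdvd
  · rw [← Ideal.span, Ideal.span_singleton_le_iff_mem]
    exact hβI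

end QuadraticAlgebra

theorem Rat.exists_int_eq_of_squarefree_mul_sq {d : ℕ} (hd : Squarefree d) {r : ℚ} {k : ℤ}
    (h : (d : ℚ) * r ^ 2 = k) : ∃ l : ℤ, r = l := by
  have hden : (r.den : ℚ) ≠ 0 := by exact_mod_cast r.den_nz
  have h1 : (d : ℤ) * r.num ^ 2 = k * (r.den : ℤ) ^ 2 := by
    have : (d : ℚ) * r.num ^ 2 = k * (r.den : ℚ) ^ 2 := by
      rw [← h]
      nth_rewrite 2 [← Rat.num_div_den r]
      field_simp
    exact_mod_cast this
  have h2 : r.den ^ 2 ∣ d * r.num.natAbs ^ 2 := by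
    rw [← Int.natCast_dvd_natCast]
    refine ⟨k, ?_⟩
    push_cast
    rw [sq_abs, h1, mul_comm]
  have h3 : r.den ^ 2 ∣ d := by
    refine Nat.Coprime.dvd_of_dvd_mul_right ?_ h2
    exact Nat.Coprime.pow 2 2 r.reduced.symm
  have h4 : r.den = 1 := Nat.isUnit_iff.1 (hd _ (by rwa [← sq]))
  exact ⟨r.num, ((Rat.den_eq_one_iff r).1 h4).symm⟩

theorem ne_zero_of_rat_sq_add {d : ℕ} (hd0 : 0 < d) {p q : ℚ} (h : p ^ 2 + d * q ^ 2 = 0) :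
    p = 0 ∧ q = 0 := by
  have hd : (0 : ℚ) < d := by exact_mod_cast hd0
  have h1 : (0 : ℚ) ≤ d * q ^ 2 := by positivity
  have h2 : p ^ 2 = 0 := by nlinarith [sq_nonneg p]
  have h3 : (d : ℚ) * q ^ 2 = 0 := by nlinarith [sq_nonneg p]
  exact ⟨pow_eq_zero_iff two_ne_zero |>.1 h2, by
    rcases mul_eq_zero.1 h3 with h | h
    · exact absurd h hd.ne'
    · exact pow_eq_zero_iff two_ne_zero |>.1 h⟩

theorem exists_rat_add_rat_mul {d : ℕ} {K : Type*} [Field K] [NumberField K] {α : K}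
    (hα : α ^ 2 = -(d : K))
    (hgen : IntermediateField.adjoin ℚ {α} = ⊤) (z : K) : ∃ p q : ℚ, z = p + q * α := by
  have hz : z ∈ IntermediateField.adjoin ℚ {α} := by rw [hgen]; trivial
  induction hz using IntermediateField.adjoin_induction with
  | mem x hx => exact ⟨0, 1, by simpa using hx⟩
  | algebraMap x => exact ⟨x, 0, by simp⟩
  | add x y _ _ hx hy =>
    obtain ⟨p, q, rfl⟩ := hx
    obtain ⟨p', q', rfl⟩ := hy
    exact ⟨p + p', q + q', by push_cast; ring⟩
  | mul x y _ _ hx hy =>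
    obtain ⟨p, q, rfl⟩ := hx
    obtain ⟨p', q', rfl⟩ := hy
    exact ⟨p * p' - d * q * q', p * q' + q * p', by
      push_cast; linear_combination (q : K) * q' * hα⟩
  | inv x _ hx =>
    obtain ⟨p, q, rfl⟩ := hx
    rcases eq_or_ne ((p : K) + q * α) 0 with h | h
    · exact ⟨0, 0, by simp [h]⟩
    · by_cases hN : p ^ 2 + d * q ^ 2 = 0
      · have h2 : ((p : K) + q * α) * (p - q * α) = 0 := by
          have : ((p ^ 2 + d * q ^ 2 : ℚ) : K) = 0 := by rw [hN]; simp
          push_cast at this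
          linear_combination this - (q : K) ^ 2 * hα
        have h3 : (p : K) - q * α = 0 := (mul_eq_zero.1 h2).resolve_left h
        exact ⟨1 / (2 * p), 0, by
          have : (p : K) + q * α = 2 * p := by linear_combination -h3
          rw [this]; push_cast; simp⟩
      · refine ⟨p / (p ^ 2 + d * q ^ 2), -q / (p ^ 2 + d * q ^ 2), ?_⟩
        have hN' : ((p : K) ^ 2 + d * q ^ 2) ≠ 0 := by exact_mod_cast hN
        push_cast
        refine inv_eq_of_mul_eq_one_right ?_
        rw [show ∀ A B N t : K, (A + B * t) * (A / N + -B / N * t) = (A ^ 2 - B ^ 2 * t ^ 2) / N by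
          intros; ring, div_eq_one_iff_eq hN']
        linear_combination -(q : K) ^ 2 * hα

theorem exists_int_trace_norm_of_isIntegral {d : ℕ} {K : Type*} [Field K] [NumberField K] {α : K}
    (hα : α ^ 2 = -(d : K))
    (hd0 : 0 < d) {p q : ℚ} (hz : IsIntegral ℤ ((p : K) + q * α)) :
    ∃ m n : ℤ, 2 * p = m ∧ p ^ 2 + d * q ^ 2 = n := by
  let φ : QuadraticAlgebra ℚ (-(d : ℚ)) 0 →ₐ[ℚ] K := QuadraticAlgebra.lift ⟨α, by
    rw [← sq, hα]; simp [Algebra.smul_def]⟩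
  have hφ : ∀ x : QuadraticAlgebra ℚ (-(d : ℚ)) 0, φ x = x.re + x.im * α := by
    intro x
    simp [φ, QuadraticAlgebra.lift, Algebra.smul_def]
  have hinj : Function.Injective φ := by
    rw [injective_iff_map_eq_zero]
    intro x hx
    rw [hφ] at hx
    have h2 : ((x.re ^ 2 + d * x.im ^ 2 : ℚ) : K) = 0 := by
      push_cast
      linear_combination ((x.re : K) - x.im * α) * hx + (x.im : K) ^ 2 * hα
    have := ne_zero_of_rat_sq_add hd0 (by exact_mod_cast h2)
    exact QuadraticAlgebra.ext this.1 this.2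
  obtain ⟨w, hre, him⟩ : ∃ w : QuadraticAlgebra ℚ (-(d : ℚ)) 0, w.re = p ∧ w.im = q :=
    ⟨⟨p, q⟩, rfl, rfl⟩
  have hw : IsIntegral ℤ w := by
    rw [← isIntegral_algHom_iff (φ.restrictScalars ℤ) hinj]
    simpa [hφ, hre, him] using hz
  have hw' : IsIntegral ℤ (star w) :=
    hw.map (starRingEnd (QuadraticAlgebra ℚ (-(d : ℚ)) 0)).toIntAlgHom
  have htr : algebraMap ℚ (QuadraticAlgebra ℚ (-(d : ℚ)) 0) (2 * p) = w + star w := by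
    rw [QuadraticAlgebra.algebraMap_eq]
    ext <;> simp [hre, him]
    ring
  have hnm : algebraMap ℚ (QuadraticAlgebra ℚ (-(d : ℚ)) 0) (p ^ 2 + d * q ^ 2)
      = w * star w := by
    rw [QuadraticAlgebra.algebraMap_eq]
    ext <;> simp [hre, him] <;> ring
  have hF := QuadraticAlgebra.algebraMap_injective (R := ℚ) (a := -(d : ℚ)) (b := 0)
  have h1 : IsIntegral ℤ (2 * p) :=
    (isIntegral_algebraMap_iff hF).1 (by rw [htr]; exact hw.add hw')
  have h2 : IsIntegral ℤ (p ^ 2 + d * q ^ 2) :=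
    (isIntegral_algebraMap_iff hF).1 (by rw [hnm]; exact hw.mul hw')
  obtain ⟨m, hm⟩ := IsIntegrallyClosed.isIntegral_iff.1 h1
  obtain ⟨n, hn⟩ := IsIntegrallyClosed.isIntegral_iff.1 h2
  exact ⟨m, n, by simpa using hm.symm, by simpa using hn.symm⟩

/-- The trace and norm conditions for integrality, in terms of doubled coordinates. -/
theorem exists_int_of_isIntegral {d : ℕ} {K : Type*} [Field K] [NumberField K] {α : K}
    (hα : α ^ 2 = -(d : K)) (hgen : IntermediateField.adjoin ℚ {α} = ⊤)
    (hd0 : 0 < d) (hd : Squarefree d) {z : K} (hz : IsIntegral ℤ z) :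
    ∃ m l n : ℤ, m ^ 2 + d * l ^ 2 = 4 * n ∧ 2 * z = m + l * α := by
  obtain ⟨p, q, rfl⟩ := exists_rat_add_rat_mul hα hgen z
  obtain ⟨m, n, hm, hn⟩ := exists_int_trace_norm_of_isIntegral hα hd0 hz
  have h1 : (d : ℚ) * (2 * q) ^ 2 = ((4 * n - m ^ 2 : ℤ) : ℚ) := by
    push_cast
    rw [← hn, ← hm]
    ring
  obtain ⟨l, hl⟩ := Rat.exists_int_eq_of_squarefree_mul_sq hd h1
  refine ⟨m, l, n, ?_, ?_⟩
  · rw [hl] at h1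
    have : (d : ℤ) * l ^ 2 = 4 * n - m ^ 2 := by exact_mod_cast h1
    linarith
  · have h2 : (2 : K) * p = m := by exact_mod_cast congrArg (Rat.cast (K := K)) hm
    have h3 : (2 : K) * q = l := by exact_mod_cast congrArg (Rat.cast (K := K)) hl
    linear_combination h2 + α * h3

open NumberField in
theorem classNumber_eq_one_iff_of_integral_basis {K : Type*} [Field K] [NumberField K]
    {a b : ℤ} (hD : b ^ 2 + 4 * a < 0) {w : K} (hw : w * w = a + b * w)
    (hb : ∀ z : K, IsIntegral ℤ z → ∃ x y : ℤ, z = x + y * w) :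
    classNumber K = 1 ↔ IsPrincipalIdealRing (QuadraticAlgebra ℤ a b) := by
  have hwi : IsIntegral ℤ w := by
    refine ⟨Polynomial.X ^ 2 - Polynomial.C b * Polynomial.X - Polynomial.C a, ?_, ?_⟩
    · monicity!
    · rw [← Polynomial.aeval_def]
      simp
      linear_combination hw
  obtain ⟨W, hW⟩ : ∃ W : 𝓞 K, (W : K) = w := ⟨⟨w, hwi⟩, rfl⟩
  let φ : QuadraticAlgebra ℤ a b →ₐ[ℤ] 𝓞 K := QuadraticAlgebra.lift ⟨W, by
    apply RingOfIntegers.ext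
    simpa [hW, zsmul_eq_mul] using hw⟩
  have hφ : ∀ x : QuadraticAlgebra ℤ a b, ((φ x : 𝓞 K) : K) = x.re + x.im * w := by
    intro x
    simp [φ, QuadraticAlgebra.lift, hW]
  have hinj : Function.Injective φ := by
    rw [injective_iff_map_eq_zero]
    intro x hx
    have h1 : (x.re : K) + x.im * w = 0 := by rw [← hφ, hx]; simp
    rw [← QuadraticAlgebra.norm_eq_zero_iff_of_disc_neg hD]
    have h2 : ((QuadraticAlgebra.norm x : ℤ) : K) = 0 := by
      rw [QuadraticAlgebra.norm_def]
      push_cast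
      linear_combination ((x.re : K) + b * x.im - x.im * w) * h1 + (x.im : K) ^ 2 * hw
    exact_mod_cast h2
  have hsurj : Function.Surjective φ := by
    intro z
    obtain ⟨x, y, hxy⟩ := hb z z.isIntegral_coe
    exact ⟨⟨x, y⟩, RingOfIntegers.ext (by rw [hφ, hxy])⟩
  have e : QuadraticAlgebra ℤ a b ≃+* 𝓞 K := RingEquiv.ofBijective φ ⟨hinj, hsurj⟩
  rw [classNumber_eq_one_iff]
  exact ⟨fun h => IsPrincipalIdealRing.of_surjective e.symm e.symm.surjective,
    fun h => IsPrincipalIdealRing.of_surjective e e.surjective⟩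

open NumberField in
theorem classNumber_eq_one_iff_of_mod_four_ne_three {d : ℕ} {K : Type*} [Field K] [NumberField K]
    {α : K} (hα : α ^ 2 = -(d : K)) (hgen : IntermediateField.adjoin ℚ {α} = ⊤)
    (hd0 : 0 < d) (hd : Squarefree d) (h4 : d % 4 = 1 ∨ d % 4 = 2) :
    classNumber K = 1 ↔ IsPrincipalIdealRing (QuadraticAlgebra ℤ (-(d : ℤ)) 0) := by
  refine classNumber_eq_one_iff_of_integral_basis (w := α) (by omega) ?_ fun z hz => ?_
  · push_cast
    linear_combination hα
  obtain ⟨m, l, n, h, hz2⟩ := exists_int_of_isIntegral hα hgen hd0 hd hz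
  have hmod : (m % 2 = 0) ∧ (l % 2 = 0) := by
    have h' : (m ^ 2 + d * l ^ 2) % 4 = 0 := by omega
    have hm4 : m % 4 = 0 ∨ m % 4 = 1 ∨ m % 4 = 2 ∨ m % 4 = 3 := by omega
    have hl4 : l % 4 = 0 ∨ l % 4 = 1 ∨ l % 4 = 2 ∨ l % 4 = 3 := by omega
    have hd4 : (d : ℤ) % 4 = 1 ∨ (d : ℤ) % 4 = 2 := by omega
    rcases hm4 with hm | hm | hm | hm <;> rcases hl4 with hl | hl | hl | hl <;>
      rcases hd4 with hd | hd <;>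
      simp [Int.add_emod, Int.mul_emod, pow_two, hm, hl, hd] at h' <;> omega
  obtain ⟨⟨x, hx⟩, ⟨y, hy⟩⟩ : (2 ∣ m) ∧ (2 ∣ l) := by omega
  refine ⟨x, y, mul_left_cancel₀ (two_ne_zero (α := K)) ?_⟩
  rw [hz2, hx, hy]
  push_cast
  ring

open NumberField in
theorem classNumber_eq_one_iff_of_eq_four_mul_sub_one {d : ℕ} {K : Type*} [Field K] [NumberField K]
    {α : K} (hα : α ^ 2 = -(d : K)) (hgen : IntermediateField.adjoin ℚ {α} = ⊤)
    (hd0 : 0 < d) (hd : Squarefree d) {c : ℤ} (hc : (d : ℤ) = 4 * c - 1) :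
    classNumber K = 1 ↔ IsPrincipalIdealRing (QuadraticAlgebra ℤ (-c) 1) := by
  have hcK : (d : K) = 4 * c - 1 := by exact_mod_cast congrArg (Int.cast (R := K)) hc
  refine classNumber_eq_one_iff_of_integral_basis (w := (1 + α) / 2) (by omega) ?_ fun z hz => ?_
  · push_cast
    linear_combination (1 / 4) * hα - (1 / 4) * hcK
  obtain ⟨m, l, n, h, hz2⟩ := exists_int_of_isIntegral hα hgen hd0 hd hz
  have hmod : 2 ∣ m - l := by
    have h1 : Even (m ^ 2 - l ^ 2) := ⟨2 * n - 2 * c * l ^ 2, by rw [hc] at h; linarith⟩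
    have h2 : Even (m - l) := by
      rw [Int.even_sub] at h1 ⊢
      simpa [Int.even_pow] using h1
    exact h2.two_dvd
  obtain ⟨x, hx⟩ := hmod
  refine ⟨x, l, mul_left_cancel₀ (two_ne_zero (α := K)) ?_⟩
  have hx' : m = l + 2 * x := by omega
  rw [hz2, hx']
  push_cast
  ring

namespace QuadraticAlgebra

theorem le_two_of_isPrincipalIdealRing {d : ℕ} (hd0 : 0 < d) (h4 : d % 4 = 1 ∨ d % 4 = 2)
    [IsPrincipalIdealRing (QuadraticAlgebra ℤ (-(d : ℤ)) 0)] : d ≤ 2 := by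
  have hD : (0 : ℤ) ^ 2 + 4 * -(d : ℤ) < 0 := by omega
  obtain ⟨β, hβ⟩ : ∃ β : QuadraticAlgebra ℤ (-(d : ℤ)) 0, norm β = (2 : ℕ) := by
    refine exists_norm_eq_prime hD Nat.prime_two (z := ⟨d % 2, 1⟩) ?_ ?_
    · rw [norm_def]
      rcases h4 with h | h
      · have : (d : ℤ) % 2 = 1 := by omega
        simp [this]
        omega
      · have : (d : ℤ) % 2 = 0 := by omega
        simp [this]
        omega
    · rw [intCast_dvd_iff]
      norm_num
  rw [norm_def] at hβ
  by_contra! hd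
  have hd' : (3 : ℤ) ≤ d := by exact_mod_cast hd
  have h1 : β.re ^ 2 + d * β.im ^ 2 = 2 := by
    push_cast at hβ
    linarith
  have h2 : β.im ^ 2 = 0 := by nlinarith [sq_nonneg β.re, sq_nonneg β.im]
  rw [h2] at h1
  have h3 : -2 < β.re := by nlinarith
  have h4 : β.re < 2 := by nlinarith
  interval_cases β.re <;> omega

/-- The form value `x ^ 2 + x * y + c * y ^ 2` as a norm. -/
theorem norm_mk_one (c x y : ℤ) :
    norm (⟨x, y⟩ : QuadraticAlgebra ℤ (-c) 1) = x ^ 2 + x * y + c * y ^ 2 := by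
  rw [norm_def]; ring

theorem le_of_prime_dvd_form {c : ℤ} (hc : 0 < c)
    [IsPrincipalIdealRing (QuadraticAlgebra ℤ (-c) 1)] {q : ℕ} (hq : q.Prime) {x y : ℤ}
    (hqz : (q : ℤ) ∣ x ^ 2 + x * y + c * y ^ 2) (hxy : ¬ ((q : ℤ) ∣ x ∧ (q : ℤ) ∣ y)) :
    c ≤ q := by
  obtain ⟨⟨X, Y⟩, hβ⟩ := exists_norm_eq_prime (a := -c) (b := 1) (by omega) hq (z := ⟨x, y⟩)
    (by rwa [norm_mk_one]) (by rwa [intCast_dvd_iff])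
  rw [norm_mk_one] at hβ
  rcases eq_or_ne Y 0 with rfl | hY
  · exfalso
    have h1 : X.natAbs ^ 2 = q := by
      zify
      rw [sq_abs]
      linarith
    rw [← h1] at hq
    exact Nat.Prime.not_prime_pow le_rfl hq
  · have hY2 : 0 < Y ^ 2 := by positivity
    nlinarith [sq_nonneg (2 * X + Y)]

/-- A prime below the bound splits in the order of discriminant `1 - 4 * (6 * k + 5)`. -/
def HasSmallSplitPrime (k : ℕ) : Bool :=
  [5, 7, 11, 13, 17, 19, 23, 29, 31, 37, 41, 43, 47, 53, 59, 61].any fun q =>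
    decide (q < 6 * k + 5) && (List.range q).any fun x => (x ^ 2 + x + (6 * k + 5)) % q == 0

theorem hasSmallSplitPrime_of_lt :
    ∀ k < 417, k = 0 ∨ k = 1 ∨ k = 2 ∨ k = 6 ∨ HasSmallSplitPrime k = true := by
  decide +kernel

theorem forward_of_isPrincipalIdealRing {d : ℕ} {c : ℤ} (hc : (d : ℤ) = 4 * c - 1)
    [IsPrincipalIdealRing (QuadraticAlgebra ℤ (-c) 1)] :
    d ∈ ({1, 2, 3, 7, 11, 19, 43, 67, 163} : Set ℕ) ∨ 10000 ≤ d ∧ d % 24 = 19 ∧ d.Prime := by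
  have hc0 : 0 < c := by omega
  by_cases h2 : c % 2 = 0
  · have := le_of_prime_dvd_form hc0 Nat.prime_two (x := 0) (y := 1) (by omega) (by omega)
    have : d = 7 := by omega
    simp [this]
  by_cases h3 : c % 3 = 0
  · have := le_of_prime_dvd_form hc0 Nat.prime_three (x := 0) (y := 1) (by omega) (by omega)
    have : d = 11 := by omega
    simp [this]
  by_cases h31 : c % 3 = 1
  · have := le_of_prime_dvd_form hc0 Nat.prime_three (x := 1) (y := 1) (by omega) (by omega)
    have : d = 3 := by omega
    simp [this]
  obtain ⟨k, hk⟩ : ∃ k : ℕ, d = 24 * k + 19 := ⟨d / 24, by omega⟩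
  have hck : c = 6 * k + 5 := by omega
  by_cases hlt : k < 417
  · left
    rcases hasSmallSplitPrime_of_lt k hlt with h | h | h | h | h
    · simp [hk, h]
    · simp [hk, h]
    · simp [hk, h]
    · simp [hk, h]
    · exfalso
      obtain ⟨q, hq, hqk⟩ := List.any_eq_true.1 h
      rw [Bool.and_eq_true, decide_eq_true_eq] at hqk
      obtain ⟨x, -, hx⟩ := List.any_eq_true.1 hqk.2
      have hqp : q.Prime := by
        have : ∀ q ∈ [5, 7, 11, 13, 17, 19, 23, 29, 31, 37, 41, 43, 47, 53, 59, 61],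
          Nat.Prime q := by simp; norm_num
        exact this q hq
      have hx' : q ∣ x ^ 2 + x + (6 * k + 5) := Nat.dvd_of_mod_eq_zero (by simpa using hx)
      have := le_of_prime_dvd_form hc0 hqp (x := x) (y := 1)
        (by rw [hck]; exact_mod_cast (by simpa using hx'))
        (fun h => hqp.one_lt.ne' (Nat.dvd_one.1 (by exact_mod_cast h.2)))
      omega
  · right
    refine ⟨by omega, by omega, ?_⟩
    by_contra hdp
    have hq := Nat.minFac_prime (show d ≠ 1 by omega)
    have hle := Nat.minFac_sq_le_self (by omega) hdp
    have hodd : d.minFac ≠ 2 := by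
      rw [Ne, Nat.minFac_eq_two_iff]
      omega
    have := le_of_prime_dvd_form hc0 hq (x := -1) (y := 2) (by
        have : (d.minFac : ℤ) ∣ d := by exact_mod_cast d.minFac_dvd
        rw [hc] at this
        convert this using 1
        ring) (fun h => hq.one_lt.ne' (Nat.dvd_one.1 (by
        exact_mod_cast (Int.dvd_neg).1 h.1)))
    have h4 : d + 1 ≤ 4 * d.minFac := by omega
    nlinarith [hq.two_le]

theorem intCast_dvd_of_forall_range {c : ℤ} {p : ℕ} (hp : p.Prime)
    (h : ∀ x ∈ Finset.range p, ∀ y ∈ Finset.range p, x ≠ 0 ∨ y ≠ 0 →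
      ((x : ℤ) ^ 2 + x * y + c * y ^ 2) % p ≠ 0)
    (z : QuadraticAlgebra ℤ (-c) 1) (hz : (p : ℤ) ∣ norm z) :
    ((p : ℤ) : QuadraticAlgebra ℤ (-c) 1) ∣ z := by
  obtain ⟨x, y⟩ := z
  rw [norm_mk_one] at hz
  rw [intCast_dvd_iff]
  have hp0 : (0 : ℤ) < p := by exact_mod_cast hp.pos
  obtain ⟨X, hX⟩ := Int.eq_ofNat_of_zero_le (Int.emod_nonneg x hp0.ne')
  obtain ⟨Y, hY⟩ := Int.eq_ofNat_of_zero_le (Int.emod_nonneg y hp0.ne')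
  have hXp := Int.emod_lt_of_pos x hp0
  have hYp := Int.emod_lt_of_pos y hp0
  by_contra hcon
  refine h X (by simp; omega) Y (by simp; omega) ?_ ?_
  · by_contra! h0
    apply hcon
    simp only [h0.1, h0.2] at hX hY
    exact ⟨Int.dvd_of_emod_eq_zero (by simpa using hX), Int.dvd_of_emod_eq_zero (by simpa using hY)⟩
  · rw [← hX, ← hY, ← Int.emod_eq_zero_of_dvd hz]
    refine Int.ModEq.add (Int.ModEq.add ?_ ?_) ?_
    · exact (Int.mod_modEq x p).pow 2
    · exact (Int.mod_modEq x p).mul (Int.mod_modEq y p)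
    · exact ((Int.mod_modEq y p).pow 2).mul_left c

theorem isPrincipalIdealRing_of_small {c : ℤ} {S : ℕ} (hS : 0 < S) (hc : 0 < c)
    (hcS : 4 * c - 1 < 3 * (S + 1) ^ 2)
    (h : ∀ p ∈ Finset.range (S + 1), p.Prime →
      ∀ x ∈ Finset.range p, ∀ y ∈ Finset.range p, x ≠ 0 ∨ y ≠ 0 →
        ((x : ℤ) ^ 2 + x * y + c * y ^ 2) % p ≠ 0) :
    IsPrincipalIdealRing (QuadraticAlgebra ℤ (-c) 1) := by
  refine isPrincipalIdealRing_of_inert (by omega) hS (by linarith) fun p hp hpS z hz => ?_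
  exact intCast_dvd_of_forall_range hp (h p (by simp; omega) hp) z hz

end QuadraticAlgebra

open NumberField QuadraticAlgebra in
theorem classNumber_eq_one_of_mem {d : ℕ} {K : Type*} [Field K] [NumberField K]
    {α : K} (hα : α ^ 2 = -(d : K)) (hgen : IntermediateField.adjoin ℚ {α} = ⊤)
    (hd : Squarefree d) (h : d ∈ ({1, 2, 3, 7, 11, 19, 43, 67, 163} : Set ℕ)) :
    classNumber K = 1 := by
  simp only [Set.mem_insert_iff, Set.mem_singleton_iff] at h
  rcases h with rfl | rfl | rfl | rfl | rfl | rfl | rfl | rfl | rfl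
  · rw [classNumber_eq_one_iff_of_mod_four_ne_three hα hgen (by norm_num) hd (by norm_num)]
    exact isPrincipalIdealRing_of_inert (S := 1) (by norm_num) (by norm_num) (by norm_num)
      fun p hp hp1 => absurd hp.two_le (by omega)
  · rw [classNumber_eq_one_iff_of_mod_four_ne_three hα hgen (by norm_num) hd (by norm_num)]
    exact isPrincipalIdealRing_of_inert (S := 1) (by norm_num) (by norm_num) (by norm_num)
      fun p hp hp1 => absurd hp.two_le (by omega)
  · rw [classNumber_eq_one_iff_of_eq_four_mul_sub_one hα hgen (by norm_num) hd (c := 1)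
      (by norm_num)]
    exact isPrincipalIdealRing_of_small (S := 1) (by norm_num) (by norm_num) (by norm_num)
      (by decide)
  · rw [classNumber_eq_one_iff_of_eq_four_mul_sub_one hα hgen (by norm_num) hd (c := 2)
      (by norm_num)]
    exact isPrincipalIdealRing_of_small (S := 1) (by norm_num) (by norm_num) (by norm_num)
      (by decide)
  · rw [classNumber_eq_one_iff_of_eq_four_mul_sub_one hα hgen (by norm_num) hd (c := 3)
      (by norm_num)]
    exact isPrincipalIdealRing_of_small (S := 1) (by norm_num) (by norm_num) (by norm_num)
      (by decide)
  · rw [classNumber_eq_one_iff_of_eq_four_mul_sub_one hα hgen (by norm_num) hd (c := 5)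
      (by norm_num)]
    exact isPrincipalIdealRing_of_small (S := 2) (by norm_num) (by norm_num) (by norm_num)
      (by decide +kernel)
  · rw [classNumber_eq_one_iff_of_eq_four_mul_sub_one hα hgen (by norm_num) hd (c := 11)
      (by norm_num)]
    exact isPrincipalIdealRing_of_small (S := 3) (by norm_num) (by norm_num) (by norm_num)
      (by decide +kernel)
  · rw [classNumber_eq_one_iff_of_eq_four_mul_sub_one hα hgen (by norm_num) hd (c := 17)
      (by norm_num)]
    exact isPrincipalIdealRing_of_small (S := 4) (by norm_num) (by norm_num) (by norm_num)
      (by decide +kernel)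
  · rw [classNumber_eq_one_iff_of_eq_four_mul_sub_one hα hgen (by norm_num) hd (c := 41)
      (by norm_num)]
    exact isPrincipalIdealRing_of_small (S := 7) (by norm_num) (by norm_num) (by norm_num)
      (by decide +kernel)

theorem Nat.sum_divisors_eq_sum_filter_add {f : ℕ → ℤ} (hf : ∀ m n, f (m * n) = f m * f n) {p : ℕ}
    (hp : p.Prime) {n : ℕ} (hn : n ≠ 0) :
    ∑ k ∈ n.divisors, f k = ∑ k ∈ n.divisors with ¬ p ∣ k, f k +
      if p ∣ n then f p * ∑ k ∈ (n / p).divisors, f k else 0 := by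
  rw [← Finset.sum_filter_not_add_sum_filter n.divisors (fun k => p ∣ k)]
  congr 1
  split_ifs with h
  · obtain ⟨m, rfl⟩ := h
    have hm : m ≠ 0 := right_ne_zero_of_mul hn
    rw [Nat.mul_div_cancel_left m hp.pos, Finset.mul_sum]
    symm
    refine Finset.sum_bij (fun k _ => p * k) ?_ ?_ ?_ ?_
    · intro k hk
      simp only [Finset.mem_filter, Nat.mem_divisors] at hk ⊢
      exact ⟨⟨Nat.mul_dvd_mul_left p hk.1, hn⟩, dvd_mul_right p k⟩
    · intro k _ l _ hkl
      exact Nat.eq_of_mul_eq_mul_left hp.pos hkl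
    · intro k hk
      simp only [Finset.mem_filter, Nat.mem_divisors] at hk
      obtain ⟨⟨hk1, -⟩, l, rfl⟩ := hk
      exact ⟨l, by simpa [hm] using Nat.dvd_of_mul_dvd_mul_left hp.pos hk1, rfl⟩
    · intro k _
      exact (hf p k).symm
  · refine Finset.sum_eq_zero fun k hk => ?_
    simp only [Finset.mem_filter, Nat.mem_divisors] at hk
    exact absurd (hk.2.trans hk.1.1) h

theorem Nat.sum_divisors_prime_mul {f : ℕ → ℤ} (hf : ∀ m n, f (m * n) = f m * f n) {p : ℕ}
    (hp : p.Prime) {n : ℕ} (hn : n ≠ 0) :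
    ∑ k ∈ (p * n).divisors, f k = (1 + f p) * ∑ k ∈ n.divisors, f k -
      f p * if p ∣ n then ∑ k ∈ (n / p).divisors, f k else 0 := by
  have h1 := Nat.sum_divisors_eq_sum_filter_add hf hp (mul_ne_zero hp.ne_zero hn)
  have h2 := Nat.sum_divisors_eq_sum_filter_add hf hp hn
  rw [if_pos (dvd_mul_right p n), Nat.mul_div_cancel_left n hp.pos] at h1
  have h3 : {k ∈ (p * n).divisors | ¬ p ∣ k} = {k ∈ n.divisors | ¬ p ∣ k} := by
    ext k
    simp only [Finset.mem_filter, Nat.mem_divisors]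
    refine ⟨fun h => ⟨⟨?_, hn⟩, h.2⟩, fun h => ⟨⟨h.1.1.mul_left p, mul_ne_zero hp.ne_zero hn⟩, h.2⟩⟩
    exact (Nat.Coprime.dvd_of_dvd_mul_left ((Nat.Prime.coprime_iff_not_dvd hp).2 h.2).symm h.1.1)
  rw [h3] at h1
  split_ifs at h2 ⊢ with h
  · linear_combination h1 - h2
  · linear_combination h1 - h2

theorem legendreSym_prime_eq_neg {d p : ℕ} [Fact d.Prime] [Fact p.Prime] (hd : d % 4 = 3)
    (hp2 : p ≠ 2) : legendreSym d p = legendreSym p (-d) := by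
  have hpo : p % 2 = 1 := (Fact.out : p.Prime).mod_two_eq_one_iff_ne_two.2 hp2
  rw [legendreSym.quadratic_reciprocity' (p := p) (q := d) hp2 (by omega),
    ← neg_one_mul (d : ℤ), legendreSym.mul,
    legendreSym.at_neg_one hp2, ZMod.χ₄_eq_neg_one_pow hpo]
  congr 1
  have : Odd (d / 2) := by rw [Nat.odd_iff]; omega
  rw [mul_comm, pow_mul, this.neg_one_pow]

theorem legendreSym_two_eq_neg_one {d : ℕ} [Fact d.Prime] (hd : d % 8 = 3) :
    legendreSym d 2 = -1 := by
  rw [legendreSym.at_two (by omega), ZMod.χ₈_nat_eq_if_mod_eight]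
  simp [hd]
  omega

namespace QuadraticAlgebra

theorem finite_setOf_norm_eq {a b : ℤ} (hD : b ^ 2 + 4 * a < 0) (n : ℤ) :
    {z : QuadraticAlgebra ℤ a b | norm z = n}.Finite := by
  refine Set.Finite.subset (((Set.finite_Icc (4 * a * n) (-(4 * a * n))).prod
    (Set.finite_Icc (-(4 * n)) (4 * n))).image fun w => (⟨w.1, w.2⟩ : QuadraticAlgebra ℤ a b)) ?_
  rintro ⟨x, y⟩ (h : norm _ = n)
  have h0 := norm_nonneg_of_disc_neg hD (⟨x, y⟩ : QuadraticAlgebra ℤ a b)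
  rw [norm_def] at h h0
  simp only at h h0
  have e : ∀ t : ℤ, |t| ≤ t ^ 2 := fun t => by
    rcases abs_cases t with ht | ht <;> rw [ht.1] <;> nlinarith
  have hy : y ^ 2 ≤ 4 * n := by nlinarith [sq_nonneg (2 * x + b * y), sq_nonneg y]
  have hx : x ^ 2 ≤ -(4 * a * n) := by nlinarith [sq_nonneg (2 * a * y - b * x), sq_nonneg x]
  have hx' := abs_le.1 ((e x).trans hx)
  have hy' := abs_le.1 ((e y).trans hy)
  refine ⟨(x, y), ⟨⟨?_, ?_⟩, ⟨?_, ?_⟩⟩, rfl⟩ <;> simp only <;> linarith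

theorem ncard_norm_eq_one {c : ℤ} (hc : 1 < c) :
    {z : QuadraticAlgebra ℤ (-c) 1 | norm z = 1}.ncard = 2 := by
  have : {z : QuadraticAlgebra ℤ (-c) 1 | norm z = 1} = {1, -1} := by
    ext z
    simp only [Set.mem_ofPred_eq, Set.mem_insert_iff, Set.mem_singleton_iff]
    constructor
    · obtain ⟨x, y⟩ := z
      intro h
      rw [norm_mk_one] at h
      have hy : y ^ 2 = 0 := by nlinarith [sq_nonneg (2 * x + y), sq_nonneg y]
      have hy0 : y = 0 := by simpa using hy
      subst hy0
      have hx : x ^ 2 = 1 := by linarith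
      rcases (by simpa using hx : x = 1 ∨ x = -1) with rfl | rfl
      · left; ext <;> simp
      · right; ext <;> simp
    · rintro (rfl | rfl) <;> simp
  rw [this, Set.ncard_pair]
  intro h
  simpa using congrArg re h

theorem ncard_image_mul_left {a b : ℤ} (hD : b ^ 2 + 4 * a < 0) {β : QuadraticAlgebra ℤ a b}
    (hβ : β ≠ 0) (s : Set (QuadraticAlgebra ℤ a b)) : ((β * ·) '' s).ncard = s.ncard := by
  have := isDomain_of_disc_neg hD
  exact Set.ncard_image_of_injective s (mul_right_injective₀ hβ)

theorem ncard_norm_inert {a b : ℤ} (hD : b ^ 2 + 4 * a < 0) {p : ℕ} (hp : p.Prime)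
    (hinert : ∀ z : QuadraticAlgebra ℤ a b, (p : ℤ) ∣ norm z →
      ((p : ℤ) : QuadraticAlgebra ℤ a b) ∣ z) (n : ℤ) :
    {z : QuadraticAlgebra ℤ a b | norm z = p * n}.ncard =
      {z : QuadraticAlgebra ℤ a b | p * norm z = n}.ncard := by
  have hp0 : (p : ℤ) ≠ 0 := by exact_mod_cast hp.ne_zero
  have hpR : ((p : ℤ) : QuadraticAlgebra ℤ a b) ≠ 0 := fun h => hp0 (by simpa using congrArg re h)
  rw [← ncard_image_mul_left hD hpR {z | p * norm z = n}]
  congr 1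
  ext z
  constructor
  · intro hz
    obtain ⟨w, rfl⟩ := hinert z ⟨n, hz⟩
    refine ⟨w, ?_, rfl⟩
    rw [Set.mem_ofPred_eq, map_mul, norm_intCast, Int.cast_id] at hz
    exact mul_left_cancel₀ hp0 (by linarith)
  · rintro ⟨w, hw, rfl⟩
    simp only [Set.mem_ofPred_eq, map_mul, norm_intCast, Int.cast_id] at hw ⊢
    rw [← hw]
    ring

theorem ncard_norm_of_forall_dvd {a b : ℤ} (hD : b ^ 2 + 4 * a < 0) {p : ℤ} (hp : p ≠ 0)
    {θ : QuadraticAlgebra ℤ a b} (hθ : norm θ = p)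
    (hram : ∀ z : QuadraticAlgebra ℤ a b, p ∣ norm z → θ ∣ z) (n : ℤ) :
    {z : QuadraticAlgebra ℤ a b | norm z = p * n}.ncard =
      {z : QuadraticAlgebra ℤ a b | norm z = n}.ncard := by
  have hθ0 : θ ≠ 0 := by rintro rfl; simp at hθ; exact hp hθ.symm
  rw [← ncard_image_mul_left hD hθ0 {z | norm z = n}]
  congr 1
  ext z
  constructor
  · intro hz
    obtain ⟨w, rfl⟩ := hram z ⟨n, hz⟩
    refine ⟨w, ?_, rfl⟩
    rw [Set.mem_ofPred_eq, map_mul, hθ] at hz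
    exact mul_left_cancel₀ hp hz
  · rintro ⟨w, hw, rfl⟩
    simp only [Set.mem_ofPred_eq, map_mul, hθ] at hw ⊢
    rw [← hw]

theorem prime_of_norm_prime {a b : ℤ} (hD : b ^ 2 + 4 * a < 0)
    [IsPrincipalIdealRing (QuadraticAlgebra ℤ a b)] {p : ℕ} (hp : p.Prime)
    {β : QuadraticAlgebra ℤ a b} (hβ : norm β = p) : Prime β := by
  have := isDomain_of_disc_neg hD
  refine Irreducible.prime ⟨fun h => ?_, fun u v huv => ?_⟩
  · rw [isUnit_iff_norm_isUnit, hβ, Int.isUnit_iff] at h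
    have := hp.two_le
    omega
  · rw [isUnit_iff_norm_isUnit, isUnit_iff_norm_isUnit]
    have hpi : Irreducible (p : ℤ) := (Nat.prime_iff_prime_int.1 hp).irreducible
    exact hpi.isUnit_or_isUnit (by rw [← hβ, huv, map_mul])

theorem ncard_norm_split {a b : ℤ} (hD : b ^ 2 + 4 * a < 0)
    [IsPrincipalIdealRing (QuadraticAlgebra ℤ a b)] {p : ℕ} (hp : p.Prime)
    {β : QuadraticAlgebra ℤ a b} (hβ : norm β = p) (hβ' : ¬ β ∣ star β) (n : ℤ) :
    {z : QuadraticAlgebra ℤ a b | norm z = p * n}.ncard +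
      {z : QuadraticAlgebra ℤ a b | p * norm z = n}.ncard =
      2 * {z : QuadraticAlgebra ℤ a b | norm z = n}.ncard := by
  have := isDomain_of_disc_neg hD
  have hp0 : (p : ℤ) ≠ 0 := by exact_mod_cast hp.ne_zero
  have hpR : ((p : ℤ) : QuadraticAlgebra ℤ a b) ≠ 0 := fun h => hp0 (by simpa using congrArg re h)
  have hββ : β * star β = (p : ℤ) := by rw [mul_star_eq_intCast_norm, hβ]
  have hP := prime_of_norm_prime hD hp hβ
  have hs0 : star β ≠ 0 := star_ne_zero.2 hP.ne_zero
  have hfin := finite_setOf_norm_eq hD n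
  have hunion : {z : QuadraticAlgebra ℤ a b | norm z = p * n} =
      (β * ·) '' {z | norm z = n} ∪ (star β * ·) '' {z | norm z = n} := by
    ext z
    constructor
    · intro hz
      have hz' : norm z = p * n := hz
      have h1 : β ∣ z * star z := by
        rw [mul_star_eq_intCast_norm, hz', Int.cast_mul, ← hββ, mul_assoc]
        exact dvd_mul_right _ _
      rcases hP.dvd_or_dvd h1 with ⟨w, rfl⟩ | h
      · left
        refine ⟨w, ?_, rfl⟩
        rw [map_mul, hβ] at hz'
        exact mul_left_cancel₀ hp0 hz'
      · right
        rw [← star_dvd_star_iff, star_star] at h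
        obtain ⟨w, rfl⟩ := h
        refine ⟨w, ?_, rfl⟩
        rw [map_mul, norm_star, hβ] at hz'
        exact mul_left_cancel₀ hp0 hz'
    · rintro (⟨w, hw, rfl⟩ | ⟨w, hw, rfl⟩) <;>
        simp only [Set.mem_ofPred_eq, map_mul, norm_star, hβ] at hw ⊢ <;> rw [hw]
  have hinter : (β * ·) '' {z | norm z = n} ∩ (star β * ·) '' {z | norm z = n} =
      (((p : ℤ) : QuadraticAlgebra ℤ a b) * ·) '' {z | p * norm z = n} := by
    ext z
    constructor
    · rintro ⟨⟨w, hw, rfl⟩, ⟨w', hw', h⟩⟩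
      simp only [Set.mem_ofPred_eq] at hw hw' h
      have h1 : β ∣ star β * w' := ⟨w, h⟩
      obtain ⟨v, rfl⟩ := (hP.dvd_or_dvd h1).resolve_left hβ'
      refine ⟨v, ?_, ?_⟩
      · rw [map_mul, hβ] at hw'
        exact hw'
      · simp only
        rw [← h, ← hββ]
        ring
    · rintro ⟨v, hv, rfl⟩
      simp only [Set.mem_ofPred_eq] at hv
      refine ⟨⟨star β * v, ?_, ?_⟩, ⟨β * v, ?_, ?_⟩⟩
      · rw [Set.mem_ofPred_eq, map_mul, norm_star, hβ, hv]
      · simp only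
        rw [← hββ, mul_assoc]
      · rw [Set.mem_ofPred_eq, map_mul, hβ, hv]
      · simp only
        rw [← hββ]
        ring
  have h := Set.ncard_union_add_ncard_inter ((β * ·) '' {z | norm z = n})
    ((star β * ·) '' {z | norm z = n}) (hfin.image _) (hfin.image _)
  rwa [← hunion, hinter, ncard_image_mul_left hD hP.ne_zero, ncard_image_mul_left hD hs0,
    ncard_image_mul_left hD hpR, ← two_mul] at h

theorem ncard_norm_prime_mul {d : ℕ} [Fact d.Prime] (hd : d % 8 = 3) {c : ℤ}
    (hc : (d : ℤ) = 4 * c - 1) [IsPrincipalIdealRing (QuadraticAlgebra ℤ (-c) 1)]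
    {p : ℕ} (hp : p.Prime) (n : ℤ) :
    ({z : QuadraticAlgebra ℤ (-c) 1 | norm z = p * n}.ncard : ℤ) =
      (1 + legendreSym d p) * {z : QuadraticAlgebra ℤ (-c) 1 | norm z = n}.ncard -
        legendreSym d p * {z : QuadraticAlgebra ℤ (-c) 1 | p * norm z = n}.ncard := by
  have hdp : d.Prime := Fact.out
  have hD : (1 : ℤ) ^ 2 + 4 * -c < 0 := by have := hdp.pos; omega
  have hinert (h : ∀ z : QuadraticAlgebra ℤ (-c) 1, (p : ℤ) ∣ norm z →
      ((p : ℤ) : QuadraticAlgebra ℤ (-c) 1) ∣ z) (h1 : legendreSym d p = -1) :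
      ({z : QuadraticAlgebra ℤ (-c) 1 | norm z = p * n}.ncard : ℤ) =
      (1 + legendreSym d p) * {z : QuadraticAlgebra ℤ (-c) 1 | norm z = n}.ncard -
        legendreSym d p * {z : QuadraticAlgebra ℤ (-c) 1 | p * norm z = n}.ncard := by
    rw [ncard_norm_inert hD hp h, h1]
    ring
  rcases eq_or_ne p 2 with rfl | hp2
  · refine hinert (fun z hz => ?_) (legendreSym_two_eq_neg_one hd)
    refine intCast_dvd_of_forall_range hp ?_ z hz
    have hc2 : c % 2 = 1 := by omega
    intro x hx y hy hxy
    simp only [Finset.mem_range] at hx hy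
    interval_cases x <;> interval_cases y <;> simp at hxy ⊢ <;> omega
  have : Fact p.Prime := ⟨hp⟩
  have hpZ : Prime (p : ℤ) := Nat.prime_iff_prime_int.1 hp
  have hp2Z : ¬ (p : ℤ) ∣ 2 := fun h =>
    hp2 ((Nat.prime_dvd_prime_iff_eq hp Nat.prime_two).1 (by exact_mod_cast h))
  have h4N : ∀ x y : ℤ, 4 * norm (⟨x, y⟩ : QuadraticAlgebra ℤ (-c) 1) =
      (2 * x + y) ^ 2 + d * y ^ 2 := fun x y => by
    rw [norm_mk_one, hc]; ring
  rcases eq_or_ne p d with rfl | hpd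
  · have h0 : legendreSym p p = 0 := (legendreSym.eq_zero_iff p p).2 (by simp)
    rw [h0, ncard_norm_of_forall_dvd hD hpZ.ne_zero (θ := ⟨-1, 2⟩)]
    · ring
    · rw [norm_mk_one, hc]; ring
    · rintro ⟨x, y⟩ hz
      have h1 : (p : ℤ) ∣ (2 * x + y) ^ 2 + p * y ^ 2 := h4N x y ▸ hz.mul_left 4
      obtain ⟨t, ht⟩ := hpZ.dvd_of_dvd_pow ((dvd_add_left (dvd_mul_right _ _)).1 h1)
      refine ⟨⟨2 * c * t - x, -t⟩, QuadraticAlgebra.ext ?_ ?_⟩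
      · simp only [re_mul]
        ring
      · simp only [im_mul]
        linear_combination ht + t * hc
  · have hd0 : ((d : ℤ) : ZMod p) ≠ 0 := by
      rw [Ne, ZMod.intCast_zmod_eq_zero_iff_dvd, Int.natCast_dvd_natCast,
        Nat.prime_dvd_prime_iff_eq hp hdp]
      exact hpd
    by_cases hex : ∃ z : QuadraticAlgebra ℤ (-c) 1, (p : ℤ) ∣ norm z ∧
        ¬ ((p : ℤ) : QuadraticAlgebra ℤ (-c) 1) ∣ z
    · obtain ⟨z, hz, hpz⟩ := hex
      obtain ⟨β, hβ⟩ := exists_norm_eq_prime hD hp hz hpz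
      have h1 : legendreSym d p = 1 := by
        rw [legendreSym_prime_eq_neg (by omega) hp2]
        obtain ⟨x, y⟩ := z
        have hxy : (p : ℤ) ∣ (2 * x + y) ^ 2 + d * y ^ 2 := h4N x y ▸ hz.mul_left 4
        refine legendreSym.eq_one_of_sq_sub_mul_sq_eq_zero (by simpa using hd0)
          (x := ((2 * x + y : ℤ) : ZMod p)) (y := ((y : ℤ) : ZMod p)) ?_ ?_
        · rw [Ne, ZMod.intCast_zmod_eq_zero_iff_dvd]
          intro hy
          have h2 := hpZ.dvd_of_dvd_pow ((dvd_add_left ((dvd_pow hy two_ne_zero).mul_left _)).1 hxy)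
          have hx := (hpZ.dvd_or_dvd ((dvd_add_left hy).1 h2)).resolve_left hp2Z
          exact hpz ((intCast_dvd_iff _ _).2 ⟨hx, hy⟩)
        · have := (ZMod.intCast_zmod_eq_zero_iff_dvd _ p).2 hxy
          push_cast at this ⊢
          linear_combination this
      have hns : ¬ β ∣ star β := by
        obtain ⟨X, Y⟩ := β
        intro h
        have h2 : (⟨X, Y⟩ : QuadraticAlgebra ℤ (-c) 1) ∣
            ((2 * X + Y : ℤ) : QuadraticAlgebra ℤ (-c) 1) := by
          convert dvd_add_self_left.2 h using 1
          ext <;> simp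
          ring
        obtain ⟨w, hw⟩ := h2
        have h3 : (2 * X + Y) ^ 2 = p * norm w := by
          rw [← hβ, ← map_mul, ← hw, norm_intCast, Int.cast_id]
        have h4 : (p : ℤ) ∣ 2 * X + Y := hpZ.dvd_of_dvd_pow ⟨_, h3⟩
        have h5 : (p : ℤ) ∣ d * Y ^ 2 := by
          refine (dvd_add_right (dvd_pow h4 two_ne_zero)).1 ?_
          rw [← h4N, hβ]
          exact dvd_mul_left _ _
        have h6 : (p : ℤ) ∣ Y := by
          refine hpZ.dvd_of_dvd_pow ((hpZ.dvd_or_dvd h5).resolve_left fun h => ?_)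
          exact hpd ((Nat.prime_dvd_prime_iff_eq hp hdp).1 (by exact_mod_cast h))
        have h7 := (hpZ.dvd_or_dvd ((dvd_add_left h6).1 h4)).resolve_left hp2Z
        obtain ⟨A, rfl⟩ := h7
        obtain ⟨B, rfl⟩ := h6
        rw [norm_mk_one] at hβ
        have h8 : (p : ℤ) * (A ^ 2 + A * B + c * B ^ 2) = 1 := by
          refine mul_left_cancel₀ hpZ.ne_zero ?_
          linear_combination hβ
        exact hpZ.not_isUnit (IsUnit.of_mul_eq_one _ h8)
      have := ncard_norm_split hD hp hβ hns n
      rw [h1]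
      zify at this
      linear_combination this
    · push Not at hex
      refine hinert hex ?_
      rw [legendreSym_prime_eq_neg (by omega) hp2, legendreSym.eq_neg_one_iff]
      rintro ⟨t, ht⟩
      obtain ⟨T, rfl⟩ := ZMod.intCast_surjective t
      have h1 : (p : ℤ) ∣ T ^ 2 + d := by
        rw [← ZMod.intCast_zmod_eq_zero_iff_dvd]
        push_cast at ht ⊢
        linear_combination -ht
      have h2 := hex ⟨T - 1, 2⟩ (by
        rw [norm_mk_one]
        convert h1 using 1
        rw [hc]
        ring)
      exact hp2Z ((intCast_dvd_iff _ _).1 h2).2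

theorem ncard_norm_eq_two_mul_sum {d : ℕ} [Fact d.Prime] (hd : d % 8 = 3) (hd3 : 3 < d) {c : ℤ}
    (hc : (d : ℤ) = 4 * c - 1) [IsPrincipalIdealRing (QuadraticAlgebra ℤ (-c) 1)]
    {n : ℕ} (hn : n ≠ 0) :
    ({z : QuadraticAlgebra ℤ (-c) 1 | norm z = n}.ncard : ℤ) =
      2 * ∑ m ∈ n.divisors, legendreSym d m := by
  induction n using Nat.strong_induction_on with
  | _ n ih =>
  rcases eq_or_ne n 1 with rfl | hn1
  · rw [Nat.cast_one, ncard_norm_eq_one (by omega)]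
    simp
  · obtain ⟨m, hm⟩ := n.minFac_dvd
    have hp := Nat.minFac_prime hn1
    generalize n.minFac = p at hm hp
    subst hm
    have hm0 : m ≠ 0 := right_ne_zero_of_mul hn
    have hmn : m < p * m := lt_mul_of_one_lt_left (Nat.pos_of_ne_zero hm0) hp.one_lt
    rw [Nat.sum_divisors_prime_mul (f := fun k => legendreSym d k)
      (fun a b => by rw [Nat.cast_mul, legendreSym.mul]) hp hm0, Nat.cast_mul,
      ncard_norm_prime_mul hd hc hp, ih m hmn hm0]
    have hq : ({z : QuadraticAlgebra ℤ (-c) 1 | p * norm z = (m : ℤ)}.ncard : ℤ) =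
        2 * if p ∣ m then ∑ k ∈ (m / p).divisors, legendreSym d k else 0 := by
      have hp0 : (p : ℤ) ≠ 0 := by exact_mod_cast hp.ne_zero
      split_ifs with h
      · obtain ⟨l, rfl⟩ := h
        have hl0 : l ≠ 0 := right_ne_zero_of_mul hm0
        have hlp : l < p * l := lt_mul_of_one_lt_left (Nat.pos_of_ne_zero hl0) hp.one_lt
        rw [Nat.mul_div_cancel_left l hp.pos, ← ih l (hlp.trans hmn) hl0]
        simp [hp.ne_zero]
      · have : {z : QuadraticAlgebra ℤ (-c) 1 | p * norm z = (m : ℤ)} = ∅ := by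
          rw [Set.eq_empty_iff_forall_notMem]
          intro z hz
          exact h (Int.natCast_dvd_natCast.1 ⟨norm z, hz.symm⟩)
        rw [this]
        simp
    rw [hq]
    ring

end QuadraticAlgebra

section

open MeasureTheory Filter Topology

/-- The Epstein-type sum `∑ₙ ((n + a)² + b²)⁻ˢ` over all integers. -/
noncomputable def latticeSum (s a b : ℝ) : ℝ := ∑' n : ℤ, ((n + a) ^ 2 + b ^ 2) ^ (-s)

/-- The integral of `(1 + u²)⁻ˢ` over the real line. -/
noncomputable def powIntegral (s : ℝ) : ℝ := ∫ u : ℝ, (1 + u ^ 2) ^ (-s)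

theorem one_add_sq_rpow_neg_le {s : ℝ} (hs : 1 ≤ s) (u : ℝ) :
    (1 + u ^ 2) ^ (-s) ≤ (1 + u ^ 2)⁻¹ := by
  rw [← Real.rpow_neg_one]
  exact Real.rpow_le_rpow_of_exponent_le (by nlinarith [sq_nonneg u]) (by linarith)

theorem continuous_one_add_sq_rpow_neg (s : ℝ) :
    Continuous fun u : ℝ => (1 + u ^ 2) ^ (-s) := by
  refine Continuous.rpow_const (by fun_prop) fun u => Or.inl ?_
  positivity

theorem integrable_one_add_sq_rpow_neg {s : ℝ} (hs : 1 ≤ s) :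
    Integrable fun u : ℝ => (1 + u ^ 2) ^ (-s) := by
  refine integrable_inv_one_add_sq.mono'
    (continuous_one_add_sq_rpow_neg s).aestronglyMeasurable (ae_of_all _ fun u => ?_)
  rw [Real.norm_of_nonneg (by positivity)]
  exact one_add_sq_rpow_neg_le hs u

theorem powIntegral_le_pi {s : ℝ} (hs : 1 ≤ s) : powIntegral s ≤ Real.pi := by
  rw [← integral_univ_inv_one_add_sq]
  exact integral_mono (integrable_one_add_sq_rpow_neg hs) integrable_inv_one_add_sq
    (one_add_sq_rpow_neg_le hs)

theorem tendsto_powIntegral : Tendsto powIntegral (𝓝[>] 1) (𝓝 Real.pi) := by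
  rw [← integral_univ_inv_one_add_sq]
  refine tendsto_integral_filter_of_dominated_convergence (fun u : ℝ => (1 + u ^ 2)⁻¹)
    (Eventually.of_forall fun s => (continuous_one_add_sq_rpow_neg s).aestronglyMeasurable)
    ?_ integrable_inv_one_add_sq (ae_of_all _ fun u => ?_)
  · filter_upwards [self_mem_nhdsWithin] with s hs
    refine ae_of_all _ fun u => ?_
    rw [Real.norm_of_nonneg (by positivity)]
    exact one_add_sq_rpow_neg_le (le_of_lt hs) u
  · have : ContinuousAt (fun s : ℝ => (1 + u ^ 2) ^ (-s)) 1 :=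
      ContinuousAt.rpow continuousAt_const continuousAt_id.neg (Or.inl (by positivity))
    have h := this.tendsto.mono_left (nhdsWithin_le_nhds (s := Set.Ioi 1))
    rwa [Real.rpow_neg_one] at h

theorem sq_add_sq_rpow_neg_eq {b : ℝ} (hb : 0 < b) (s u : ℝ) :
    (u ^ 2 + b ^ 2) ^ (-s) = b ^ (-(2 * s)) * (1 + (b⁻¹ * u) ^ 2) ^ (-s) := by
  have : u ^ 2 + b ^ 2 = b ^ 2 * (1 + (b⁻¹ * u) ^ 2) := by field_simp; ring
  rw [this, Real.mul_rpow (by positivity) (by positivity), ← Real.rpow_natCast,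
    ← Real.rpow_mul hb.le]
  norm_num

theorem integrable_sq_add_sq_rpow_neg {s b : ℝ} (hs : 1 ≤ s) (hb : 0 < b) :
    Integrable fun u : ℝ => (u ^ 2 + b ^ 2) ^ (-s) := by
  simp_rw [sq_add_sq_rpow_neg_eq hb]
  exact ((integrable_one_add_sq_rpow_neg hs).comp_mul_left' (inv_ne_zero hb.ne')).const_mul _

theorem integral_sq_add_sq_rpow_neg {s b : ℝ} (hb : 0 < b) :
    ∫ u : ℝ, (u ^ 2 + b ^ 2) ^ (-s) = b ^ (1 - 2 * s) * powIntegral s := by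
  simp_rw [sq_add_sq_rpow_neg_eq hb]
  rw [integral_const_mul, Measure.integral_comp_mul_left (fun u : ℝ => (1 + u ^ 2) ^ (-s)),
    inv_inv, abs_of_pos hb, smul_eq_mul, ← mul_assoc, powIntegral, sub_eq_add_neg,
    Real.rpow_add hb, Real.rpow_one, mul_comm b]

theorem rpow_neg_sub_le {s ρ w w' : ℝ} (hs : 1 ≤ s) (hs2 : s ≤ 2) (hw : 0 < w) (hw' : 0 < w')
    (hρ : 1 ≤ ρ) (h₁ : w' ≤ ρ * w) (h₂ : w ≤ ρ * w') :
    |w ^ (-s) - w' ^ (-s)| ≤ (ρ ^ 2 - 1) * w' ^ (-s) := by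
  have key : ∀ {x y : ℝ}, 0 < x → 0 < y → x ≤ ρ * y → y ^ (-s) ≤ ρ ^ 2 * x ^ (-s) := by
    intro x y hx hy hxy
    have hρ0 : 0 < ρ := by linarith
    have h1 : (ρ * y) ^ (-s) ≤ x ^ (-s) := Real.rpow_le_rpow_of_nonpos hx hxy (by linarith)
    rw [Real.mul_rpow hρ0.le hy.le] at h1
    have h2 : ρ ^ s ≤ ρ ^ (2 : ℝ) := Real.rpow_le_rpow_of_exponent_le hρ hs2
    have h3 : ρ ^ s * ρ ^ (-s) = 1 := by rw [← Real.rpow_add hρ0]; simp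
    rw [Real.rpow_two] at h2
    calc y ^ (-s) = ρ ^ s * (ρ ^ (-s) * y ^ (-s)) := by rw [← mul_assoc, h3, one_mul]
      _ ≤ ρ ^ s * x ^ (-s) := by gcongr
      _ ≤ _ := by gcongr
  have k1 := key hw' hw h₁
  have k2 := key hw hw' h₂
  have hpos : 0 < w' ^ (-s) := by positivity
  have hpos' : 0 < w ^ (-s) := by positivity
  have hρ2 : 1 ≤ ρ ^ 2 := by nlinarith
  rw [abs_le]
  constructor
  · rcases le_total (w' ^ (-s)) (w ^ (-s)) with h | h
    · nlinarith
    · nlinarith [mul_nonneg (sub_nonneg.2 hρ2) (sub_nonneg.2 h)]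
  · linarith

theorem sq_add_sq_rpow_neg_sub_le {s b u x : ℝ} (hs : 1 ≤ s) (hs2 : s ≤ 2) (hb : 1 ≤ b)
    (hx : 0 ≤ x) (hx1 : x ≤ 1) :
    |(u ^ 2 + b ^ 2) ^ (-s) - ((u + x) ^ 2 + b ^ 2) ^ (-s)| ≤
      8 / b * ((u + x) ^ 2 + b ^ 2) ^ (-s) := by
  have hb0 : 0 < b := by linarith
  have aux : ∀ {v y : ℝ}, |y| ≤ 1 → (v + y) ^ 2 + b ^ 2 ≤ (1 + 2 / b) * (v ^ 2 + b ^ 2) := by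
    intro v y hy
    have h1 : b * (2 * v * y + y ^ 2) ≤ 2 * (v ^ 2 + b ^ 2) := by
      have hy2 : y ^ 2 ≤ 1 := (sq_le_one_iff_abs_le_one y).2 hy
      nlinarith [sq_nonneg (v * y - b), mul_nonneg (sq_nonneg v) (sub_nonneg.2 hy2)]
    have h2 : 2 * v * y + y ^ 2 ≤ 2 / b * (v ^ 2 + b ^ 2) := by
      rw [div_mul_eq_mul_div, le_div_iff₀ hb0]; linarith
    nlinarith
  have hρ : (1 : ℝ) ≤ 1 + 2 / b := by have : 0 ≤ 2 / b := by positivity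
                                      linarith
  refine (rpow_neg_sub_le hs hs2 (by positivity) (by positivity) hρ
    (aux (by rwa [abs_of_nonneg hx])) ?_).trans ?_
  · have := aux (v := u + x) (y := -x) (by rwa [abs_neg, abs_of_nonneg hx])
    simpa using this
  · refine mul_le_mul_of_nonneg_right ?_ (by positivity)
    rw [le_div_iff₀ hb0]
    have : ((1 + 2 / b) ^ 2 - 1) * b = 4 + 4 / b := by field_simp; ring
    rw [this]
    have : 4 / b ≤ 4 := div_le_self (by norm_num) hb
    linarith

theorem lattice_term_sub_integral_le {s a b : ℝ} (hs : 1 ≤ s) (hs2 : s ≤ 2) (hb : 1 ≤ b)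
    (n : ℤ) :
    |((n + a) ^ 2 + b ^ 2) ^ (-s) - ∫ x in (0 : ℝ)..1, ((x + n + a) ^ 2 + b ^ 2) ^ (-s)| ≤
      8 / b * ∫ x in (0 : ℝ)..1, ((x + n + a) ^ 2 + b ^ 2) ^ (-s) := by
  have hb0 : 0 < b := by linarith
  have hc : Continuous fun x : ℝ => ((x + n + a) ^ 2 + b ^ 2) ^ (-s) :=
    Continuous.rpow_const (by fun_prop) fun u => Or.inl (by positivity)
  have h1 : ((n + a) ^ 2 + b ^ 2) ^ (-s) - ∫ x in (0 : ℝ)..1, ((x + n + a) ^ 2 + b ^ 2) ^ (-s) =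
      ∫ x in (0 : ℝ)..1, (((n + a) ^ 2 + b ^ 2) ^ (-s) - ((x + n + a) ^ 2 + b ^ 2) ^ (-s)) := by
    rw [intervalIntegral.integral_sub (by simp) (hc.intervalIntegrable _ _)]
    simp
  rw [h1, ← Real.norm_eq_abs, ← intervalIntegral.integral_const_mul]
  refine intervalIntegral.norm_integral_le_of_norm_le zero_le_one
    (ae_of_all _ fun x hx => ?_) ((hc.const_mul _).intervalIntegrable _ _)
  have := sq_add_sq_rpow_neg_sub_le (u := n + a) hs hs2 hb hx.1.le hx.2
  rw [show (n + a + x : ℝ) = x + n + a by ring] at this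
  rwa [Real.norm_eq_abs]

theorem hasSum_integral_lattice {s a b : ℝ} (hs : 1 ≤ s) (hb : 0 < b) :
    HasSum (fun n : ℤ => ∫ x in (0 : ℝ)..1, ((x + n + a) ^ 2 + b ^ 2) ^ (-s))
      (b ^ (1 - 2 * s) * powIntegral s) := by
  rw [← integral_sq_add_sq_rpow_neg hb, ← integral_add_right_eq_self _ a]
  exact Integrable.hasSum_intervalIntegral_comp_add_int
    ((integrable_sq_add_sq_rpow_neg hs hb).comp_add_right a)

theorem summable_lattice {s a b : ℝ} (hs : 1 ≤ s) (hs2 : s ≤ 2) (hb : 1 ≤ b) :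
    Summable fun n : ℤ => ((n + a) ^ 2 + b ^ 2) ^ (-s) := by
  have h := (hasSum_integral_lattice (a := a) hs (by linarith : 0 < b)).summable
  have h2 : Summable fun n : ℤ => ((n + a) ^ 2 + b ^ 2) ^ (-s) -
      ∫ x in (0 : ℝ)..1, ((x + n + a) ^ 2 + b ^ 2) ^ (-s) :=
    Summable.of_norm_bounded (h.mul_left (8 / b))
      fun n => lattice_term_sub_integral_le hs hs2 hb n
  simpa using h2.add h

theorem latticeSum_sub_le {s a b : ℝ} (hs : 1 ≤ s) (hs2 : s ≤ 2) (hb : 1 ≤ b) :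
    |latticeSum s a b - b ^ (1 - 2 * s) * powIntegral s| ≤ 8 * Real.pi * b ^ (-(2 * s)) := by
  have hb0 : 0 < b := by linarith
  have h := hasSum_integral_lattice (a := a) hs hb0
  have h2 := (summable_lattice (a := a) hs hs2 hb).hasSum.sub h
  have h3 : ‖∑' n : ℤ, (((n + a) ^ 2 + b ^ 2) ^ (-s) -
      ∫ x in (0 : ℝ)..1, ((x + n + a) ^ 2 + b ^ 2) ^ (-s))‖ ≤ _ :=
    tsum_of_norm_bounded (h.mul_left (8 / b))
      fun n => lattice_term_sub_integral_le hs hs2 hb n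
  rw [h2.tsum_eq] at h3
  refine h3.trans ?_
  calc 8 / b * (b ^ (1 - 2 * s) * powIntegral s) = 8 * powIntegral s * b ^ (-(2 * s)) := by
        rw [sub_eq_add_neg, Real.rpow_add hb0, Real.rpow_one]; field_simp
    _ ≤ _ := by gcongr; exact powIntegral_le_pi hs

theorem tendsto_latticeSum {a b : ℝ} (hb : 1 ≤ b) :
    Tendsto (fun s => latticeSum s a b) (𝓝[>] 1) (𝓝 (latticeSum 1 a b)) := by
  have hb0 : 0 < b := by linarith
  refine tendsto_tsum_of_dominated_convergence
    (summable_lattice (a := a) le_rfl one_le_two hb) (fun n => ?_) ?_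
  · have : ContinuousAt (fun s : ℝ => (((n : ℝ) + a) ^ 2 + b ^ 2) ^ (-s)) 1 :=
      ContinuousAt.rpow continuousAt_const continuousAt_id.neg (Or.inl (by positivity))
    exact this.tendsto.mono_left nhdsWithin_le_nhds
  · filter_upwards [self_mem_nhdsWithin] with s hs n
    rw [Real.norm_of_nonneg (by positivity)]
    exact Real.rpow_le_rpow_of_exponent_le (by nlinarith [sq_nonneg (n + a)])
      (neg_le_neg (le_of_lt hs))

end

section

open MeasureTheory Filter Topology

theorem im_one_div_of_coords {x y : ℝ} (w : ℂ) (hr : w.re = x) (hi : w.im = y) :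
    (1 / w).im = -(y * (x ^ 2 + y ^ 2)⁻¹) := by
  rw [one_div, Complex.inv_im, Complex.normSq_apply, hr, hi]
  ring_nf

theorem latticeSum_one_eq {a b : ℝ} (hb : 1 ≤ b) {q : ℂ}
    (hq : q = Complex.exp (2 * Real.pi * Complex.I * (a + b * Complex.I))) :
    latticeSum 1 a b = Real.pi / b * (1 + 2 * (q / (1 - q)).re) := by
  have hb0 : 0 < b := by linarith
  set z : UpperHalfPlane := ⟨a + b * Complex.I, by simpa using hb0⟩ with hz
  have hzc : (z : ℂ) = a + b * Complex.I := rfl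
  have hq1 : ‖q‖ < 1 := by
    rw [hq, ← hzc]; exact UpperHalfPlane.norm_exp_two_pi_I_lt_one z
  have hq0 : 1 - q ≠ 0 := by
    intro h
    rw [← sub_eq_zero.1 h] at hq1
    simp at hq1
  have h1 := pi_mul_cot_pi_q_exp z
  rw [cot_series_rep' _ |> sub_eq_iff_eq_add.1] at h1
  swap
  · exact UpperHalfPlane.coe_mem_integerComplement z
  rw [hzc, ← hq, tsum_geometric_of_norm_lt_one hq1] at h1
  have hsum := summable_cotTerm (UpperHalfPlane.coe_mem_integerComplement z)
  simp only [hzc, cotTerm] at hsum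
  have hf := summable_lattice (a := a) le_rfl one_le_two hb
  have hf1 := hf.comp_injective (i := fun n : ℕ => ((n : ℤ) + 1)) fun x y h => by simpa using h
  have hf2 := hf.comp_injective (i := fun n : ℕ => (-((n : ℤ) + 1) : ℤ))
    fun x y h => by simpa using h
  have hadd : latticeSum 1 a b = _ := tsum_of_add_one_of_neg_add_one hf1 hf2
  have him := ((Complex.hasSum_iff _ _).1 hsum.hasSum).2
  have hterm : ∀ n : ℕ, (1 / (a + b * Complex.I - (n + 1)) +
      1 / (a + b * Complex.I + (n + 1)) : ℂ).im =
      -b * ((((((n : ℤ) + 1 : ℤ) : ℝ) + a) ^ 2 + b ^ 2) ^ (-(1 : ℝ)) +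
        ((((-((n : ℤ) + 1) : ℤ) : ℝ) + a) ^ 2 + b ^ 2) ^ (-(1 : ℝ))) := by
    intro n
    rw [Complex.add_im, im_one_div_of_coords (x := a - (n + 1)) (y := b) _ (by simp) (by simp),
      im_one_div_of_coords (x := a + (n + 1)) (y := b) _ (by simp) (by simp)]
    simp only [Real.rpow_neg_one]
    push_cast
    ring
  simp only [hterm] at him
  have h2 := him.unique ((hf1.hasSum.add hf2.hasSum).mul_left (-b))
  have h3 := congrArg Complex.im h1
  rw [Complex.add_im, h2, im_one_div_of_coords (x := a) (y := b) _ (by simp) (by simp)] at h3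
  have h4 : (Real.pi * Complex.I - 2 * Real.pi * Complex.I * (1 - q)⁻¹ : ℂ).im =
      -(Real.pi * (1 + 2 * (q / (1 - q)).re)) := by
    have : (1 - q)⁻¹ = 1 + q / (1 - q) := by field_simp; ring
    rw [this]
    simp
    ring
  rw [h4] at h3
  rw [hadd, div_mul_eq_mul_div, eq_div_iff hb0.ne']
  simp only [Int.cast_zero, zero_add, Real.rpow_neg_one]
  simp only [Function.comp_def, Real.rpow_neg_one] at h3
  linear_combination -h3

end

section

open MeasureTheory Filter Topology

theorem norm_one_sub_le_two_mul {z : ℂ} (hz : ‖z‖ = 1) {r : ℝ} (hr0 : 0 ≤ r) (hr : r ≤ 1) :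
    ‖1 - z‖ ≤ 2 * ‖1 - z * r‖ := by
  have h2 : (1 - z : ℂ) = (1 - z * r) - z * ((1 - r : ℝ) : ℂ) := by push_cast; ring
  have h3 : ‖z * ((1 - r : ℝ) : ℂ)‖ = 1 - r := by
    rw [norm_mul, hz, one_mul, Complex.norm_of_nonneg (by linarith)]
  have h4 : 1 - r ≤ ‖1 - z * r‖ := by
    have := norm_sub_norm_le (1 : ℂ) (z * r)
    rwa [norm_mul, hz, one_mul, Complex.norm_of_nonneg hr0, norm_one] at this
  have := norm_sub_le (1 - z * r) (z * ((1 - r : ℝ) : ℂ))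
  rw [← h2, h3] at this
  linarith

theorem one_sub_mul_exp_mem_slitPlane {z : ℂ} (hz : ‖z‖ = 1) (hz1 : z ≠ 1) {t : ℝ} (ht : 0 ≤ t) :
    1 - z * (Real.exp (-t) : ℝ) ∈ Complex.slitPlane := by
  left
  have hre : z.re < 1 := by
    refine lt_of_le_of_ne (hz ▸ Complex.re_le_norm z) fun h => hz1 ?_
    have h2 := Complex.sq_norm z
    rw [hz, Complex.normSq_apply, h] at h2
    exact Complex.ext h (by simpa using h2)
  have h1 : Real.exp (-t) ≤ 1 := Real.exp_le_one_iff.2 (by linarith)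
  have h0 : 0 < Real.exp (-t) := Real.exp_pos _
  simp only [Complex.sub_re, Complex.one_re, Complex.re_mul_ofReal]
  nlinarith

theorem hasDerivAt_log_one_sub_mul_exp {z : ℂ} (hz : ‖z‖ = 1) (hz1 : z ≠ 1) {t : ℝ} (ht : 0 ≤ t) :
    HasDerivAt (fun t : ℝ => Complex.log (1 - z * (Real.exp (-t) : ℝ)))
      (z * (Real.exp (-t) : ℝ) / (1 - z * (Real.exp (-t) : ℝ))) t := by
  have h1 : HasDerivAt (fun t : ℝ => Real.exp (-t)) (-Real.exp (-t)) t := by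
    simpa using (hasDerivAt_neg t).exp
  have h2 : HasDerivAt (fun t : ℝ => 1 - z * ((Real.exp (-t) : ℝ) : ℂ))
      (z * (Real.exp (-t) : ℝ)) t := by
    simpa using (h1.ofReal_comp.const_mul z).const_sub 1
  exact h2.clog_real (one_sub_mul_exp_mem_slitPlane hz hz1 ht)

theorem norm_mul_exp_div_le {z : ℂ} (hz : ‖z‖ = 1) (hz1 : z ≠ 1) {t : ℝ} (ht : 0 ≤ t) :
    ‖z * (Real.exp (-t) : ℝ) / (1 - z * (Real.exp (-t) : ℝ))‖ ≤
      2 / ‖1 - z‖ * Real.exp (-t) := by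
  have h1 : Real.exp (-t) ≤ 1 := Real.exp_le_one_iff.2 (by linarith)
  have h := norm_one_sub_le_two_mul hz (Real.exp_pos (-t)).le h1
  have h0 : 0 < ‖1 - z‖ := norm_pos_iff.2 (sub_ne_zero.2 hz1.symm)
  rw [norm_div, norm_mul, hz, one_mul, Complex.norm_of_nonneg (Real.exp_pos _).le,
    div_mul_eq_mul_div, div_le_div_iff₀ (by linarith) h0]
  nlinarith [Real.exp_pos (-t)]

theorem continuousOn_mul_exp_div {z : ℂ} (hz : ‖z‖ = 1) (hz1 : z ≠ 1) :
    ContinuousOn (fun t : ℝ => z * (Real.exp (-t) : ℝ) / (1 - z * (Real.exp (-t) : ℝ)))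
      (Set.Ioi 0) := by
  refine ContinuousOn.div (by fun_prop) (by fun_prop) fun t ht => ?_
  exact Complex.slitPlane_ne_zero (one_sub_mul_exp_mem_slitPlane hz hz1 (le_of_lt ht))

theorem integrableOn_mul_exp_div {z : ℂ} (hz : ‖z‖ = 1) (hz1 : z ≠ 1) :
    IntegrableOn (fun t : ℝ => z * (Real.exp (-t) : ℝ) / (1 - z * (Real.exp (-t) : ℝ)))
      (Set.Ioi 0) := by
  refine Integrable.mono' ((integrableOn_exp_neg_Ioi 0).const_mul (2 / ‖1 - z‖))
    ((continuousOn_mul_exp_div hz hz1).aestronglyMeasurable measurableSet_Ioi) ?_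
  filter_upwards [ae_restrict_mem measurableSet_Ioi] with t ht
  exact norm_mul_exp_div_le hz hz1 (le_of_lt ht)

theorem integral_mul_exp_div {z : ℂ} (hz : ‖z‖ = 1) (hz1 : z ≠ 1) :
    ∫ t in Set.Ioi (0 : ℝ), z * (Real.exp (-t) : ℝ) / (1 - z * (Real.exp (-t) : ℝ)) =
      -Complex.log (1 - z) := by
  have hlim : Tendsto (fun t : ℝ => Complex.log (1 - z * (Real.exp (-t) : ℝ))) atTop (𝓝 0) := by
    have h1 : Tendsto (fun t : ℝ => (1 - z * ((Real.exp (-t) : ℝ) : ℂ))) atTop (𝓝 1) := by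
      have := (Complex.continuous_ofReal.tendsto 0).comp Real.tendsto_exp_neg_atTop_nhds_zero
      simpa [Function.comp_def] using Tendsto.const_sub (1 : ℂ) (Tendsto.const_mul z this)
    simpa using h1.clog (by simp)
  rw [integral_Ioi_of_hasDerivAt_of_tendsto'
    (fun t ht => hasDerivAt_log_one_sub_mul_exp hz hz1 ht)
    (integrableOn_mul_exp_div hz hz1) hlim]
  simp

theorem tendsto_mellin_mul_exp_div {z : ℂ} (hz : ‖z‖ = 1) (hz1 : z ≠ 1) :
    Tendsto (fun s : ℝ => mellin
      (fun t : ℝ => z * (Real.exp (-t) : ℝ) / (1 - z * (Real.exp (-t) : ℝ))) s)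
      (𝓝[>] 1) (𝓝 (-Complex.log (1 - z))) := by
  rw [← integral_mul_exp_div hz hz1]
  have hinteg : IntegrableOn (fun t : ℝ => 2 / ‖1 - z‖ * (Real.exp (-t) +
      Real.exp (-t) * t ^ ((2 : ℝ) - 1))) (Set.Ioi 0) :=
    ((integrableOn_exp_neg_Ioi 0).add (Real.GammaIntegral_convergent (by norm_num))).const_mul _
  refine tendsto_integral_filter_of_dominated_convergence _
    (Eventually.of_forall fun s => ?_) ?_ hinteg ?_
  · refine ContinuousOn.aestronglyMeasurable ?_ measurableSet_Ioi
    refine ContinuousOn.smul (f := fun t : ℝ => (t : ℂ) ^ ((s : ℂ) - 1)) ?_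
      (continuousOn_mul_exp_div hz hz1)
    intro t ht
    exact (Complex.continuousAt_ofReal_cpow_const _ _ (Or.inr ht.ne')).continuousWithinAt
  · have : Set.Ioc (1 : ℝ) 2 ∈ 𝓝[>] (1 : ℝ) := Ioc_mem_nhdsGT (by norm_num)
    filter_upwards [this] with s hs
    filter_upwards [ae_restrict_mem measurableSet_Ioi] with t ht
    have ht0 : 0 < t := ht
    rw [norm_smul, Complex.norm_cpow_eq_rpow_re_of_pos ht0]
    have h1 := norm_mul_exp_div_le hz hz1 ht0.le
    have h2 : t ^ ((s : ℂ) - 1).re ≤ 1 + t ^ ((2 : ℝ) - 1) := by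
      have : ((s : ℂ) - 1).re = s - 1 := by simp
      rw [this]
      rcases le_total t 1 with h | h
      · have := Real.rpow_le_one ht0.le h (by linarith [hs.1] : 0 ≤ s - 1)
        have : 0 ≤ t ^ ((2 : ℝ) - 1) := by positivity
        linarith
      · have := Real.rpow_le_rpow_of_exponent_le h (by linarith [hs.2] : s - 1 ≤ 2 - 1)
        linarith
    calc _ ≤ (1 + t ^ ((2 : ℝ) - 1)) * (2 / ‖1 - z‖ * Real.exp (-t)) := by gcongr
      _ = _ := by ring
  · filter_upwards [ae_restrict_mem measurableSet_Ioi] with t ht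
    have ht0 : 0 < t := ht
    have h1 : ContinuousAt (fun s : ℝ => (t : ℂ) ^ ((s : ℂ) - 1)) 1 := by
      refine ContinuousAt.const_cpow (by fun_prop) (Or.inl ?_)
      exact_mod_cast ht0.ne'
    have h2 := h1.tendsto.mono_left (nhdsWithin_le_nhds (s := Set.Ioi 1))
    simpa using h2.smul_const (z * (Real.exp (-t) : ℝ) / (1 - z * (Real.exp (-t) : ℝ)))

/-- Abel's theorem at the edge of convergence for the polylogarithm of order one. -/
theorem tendsto_polylog_one {z : ℂ} (hz : ‖z‖ = 1) (hz1 : z ≠ 1) :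
    Tendsto (fun s : ℝ => ∑' n : ℕ, z ^ n * (((n : ℝ) ^ (-s) : ℝ) : ℂ)) (𝓝[>] 1)
      (𝓝 (-Complex.log (1 - z))) := by
  have hG : Tendsto (fun s : ℝ => Complex.Gamma s) (𝓝[>] 1) (𝓝 1) := by
    have h1 : ContinuousAt Complex.Gamma ((1 : ℝ) : ℂ) :=
      (Complex.differentiableAt_Gamma_one).continuousAt
    have h2 : ContinuousAt (fun s : ℝ => Complex.Gamma s) 1 :=
      ContinuousAt.comp h1 Complex.continuous_ofReal.continuousAt
    have := h2.tendsto.mono_left (nhdsWithin_le_nhds (s := Set.Ioi 1))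
    simpa using this
  have h := (tendsto_mellin_mul_exp_div hz hz1).div hG one_ne_zero
  rw [div_one] at h
  refine h.congr' ?_
  filter_upwards [self_mem_nhdsWithin] with s hs
  have hs1 : 1 < s := hs
  have hs0 : 0 < (s : ℂ).re := by simp; linarith
  have hm := hasSum_mellin (a := fun n : ℕ => z ^ (n + 1)) (p := fun n : ℕ => (n : ℝ) + 1)
    (F := fun t : ℝ => z * (Real.exp (-t) : ℝ) / (1 - z * (Real.exp (-t) : ℝ))) (s := s)
    (fun n => Or.inr (by positivity)) hs0 (fun t ht => ?_) ?_
  · have hΓ : Complex.Gamma s ≠ 0 := Complex.Gamma_ne_zero_of_re_pos hs0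
    have hs' : (-s) ≠ 0 := by linarith
    simp only [Pi.div_apply]
    rw [← (hm.tsum_eq), ← tsum_div_const]
    have key : ∀ n : ℕ, Complex.Gamma s * z ^ (n + 1) / ((n : ℝ) + 1 : ℝ) ^ (s : ℂ) /
        Complex.Gamma s = z ^ (n + 1) * ((((n + 1 : ℕ) : ℝ) ^ (-s) : ℝ) : ℂ) := by
      intro n
      rw [Complex.ofReal_cpow (by positivity), Complex.ofReal_neg, Complex.cpow_neg]
      push_cast
      field_simp
    simp only [key]
    have hinj : Function.Injective (fun n : ℕ => n + 1) := fun a b h => by simpa using h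
    refine hinj.tsum_eq (f := fun n : ℕ => z ^ n * (((n : ℝ) ^ (-s) : ℝ) : ℂ)) fun n hn => ?_
    rcases n with _ | n
    · simp [Real.zero_rpow hs'] at hn
    · exact ⟨n, rfl⟩
  · have ht0 : 0 < t := ht
    have hn : ‖z * (Real.exp (-t) : ℝ)‖ < 1 := by
      rw [norm_mul, hz, one_mul, Complex.norm_of_nonneg (Real.exp_pos _).le]
      exact (Real.exp_lt_one_iff).2 (by linarith)
    have := (hasSum_geometric_of_norm_lt_one hn).mul_left (z * (Real.exp (-t) : ℝ))
    rw [← div_eq_mul_inv] at this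
    refine this.congr_fun fun n => ?_
    have hexp : Real.exp (-((n : ℝ) + 1) * t) = Real.exp (-t) * Real.exp (-t) ^ n := by
      rw [← Real.exp_nat_mul, ← Real.exp_add]
      ring_nf
    rw [hexp]
    push_cast
    ring
  · simp only [norm_pow, hz, one_pow, Complex.ofReal_re]
    have := (summable_nat_add_iff 1).2 (Real.summable_one_div_nat_rpow.2 hs1)
    simpa using this


theorem summable_mul_rpow_neg {f : ℕ → ℝ} (hf : ∀ n, |f n| ≤ 1) {s : ℝ} (hs : 1 < s) :
    Summable fun n : ℕ => f n * (n : ℝ) ^ (-s) := by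
  refine Summable.of_norm_bounded (Real.summable_nat_rpow.2 (by linarith : -s < -1)) fun n => ?_
  rw [norm_mul, Real.norm_eq_abs, Real.norm_of_nonneg (by positivity)]
  exact mul_le_of_le_one_left (by positivity) (hf n)

theorem exp_mul_I_pow_re_im (θ : ℝ) (n : ℕ) (x : ℝ) :
    Complex.exp (θ * Complex.I) ^ n * (x : ℂ) =
      ((Real.cos (n * θ) * x : ℝ) : ℂ) + ((Real.sin (n * θ) * x : ℝ) : ℂ) * Complex.I := by
  rw [← Complex.exp_nat_mul, ← mul_assoc,
    show (n : ℂ) * θ = ((n * θ : ℝ) : ℂ) by push_cast; ring, Complex.exp_mul_I,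
    ← Complex.ofReal_cos, ← Complex.ofReal_sin]
  push_cast
  ring

theorem tsum_exp_mul_I_pow (θ : ℝ) {s : ℝ} (hs : 1 < s) :
    ∑' n : ℕ, Complex.exp (θ * Complex.I) ^ n * (((n : ℝ) ^ (-s) : ℝ) : ℂ) =
      ((∑' n : ℕ, Real.cos (n * θ) * (n : ℝ) ^ (-s) : ℝ) : ℂ) +
      ((∑' n : ℕ, Real.sin (n * θ) * (n : ℝ) ^ (-s) : ℝ) : ℂ) * Complex.I := by
  have h1 := summable_mul_rpow_neg (f := fun n : ℕ => Real.cos (n * θ))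
    (fun n => Real.abs_cos_le_one _) hs
  have h2 := summable_mul_rpow_neg (f := fun n : ℕ => Real.sin (n * θ))
    (fun n => Real.abs_sin_le_one _) hs
  simp only [exp_mul_I_pow_re_im]
  exact ((Complex.hasSum_ofReal.2 h1.hasSum).add
    ((Complex.hasSum_ofReal.2 h2.hasSum).mul_right Complex.I)).tsum_eq

theorem exp_mul_I_ne_one {θ : ℝ} (hθ : Real.cos θ ≠ 1) : Complex.exp (θ * Complex.I) ≠ 1 := by
  intro h
  have := congrArg Complex.re h
  rw [Complex.exp_ofReal_mul_I_re] at this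
  exact hθ (by simpa using this)

theorem tendsto_tsum_cos {θ : ℝ} (hθ : Real.cos θ ≠ 1) :
    Tendsto (fun s : ℝ => ∑' n : ℕ, Real.cos (n * θ) * (n : ℝ) ^ (-s)) (𝓝[>] 1)
      (𝓝 (-(Real.log (2 - 2 * Real.cos θ) / 2))) := by
  have h := (Complex.continuous_re.tendsto _).comp
    (tendsto_polylog_one (Complex.norm_exp_ofReal_mul_I θ) (exp_mul_I_ne_one hθ))
  have hn : (-Complex.log (1 - Complex.exp (θ * Complex.I))).re =
      -(Real.log (2 - 2 * Real.cos θ) / 2) := by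
    rw [Complex.neg_re, Complex.log_re]
    have : 2 - 2 * Real.cos θ = ‖1 - Complex.exp (θ * Complex.I)‖ ^ 2 := by
      rw [Complex.sq_norm, Complex.normSq_apply]
      simp only [Complex.sub_re, Complex.sub_im, Complex.exp_ofReal_mul_I_re,
        Complex.exp_ofReal_mul_I_im, Complex.one_re, Complex.one_im]
      linear_combination -Real.sin_sq_add_cos_sq θ
    rw [this, Real.log_pow]
    push_cast
    ring
  rw [hn] at h
  refine h.congr' ?_
  filter_upwards [self_mem_nhdsWithin] with s hs
  simp only [Function.comp_apply]
  rw [tsum_exp_mul_I_pow θ hs]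
  simp

theorem tendsto_tsum_sin {x : ℝ} (hx : Int.fract x ≠ 0) :
    Tendsto (fun s : ℝ => ∑' n : ℕ, Real.sin (2 * Real.pi * n * x) * (n : ℝ) ^ (-s)) (𝓝[>] 1)
      (𝓝 (Real.pi * (1 / 2 - Int.fract x))) := by
  set y := Int.fract x with hy
  have hy0 : 0 < y := lt_of_le_of_ne (Int.fract_nonneg x) (Ne.symm hx)
  have hy1 : y < 1 := Int.fract_lt_one x
  have hsin : ∀ n : ℕ, Real.sin (2 * Real.pi * n * x) = Real.sin (n * (2 * Real.pi * y)) := by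
    intro n
    have : 2 * Real.pi * n * x = n * (2 * Real.pi * y) + ((n * ⌊x⌋ : ℤ) : ℝ) * (2 * Real.pi) := by
      rw [hy, Int.fract]; push_cast; ring
    rw [this, Real.sin_add_int_mul_two_pi]
  simp only [hsin]
  have hpi := Real.pi_pos
  have hs0 : 0 < Real.sin (Real.pi * y) :=
    Real.sin_pos_of_pos_of_lt_pi (by positivity) (by nlinarith)
  have hcos : Real.cos (2 * Real.pi * y) ≠ 1 := by
    rw [mul_assoc, Real.cos_two_mul]
    have := Real.sin_sq_add_cos_sq (Real.pi * y)
    nlinarith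
  have h := (Complex.continuous_im.tendsto _).comp
    (tendsto_polylog_one (Complex.norm_exp_ofReal_mul_I _) (exp_mul_I_ne_one hcos))
  have hn : (-Complex.log (1 - Complex.exp ((2 * Real.pi * y : ℝ) * Complex.I))).im =
      Real.pi * (1 / 2 - y) := by
    have h1 : 1 - Complex.exp ((2 * Real.pi * y : ℝ) * Complex.I) =
        ((2 * Real.sin (Real.pi * y) : ℝ) : ℂ) *
          (Complex.cos ((Real.pi * y - Real.pi / 2 : ℝ) : ℂ) +
          Complex.sin ((Real.pi * y - Real.pi / 2 : ℝ) : ℂ) * Complex.I) := by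
      rw [← Complex.ofReal_cos, ← Complex.ofReal_sin, Real.cos_sub_pi_div_two,
        Real.sin_sub_pi_div_two]
      apply Complex.ext
      · simp only [Complex.sub_re, Complex.exp_ofReal_mul_I_re, Complex.one_re, mul_assoc,
          Real.cos_two_mul, Complex.add_re,
          Complex.ofReal_re, Complex.mul_re, Complex.ofReal_im, Complex.I_re]
        linear_combination -2 * Real.sin_sq_add_cos_sq (Real.pi * y)
      · simp only [Complex.sub_im, Complex.exp_ofReal_mul_I_im, Complex.one_im, mul_assoc,
          Real.sin_two_mul, Complex.add_im, Complex.mul_im,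
          Complex.ofReal_re, Complex.ofReal_im, Complex.I_re, Complex.I_im]
        ring
    rw [h1, Complex.neg_im, Complex.log_im,
      Complex.arg_mul_cos_add_sin_mul_I (by positivity) ⟨by nlinarith, by nlinarith⟩]
    ring
  rw [hn] at h
  refine h.congr' ?_
  filter_upwards [self_mem_nhdsWithin] with s hs
  simp only [Function.comp_apply]
  rw [tsum_exp_mul_I_pow _ hs]
  simp

end

/-- The quadratic form `x ^ 2 + x * y + c * y ^ 2`. -/
def formValue (c x y : ℤ) : ℤ := x ^ 2 + x * y + c * y ^ 2

theorem two_mul_formValue_ge {c : ℤ} (hc : 1 ≤ c) (x y : ℤ) :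
    x ^ 2 + y ^ 2 ≤ 2 * formValue c x y := by
  rw [formValue]
  nlinarith [sq_nonneg (x + y), sq_nonneg y]

theorem formValue_nonneg {c : ℤ} (hc : 1 ≤ c) (x y : ℤ) : 0 ≤ formValue c x y := by
  have := two_mul_formValue_ge hc x y
  nlinarith [sq_nonneg x, sq_nonneg y]

theorem formValue_rpow_neg_le {c : ℤ} (hc : 1 ≤ c) {s : ℝ} (hs : 1 < s) (z : Fin 2 → ℤ) :
    (formValue c (z 0) (z 1) : ℝ) ^ (-s) ≤ 2 ^ s * ‖z‖ ^ (-(2 * s)) := by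
  rcases eq_or_ne z 0 with rfl | hz
  · have h1 : -s ≠ 0 := by linarith
    simp [formValue, Real.zero_rpow h1]
    positivity
  · have hz0 : 0 < ‖z‖ := norm_pos_iff.2 hz
    have h1 : ‖z‖ ^ 2 / 2 ≤ (formValue c (z 0) (z 1) : ℝ) := by
      have h2 : ((z 0 : ℝ) ^ 2 + (z 1 : ℝ) ^ 2) ≤ 2 * (formValue c (z 0) (z 1) : ℝ) := by
        exact_mod_cast two_mul_formValue_ge hc (z 0) (z 1)
      have h3 : ‖z‖ ^ 2 ≤ (z 0 : ℝ) ^ 2 + (z 1 : ℝ) ^ 2 := by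
        obtain ⟨i, hi⟩ : ∃ i, ‖z‖ = |(z i : ℝ)| := by
          rw [EisensteinSeries.norm_eq_max_natAbs]
          rcases max_choice (z 0).natAbs (z 1).natAbs with h | h
          · exact ⟨0, by rw [h, Nat.cast_natAbs, Int.cast_abs]⟩
          · exact ⟨1, by rw [h, Nat.cast_natAbs, Int.cast_abs]⟩
        rw [hi, sq_abs]
        fin_cases i
        · simpa using sq_nonneg (z 1 : ℝ)
        · simpa using sq_nonneg (z 0 : ℝ)
      linarith
    calc (formValue c (z 0) (z 1) : ℝ) ^ (-s) ≤ (‖z‖ ^ 2 / 2) ^ (-s) :=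
          Real.rpow_le_rpow_of_nonpos (by positivity) h1 (by linarith)
      _ = 2 ^ s * ‖z‖ ^ (-(2 * s)) := by
          rw [Real.div_rpow (by positivity) (by norm_num),
            Real.rpow_neg (by norm_num : (0 : ℝ) ≤ 2),
            div_inv_eq_mul, mul_comm, ← Real.rpow_natCast, ← Real.rpow_mul hz0.le]
          congr 2
          push_cast
          ring

theorem summable_form {c : ℤ} (hc : 1 ≤ c) {χ : ℤ → ℝ} (hχ : ∀ n, |χ n| ≤ 1) {s : ℝ} (hs : 1 < s) :
    Summable fun z : ℤ × ℤ => χ (formValue c z.1 z.2) * (formValue c z.1 z.2 : ℝ) ^ (-s) := by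
  rw [← (finTwoArrowEquiv ℤ).summable_iff]
  have h1 :=
    (EisensteinSeries.summable_one_div_norm_rpow (k := 2 * s) (by linarith)).mul_left (2 ^ s)
  refine Summable.of_norm_bounded h1 fun z => ?_
  have h2 := formValue_rpow_neg_le hc hs z
  have h3 : (0 : ℝ) ≤ (formValue c (z 0) (z 1) : ℝ) := by exact_mod_cast formValue_nonneg hc _ _
  change ‖χ (formValue c (z 0) (z 1)) * (formValue c (z 0) (z 1) : ℝ) ^ (-s)‖ ≤ _
  rw [norm_mul, Real.norm_eq_abs, Real.norm_eq_abs, abs_of_nonneg (Real.rpow_nonneg h3 _)]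
  calc _ ≤ 1 * (formValue c (z 0) (z 1) : ℝ) ^ (-s) :=
        mul_le_mul_of_nonneg_right (hχ _) (Real.rpow_nonneg h3 _)
    _ ≤ _ := by rw [one_mul]; exact h2

theorem hasSum_form_eq {c : ℤ} (hc : 1 ≤ c) {χ : ℤ → ℝ} {s S : ℝ}
    (h : HasSum (fun z : ℤ × ℤ => χ (formValue c z.1 z.2) * (formValue c z.1 z.2 : ℝ) ^ (-s)) S) :
    HasSum (fun n : ℕ => (Set.ncard {z : QuadraticAlgebra ℤ (-c) 1 |
      QuadraticAlgebra.norm z = (n : ℤ)} : ℝ) * (χ n * (n : ℝ) ^ (-s))) S := by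
  have h1 := h.tsum_fiberwise fun z : ℤ × ℤ => (formValue c z.1 z.2).toNat
  refine (congrArg (fun f : ℕ → ℝ => HasSum f S) (funext fun n => ?_)).mp h1
  have h2 : ∀ b : (fun z : ℤ × ℤ => (formValue c z.1 z.2).toNat) ⁻¹' {n},
      formValue c b.1.1 b.1.2 = n := fun b => by
    have := b.2
    simp only [Set.mem_preimage, Set.mem_singleton_iff] at this
    have := formValue_nonneg hc b.1.1 b.1.2
    omega
  rw [tsum_congr (fun b => by rw [h2 b]), tsum_const, nsmul_eq_mul, Int.cast_natCast,
    Nat.card_coe_set_eq]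
  congr 2
  refine Set.ncard_congr (fun z _ => ⟨z.1, z.2⟩) (fun z hz => ?_) (fun z w _ _ h => ?_)
    (fun z hz => ⟨(z.re, z.im), ?_, rfl⟩)
  · rw [Set.mem_ofPred_eq, QuadraticAlgebra.norm_mk_one]
    exact h2 ⟨z, hz⟩
  · rw [QuadraticAlgebra.mk.injEq] at h
    exact Prod.ext h.1 h.2
  · rw [Set.mem_ofPred_eq, ← QuadraticAlgebra.mk_eta z, QuadraticAlgebra.norm_mk_one] at hz
    rw [Set.mem_preimage, Set.mem_singleton_iff, formValue]
    rw [hz, Int.toNat_natCast]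

theorem hasSum_divisors_eq {χ ψ : ℤ → ℝ} (hχ : ∀ m n, χ (m * n) = χ m * χ n) {s : ℝ} (hs : 1 < s)
    {S : ℝ} (h : HasSum (fun z : ℕ × ℕ => (χ z.1 * (z.1 : ℝ) ^ (-s)) *
      (χ z.2 * ψ z.2 * (z.2 : ℝ) ^ (-s))) S) :
    HasSum (fun n : ℕ => (∑ m ∈ n.divisors, ψ m) * (χ n * (n : ℝ) ^ (-s))) S := by
  have hs0 : -s ≠ 0 := by linarith
  have h1 := h.tsum_fiberwise fun z : ℕ × ℕ => z.1 * z.2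
  refine (congrArg (fun f : ℕ → ℝ => HasSum f S) (funext fun n => ?_)).mp h1
  rcases Nat.eq_zero_or_pos n with rfl | hn
  · have : ∀ b : (fun z : ℕ × ℕ => z.1 * z.2) ⁻¹' {0},
        (χ b.1.1 * (b.1.1 : ℝ) ^ (-s)) * (χ b.1.2 * ψ b.1.2 * (b.1.2 : ℝ) ^ (-s)) = 0 := by
      rintro ⟨⟨a, b⟩, hab⟩
      rcases Nat.mul_eq_zero.1 hab with h | h <;> simp only at h <;> simp [h, Real.zero_rpow hs0]
    rw [tsum_congr this]
    simp
  · have : (fun z : ℕ × ℕ => z.1 * z.2) ⁻¹' {n} = ↑n.divisorsAntidiagonal := by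
      ext z
      simp [hn.ne']
    rw [this, Finset.tsum_subtype' n.divisorsAntidiagonal fun z : ℕ × ℕ =>
      (χ z.1 * (z.1 : ℝ) ^ (-s)) * (χ z.2 * ψ z.2 * (z.2 : ℝ) ^ (-s)),
      ← Nat.sum_divisorsAntidiagonal' (f := fun a b => ψ b), Finset.sum_mul]
    refine Finset.sum_congr rfl fun z hz => ?_
    rw [← (Nat.mem_divisorsAntidiagonal.1 hz).1]
    push_cast
    rw [hχ, Real.mul_rpow (by positivity) (by positivity)]
    ring

theorem abs_legendreSym_le_one (p : ℕ) [Fact p.Prime] (n : ℤ) : |(legendreSym p n : ℝ)| ≤ 1 := by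
  by_cases h : (n : ZMod p) = 0
  · simp [(legendreSym.eq_zero_iff p n).2 h]
  · rcases legendreSym.eq_one_or_neg_one p h with h | h <;> simp [h]

theorem hasSum_prod_mul {f g : ℕ → ℝ} (hf : Summable f) (hg : Summable g) :
    HasSum (fun z : ℕ × ℕ => f z.1 * g z.2) ((∑' n, f n) * ∑' n, g n) :=
  hf.hasSum.mul hg.hasSum (summable_mul_of_summable_norm hf.norm hg.norm)

theorem tsum_form_eq {d : ℕ} [Fact d.Prime] (hd : d % 8 = 3) (hd3 : 3 < d) {c : ℤ}
    (hc : (d : ℤ) = 4 * c - 1) [IsPrincipalIdealRing (QuadraticAlgebra ℤ (-c) 1)] {χ : ℤ → ℝ}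
    (hχ : ∀ m n, χ (m * n) = χ m * χ n) (hχ1 : ∀ n, |χ n| ≤ 1) {s : ℝ} (hs : 1 < s) :
    ∑' z : ℤ × ℤ, χ (formValue c z.1 z.2) * (formValue c z.1 z.2 : ℝ) ^ (-s) =
      2 * ((∑' n : ℕ, χ n * (n : ℝ) ^ (-s)) *
        ∑' n : ℕ, χ n * (legendreSym d n : ℝ) * (n : ℝ) ^ (-s)) := by
  have hc1 : 1 ≤ c := by omega
  have h1 := hasSum_form_eq hc1 (summable_form hc1 hχ1 hs).hasSum
  have hs1 := summable_mul_rpow_neg (f := fun n => χ n) (fun n => hχ1 n) hs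
  have hs2 := summable_mul_rpow_neg (f := fun n => χ n * (legendreSym d n : ℝ)) (fun n => by
    rw [abs_mul]
    exact mul_le_one₀ (hχ1 n) (abs_nonneg _) (abs_legendreSym_le_one d n)) hs
  have h4 := hasSum_prod_mul hs1 hs2
  have h2 := (hasSum_divisors_eq (ψ := fun n => (legendreSym d n : ℝ)) hχ hs h4).mul_left 2
  refine h1.unique ?_
  have h3 : (fun n : ℕ => 2 * ((∑ m ∈ n.divisors, (legendreSym d m : ℝ)) *
      (χ n * (n : ℝ) ^ (-s)))) = fun n : ℕ => (Set.ncard {z : QuadraticAlgebra ℤ (-c) 1 |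
      QuadraticAlgebra.norm z = (n : ℤ)} : ℝ) * (χ n * (n : ℝ) ^ (-s)) := funext fun n => by
    rcases Nat.eq_zero_or_pos n with rfl | hn
    · simp [Real.zero_rpow (by linarith : -s ≠ 0)]
    · have := QuadraticAlgebra.ncard_norm_eq_two_mul_sum hd hd3 hc hn.ne'
      rw [← mul_assoc]
      congr 1
      exact_mod_cast this.symm
  rw [← h3]
  exact h2

section

open Filter Topology

theorem tsum_int_eq_two_mul_tsum_succ {f : ℤ → ℝ} (hf : ∀ n, f (-n) = f n) (h0 : f 0 = 0)
    (hs : Summable f) : ∑' n, f n = 2 * ∑' n : ℕ, f ((n + 1 : ℕ) : ℤ) := by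
  rw [tsum_int_eq_zero_add_two_mul_tsum_pnat hf hs, h0, zero_add, nsmul_eq_mul,
    tsum_pnat_eq_tsum_succ (f := fun n : ℕ => f n)]
  norm_num

theorem tsum_form_eq_add {c : ℤ} (hc : 1 ≤ c) {χ : ℤ → ℝ} (hχ : ∀ n, |χ n| ≤ 1) {s : ℝ}
    (hs : 1 < s) :
    ∑' z : ℤ × ℤ, χ (formValue c z.1 z.2) * (formValue c z.1 z.2 : ℝ) ^ (-s) =
      2 * (∑' n : ℕ, χ (((n + 1 : ℕ) : ℤ) ^ 2) * ((n + 1 : ℕ) : ℝ) ^ (-(2 * s)) +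
        ∑' n : ℕ, ∑' x : ℤ, χ (formValue c x (n + 1 : ℕ)) *
          (formValue c x (n + 1 : ℕ) : ℝ) ^ (-s)) := by
  set F : ℤ → ℤ → ℝ := fun y x => χ (formValue c x y) * (formValue c x y : ℝ) ^ (-s) with hF
  have h1 : Summable fun z : ℤ × ℤ => F z.1 z.2 :=
    ((Equiv.prodComm ℤ ℤ).summable_iff.2 (summable_form hc hχ hs))
  have h2 : ∑' z : ℤ × ℤ, χ (formValue c z.1 z.2) * (formValue c z.1 z.2 : ℝ) ^ (-s) =
      ∑' y, ∑' x, F y x := by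
    rw [← h1.tsum_prod]
    exact ((Equiv.prodComm ℤ ℤ).tsum_eq fun z : ℤ × ℤ =>
      χ (formValue c z.1 z.2) * (formValue c z.1 z.2 : ℝ) ^ (-s)).symm
  have hneg : ∀ x y, F (-y) (-x) = F y x := fun x y => by
    simp only [hF, formValue, neg_sq, neg_mul_neg]
  have h3 : ∀ y, ∑' x, F (-y) x = ∑' x, F y x := fun y => by
    rw [← (Equiv.neg ℤ).tsum_eq fun x => F (-y) x]
    exact tsum_congr fun x => hneg x y
  have h00 : F 0 0 = 0 := by
    simp [hF, formValue, Real.zero_rpow (by linarith : -s ≠ 0)]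
  rw [h2, tsum_int_eq_zero_add_two_mul_tsum_pnat (f := fun y => ∑' x, F y x) h3 h1.prod,
    tsum_pnat_eq_tsum_succ (f := fun n : ℕ => ∑' x, F n x),
    tsum_int_eq_two_mul_tsum_succ (fun x => by simpa using hneg x 0) h00 (h1.prod_factor 0),
    two_smul, mul_add, two_mul (∑' n : ℕ, ∑' x : ℤ, _)]
  congr 2
  refine tsum_congr fun n => ?_
  have h4 : formValue c (n + 1 : ℕ) 0 = ((n + 1 : ℕ) : ℤ) ^ 2 := by simp [formValue]
  simp only [hF, h4]
  rw [Int.cast_pow, ← Real.rpow_natCast, Int.cast_natCast, ← Real.rpow_mul (by positivity)]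
  congr 2
  push_cast
  ring

theorem tsum_form_row {c : ℤ} {χ : ℤ → ℝ} (hχ : ∀ n, |χ n| ≤ 1) (hc : 1 ≤ c) {k : ℕ} (hk : 0 < k)
    (hper : ∀ n j : ℤ, χ (n + k * j) = χ n) {β : ℝ} (hβ : 1 ≤ β)
    (hβc : 4 * (k : ℝ) ^ 2 * β ^ 2 = 4 * c - 1) {s : ℝ} (hs : 1 < s) (hs2 : s ≤ 2) {y : ℕ}
    (hy : 0 < y) :
    ∑' x : ℤ, χ (formValue c x y) * (formValue c x y : ℝ) ^ (-s) =
      (k : ℝ) ^ (-(2 * s)) * ∑ r ∈ Finset.range k, χ (formValue c r y) *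
        latticeSum s ((r + y / 2) / k) (β * y) := by
  have : NeZero k := ⟨hk.ne'⟩
  have hkR : (0 : ℝ) < k := by exact_mod_cast hk
  have hy1 : (1 : ℝ) ≤ y := by exact_mod_cast hy
  have hb : 1 ≤ β * y := by nlinarith
  have h1 : Summable fun x : ℤ => χ (formValue c x y) * (formValue c x y : ℝ) ^ (-s) :=
    ((Equiv.prodComm ℤ ℤ).summable_iff.2 (summable_form hc hχ hs)).prod_factor (y : ℤ)
  have h2 := (Int.divModEquiv k).symm.summable_iff.2 h1
  have h3 : ∀ (n : ℤ) (r : ℕ), χ (formValue c (n * k + r) y) *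
      (formValue c (n * k + r) y : ℝ) ^ (-s) = (k : ℝ) ^ (-(2 * s)) * χ (formValue c r y) *
        ((n + (r + y / 2) / k) ^ 2 + (β * y) ^ 2 : ℝ) ^ (-s) := fun n r => by
    have e1 : formValue c (n * k + r) y =
        formValue c r y + k * (n ^ 2 * k + 2 * n * r + n * y) := by
      rw [formValue, formValue]; ring
    have e2 : (formValue c (n * k + r) y : ℝ) =
        (k : ℝ) ^ 2 * ((n + (r + y / 2) / k) ^ 2 + (β * y) ^ 2) := by
      rw [formValue]
      push_cast
      field_simp
      linear_combination (-(y : ℝ) ^ 2) * hβc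
    rw [e2, Real.mul_rpow (by positivity) (by positivity), e1, hper, ← Real.rpow_natCast,
      ← Real.rpow_mul hkR.le]
    push_cast
    ring_nf
  rw [← (Int.divModEquiv k).symm.tsum_eq]
  refine (h2.tsum_prod).trans ?_
  simp only [Function.comp_apply, Int.divModEquiv_symm_apply, tsum_fintype]
  simp only [h3]
  rw [Summable.tsum_finsetSum fun r _ => (summable_lattice hs.le hs2 hb).mul_left _,
    Fin.sum_univ_eq_sum_range fun r => ∑' n : ℤ, (k : ℝ) ^ (-(2 * s)) * χ (formValue c r y) *
        ((n + (r + y / 2) / k) ^ 2 + (β * y) ^ 2 : ℝ) ^ (-s), Finset.mul_sum]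
  refine Finset.sum_congr rfl fun r _ => ?_
  rw [tsum_mul_left, latticeSum, mul_assoc]

end

section

open Filter Topology

/-- The sum of `χ (r ^ 2 + r * y + c * y ^ 2)` over the residues `r` modulo `k`. -/
def rowCoeff (χ : ℤ → ℝ) (c : ℤ) (k y : ℕ) : ℝ := ∑ r ∈ Finset.range k, χ (formValue c r y)

/-- The nome `exp (2 π i ((r + y / 2) / k + i β y))`. -/
noncomputable def rowNome (k : ℕ) (β : ℝ) (r y : ℕ) : ℂ :=
  Complex.exp (2 * Real.pi * Complex.I * (((r + y / 2) / k : ℝ) + (β * y : ℝ) * Complex.I))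

/-- The exponentially small part of the row `y` of the quadratic form. -/
noncomputable def rowTail (χ : ℤ → ℝ) (c : ℤ) (k : ℕ) (β : ℝ) (y : ℕ) : ℝ :=
  ∑ r ∈ Finset.range k, χ (formValue c r y) *
    (2 * (rowNome k β r y / (1 - rowNome k β r y)).re)

/-- The deviation of the row `y` of the quadratic form from the corresponding integral. -/
noncomputable def rowError (χ : ℤ → ℝ) (c : ℤ) (k : ℕ) (β s : ℝ) (y : ℕ) : ℝ :=
  ∑ r ∈ Finset.range k, χ (formValue c r y) *
    (latticeSum s ((r + y / 2) / k) (β * y) - (β * y) ^ (1 - 2 * s) * powIntegral s)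

theorem abs_rowCoeff_le {χ : ℤ → ℝ} (hχ : ∀ n, |χ n| ≤ 1) (c : ℤ) (k y : ℕ) :
    |rowCoeff χ c k y| ≤ k := by
  refine (Finset.abs_sum_le_sum_abs _ _).trans ?_
  refine (Finset.sum_le_card_nsmul _ _ 1 fun r _ => hχ _).trans ?_
  simp

theorem abs_rowError_le {χ : ℤ → ℝ} (hχ : ∀ n, |χ n| ≤ 1) (c : ℤ) (k : ℕ) {β : ℝ} (hβ : 1 ≤ β)
    {s : ℝ} (hs : 1 < s) (hs2 : s ≤ 2) (n : ℕ) :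
    |rowError χ c k β s (n + 1)| ≤ k * (8 * Real.pi) * ((n + 1 : ℕ) : ℝ) ^ (-2 : ℝ) := by
  have hy1 : (1 : ℝ) ≤ (n + 1 : ℕ) := by push_cast; linarith [Nat.cast_nonneg (α := ℝ) n]
  have hb : 1 ≤ β * (n + 1 : ℕ) := by nlinarith
  refine (Finset.abs_sum_le_sum_abs _ _).trans ?_
  refine (Finset.sum_le_card_nsmul _ _ (8 * Real.pi * ((n + 1 : ℕ) : ℝ) ^ (-2 : ℝ))
    fun r _ => ?_).trans ?_
  · rw [abs_mul]
    refine (mul_le_of_le_one_left (abs_nonneg _) (hχ _)).trans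
      ((latticeSum_sub_le hs.le hs2 hb).trans ?_)
    refine mul_le_mul_of_nonneg_left ?_ (by positivity)
    calc (β * (n + 1 : ℕ)) ^ (-(2 * s)) ≤ (β * (n + 1 : ℕ)) ^ (-2 : ℝ) :=
          Real.rpow_le_rpow_of_exponent_le hb (by linarith)
      _ ≤ _ := Real.rpow_le_rpow_of_nonpos (by linarith) (by nlinarith) (by norm_num)
  · rw [Finset.card_range, nsmul_eq_mul, ← mul_assoc]

theorem summable_succ_rpow_neg {s : ℝ} (hs : 1 < s) :
    Summable fun n : ℕ => ((n + 1 : ℕ) : ℝ) ^ (-s) :=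
  (summable_nat_add_iff 1).2 (Real.summable_nat_rpow.2 (by linarith : -s < -1))

theorem tendsto_rowError {χ : ℤ → ℝ} (c : ℤ) (k : ℕ) {β : ℝ} (hβ : 1 ≤ β) {y : ℕ} (hy : 0 < y) :
    Tendsto (fun s => rowError χ c k β s y) (𝓝[>] 1)
      (𝓝 (Real.pi / (β * y) * rowTail χ c k β y)) := by
  have hy1 : (1 : ℝ) ≤ y := by exact_mod_cast hy
  have hb : 1 ≤ β * y := by nlinarith
  have hb0 : 0 < β * y := by linarith
  rw [rowTail, Finset.mul_sum]
  refine tendsto_finsetSum _ fun r _ => ?_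
  have h1 : Tendsto (fun s : ℝ => (β * y) ^ (1 - 2 * s)) (𝓝[>] 1) (𝓝 ((β * y) ^ (1 - 2 * 1 : ℝ))) :=
    ((Real.continuousAt_const_rpow hb0.ne').tendsto.comp
      (Continuous.tendsto (by fun_prop : Continuous fun s : ℝ => 1 - 2 * s) 1)).mono_left
        nhdsWithin_le_nhds
  have h2 := ((tendsto_latticeSum (a := (r + y / 2) / k) hb).sub
    (h1.mul tendsto_powIntegral)).const_mul (χ (formValue c r y))
  rw [latticeSum_one_eq hb (q := rowNome k β r y) rfl] at h2
  convert h2 using 2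
  rw [show (1 - 2 * 1 : ℝ) = -1 by norm_num, Real.rpow_neg_one]
  ring

theorem tendsto_tsum_form {c : ℤ} {χ : ℤ → ℝ} (hχ : ∀ n, |χ n| ≤ 1) (hc : 1 ≤ c) {k : ℕ}
    (hk : 0 < k) (hper : ∀ n j : ℤ, χ (n + k * j) = χ n) {β : ℝ} (hβ : 1 ≤ β)
    (hβc : 4 * (k : ℝ) ^ 2 * β ^ 2 = 4 * c - 1) :
    Tendsto (fun s : ℝ => (∑' n : ℕ, ∑' x : ℤ, χ (formValue c x (n + 1 : ℕ)) *
        (formValue c x (n + 1 : ℕ) : ℝ) ^ (-s)) - (k : ℝ) ^ (-(2 * s)) * (β ^ (1 - 2 * s) *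
          powIntegral s * ∑' n : ℕ, rowCoeff χ c k (n + 1) * ((n + 1 : ℕ) : ℝ) ^ (-(2 * s - 1))))
      (𝓝[>] 1) (𝓝 (Real.pi / (k ^ 2 * β) *
        ∑' n : ℕ, rowTail χ c k β (n + 1) / ((n + 1 : ℕ) : ℝ))) := by
  have hkR : (0 : ℝ) < k := by exact_mod_cast hk
  have hβ0 : 0 < β := by linarith
  have hev : ∀ᶠ s : ℝ in 𝓝[>] 1, 1 < s ∧ s ≤ 2 := by
    filter_upwards [Ioc_mem_nhdsGT (one_lt_two : (1 : ℝ) < 2)] with s hs using hs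
  have hsum : Summable fun n : ℕ => (k : ℝ) * (8 * Real.pi) * ((n + 1 : ℕ) : ℝ) ^ (-2 : ℝ) :=
    (summable_succ_rpow_neg one_lt_two).mul_left _
  have h1 : Tendsto (fun s => ∑' n : ℕ, rowError χ c k β s (n + 1)) (𝓝[>] 1)
      (𝓝 (∑' n : ℕ, Real.pi / (β * (n + 1 : ℕ)) * rowTail χ c k β (n + 1))) :=
    tendsto_tsum_of_dominated_convergence hsum
      (fun n => tendsto_rowError c k hβ (Nat.succ_pos n))
      (hev.mono fun s hs n => abs_rowError_le hχ c k hβ hs.1 hs.2 n)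
  have h2 : Tendsto (fun s : ℝ => (k : ℝ) ^ (-(2 * s))) (𝓝[>] 1) (𝓝 ((k : ℝ) ^ (-(2 * 1) : ℝ))) :=
    ((Real.continuousAt_const_rpow hkR.ne').tendsto.comp
      (Continuous.tendsto (by fun_prop : Continuous fun s : ℝ => -(2 * s)) 1)).mono_left
        nhdsWithin_le_nhds
  have h3 := h2.mul h1
  have h4 : (k : ℝ) ^ (-(2 * 1) : ℝ) *
      (∑' n : ℕ, Real.pi / (β * (n + 1 : ℕ)) * rowTail χ c k β (n + 1)) =
      Real.pi / (k ^ 2 * β) * ∑' n : ℕ, rowTail χ c k β (n + 1) / ((n + 1 : ℕ) : ℝ) := by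
    rw [← tsum_mul_left, ← tsum_mul_left]
    refine tsum_congr fun n => ?_
    rw [Real.rpow_neg hkR.le, mul_one, Real.rpow_two]
    field_simp
  rw [h4] at h3
  refine h3.congr' (hev.mono fun s hs => ?_)
  have hE : Summable fun n : ℕ => rowError χ c k β s (n + 1) :=
    Summable.of_norm_bounded hsum fun n => abs_rowError_le hχ c k hβ hs.1 hs.2 n
  have hC : Summable fun n : ℕ => rowCoeff χ c k (n + 1) * ((n + 1 : ℕ) : ℝ) ^ (-(2 * s - 1)) := by
    refine Summable.of_norm_bounded
      ((summable_succ_rpow_neg (by linarith [hs.1] : 1 < 2 * s - 1)).mul_left (k : ℝ)) fun n => ?_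
    rw [norm_mul, Real.norm_of_nonneg (Real.rpow_nonneg (Nat.cast_nonneg _) _)]
    exact mul_le_mul_of_nonneg_right (abs_rowCoeff_le hχ c k _)
      (Real.rpow_nonneg (Nat.cast_nonneg _) _)
  have h5 : ∀ n : ℕ, ∑' x : ℤ, χ (formValue c x (n + 1 : ℕ)) *
      (formValue c x (n + 1 : ℕ) : ℝ) ^ (-s) = (k : ℝ) ^ (-(2 * s)) *
        (rowError χ c k β s (n + 1) + β ^ (1 - 2 * s) * powIntegral s *
          (rowCoeff χ c k (n + 1) * ((n + 1 : ℕ) : ℝ) ^ (-(2 * s - 1)))) := fun n => by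
    rw [tsum_form_row hχ hc hk hper hβ hβc hs.1 hs.2 (Nat.succ_pos n)]
    congr 1
    rw [rowError, rowCoeff, Finset.sum_mul, Finset.mul_sum, ← Finset.sum_add_distrib]
    refine Finset.sum_congr rfl fun r _ => ?_
    rw [Real.mul_rpow hβ0.le (Nat.cast_nonneg _), neg_sub]
    ring
  beta_reduce
  rw [tsum_congr h5, tsum_mul_left, hE.tsum_add (hC.mul_left _), tsum_mul_left]
  ring

end

section

open Filter Topology

theorem ZMod.sum_univ_eq_sum_range {d : ℕ} [NeZero d] {M : Type*} [AddCommMonoid M]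
    (f : ZMod d → M) : ∑ a, f a = ∑ a ∈ Finset.range d, f (a : ZMod d) :=
  Finset.sum_bij' (fun a _ => a.val) (fun a _ => (a : ZMod d))
    (fun a _ => Finset.mem_range.2 a.val_lt) (fun a _ => Finset.mem_univ _)
    (fun a _ => ZMod.natCast_zmod_val a)
    (fun a ha => ZMod.val_cast_of_lt (Finset.mem_range.1 ha))
    (fun a _ => by rw [ZMod.natCast_zmod_val])

theorem exists_eq_mul_sqrt_of_sq_eq_neg {g : ℂ} {x : ℝ} (hx : 0 < x) (hg : g ^ 2 = -(x : ℂ)) :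
    ∃ σ : ℤ, (σ = 1 ∨ σ = -1) ∧ g.im = σ * √x ∧ g.re = 0 := by
  have h1 := congrArg Complex.re hg
  have h2 := congrArg Complex.im hg
  simp [sq] at h1 h2
  have hre : g.re = 0 := by
    by_contra hne
    have him : g.im = 0 := by
      have : g.re * g.im = 0 := by linarith
      exact (mul_eq_zero.1 this).resolve_left hne
    rw [him] at h1
    nlinarith [mul_self_nonneg g.re]
  have him : g.im ^ 2 = x := by rw [hre] at h1; linarith
  rcases le_total 0 g.im with h | h
  · exact ⟨1, Or.inl rfl, by rw [← him, Real.sqrt_sq h]; simp, hre⟩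
  · exact ⟨-1, Or.inr rfl, by rw [← him, Real.sqrt_sq_eq_abs, abs_of_nonpos h]; simp, hre⟩

theorem exists_sum_legendreSym_mul_sin {d : ℕ} [Fact d.Prime] (hd : d % 4 = 3) :
    ∃ σ : ℤ, (σ = 1 ∨ σ = -1) ∧ ∀ n : ℤ,
      ∑ a ∈ Finset.range d, (legendreSym d a : ℝ) * Real.sin (2 * Real.pi * (n * (a / d))) =
        legendreSym d n * (σ * √d) := by
  have hdp : d.Prime := Fact.out
  have hd2 : ringChar (ZMod d) ≠ 2 := by
    rw [ZMod.ringChar_zmod_n]; omega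
  set χ : MulChar (ZMod d) ℂ := (quadraticChar (ZMod d)).ringHomComp (Int.castRingHom ℂ) with hχ
  have hχa : ∀ n : ℤ, χ n = (legendreSym d n : ℂ) := fun n => rfl
  have hquad : χ.IsQuadratic := (quadraticChar_isQuadratic (ZMod d)).comp _
  have hne : χ ≠ 1 := (MulChar.ringHomComp_ne_one_iff (Int.cast_injective)).2
    (quadraticChar_ne_one hd2)
  have hd0 : (d : ℝ) ≠ 0 := by exact_mod_cast hdp.ne_zero
  have hg2 : gaussSum χ ZMod.stdAddChar ^ 2 = -((d : ℝ) : ℂ) := by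
    rw [gaussSum_sq hne hquad (ZMod.isPrimitive_stdAddChar d), ZMod.card]
    have : χ (-1) = -1 := by
      have h := hχa (-1)
      rw [legendreSym.at_neg_one (by omega), ZMod.χ₄_nat_three_mod_four hd] at h
      simpa using h
    rw [this]
    push_cast
    ring
  obtain ⟨σ, hσ, him, hre⟩ := exists_eq_mul_sqrt_of_sq_eq_neg
    (by exact_mod_cast hdp.pos) hg2
  refine ⟨σ, hσ, fun n => ?_⟩
  have key : gaussSum χ (ZMod.stdAddChar.mulShift (n : ZMod d)) =
      legendreSym d n * gaussSum χ ZMod.stdAddChar := by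
    by_cases hn : (n : ZMod d) = 0
    · rw [(legendreSym.eq_zero_iff d n).2 hn, hn, AddChar.mulShift_zero, gaussSum_one_right hne]
      simp
    · have h1 := gaussSum_mulShift χ ZMod.stdAddChar (Units.mk0 _ hn)
      rw [Units.val_mk0, hχa] at h1
      have h2 : (legendreSym d n : ℂ) * legendreSym d n = 1 := by
        rw [← sq]
        exact_mod_cast legendreSym.sq_one d hn
      rw [← h1, ← mul_assoc, h2, one_mul]
  have h3 := congrArg Complex.im key
  rw [gaussSum, ZMod.sum_univ_eq_sum_range, Complex.im_sum] at h3
  rw [show ((legendreSym d n : ℂ) * gaussSum χ ZMod.stdAddChar).im =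
    legendreSym d n * (gaussSum χ ZMod.stdAddChar).im by
      rw [← Complex.ofReal_intCast, Complex.im_ofReal_mul], him] at h3
  rw [← h3]
  refine Finset.sum_congr rfl fun a _ => ?_
  have h4 : (n : ZMod d) * (a : ZMod d) = ((n * a : ℤ) : ZMod d) := by push_cast; rfl
  rw [AddChar.mulShift_apply, h4, ZMod.stdAddChar_coe,
    show ((a : ℕ) : ZMod d) = ((a : ℤ) : ZMod d) by
    simp, hχa, ← Complex.ofReal_intCast (legendreSym d a), Complex.im_ofReal_mul]
  congr 1
  rw [show 2 * Real.pi * Complex.I * ((n * a : ℤ) : ℂ) / d =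
    ((2 * Real.pi * (n * (a / d)) : ℝ) : ℂ) * Complex.I by push_cast; ring,
    Complex.exp_ofReal_mul_I_im]

end

/-- The sum of `legendreSym d a * φ a` over the residues `a` modulo `d`. -/
def weightedSum (d : ℕ) [Fact d.Prime] (φ : ℕ → ℤ) : ℤ :=
  ∑ a ∈ Finset.range d, legendreSym d a * φ a

namespace weightedSum

theorem two_mul_mod {d a : ℕ} (h : a < d) :
    2 * a % d = if 2 * a < d then 2 * a else 2 * a - d := by
  split_ifs with h2
  · exact Nat.mod_eq_of_lt h2
  · rw [Nat.mod_eq_sub_mod (by omega), Nat.mod_eq_of_lt (by omega)]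

theorem three_mul_mod {d a : ℕ} (h : a < d) :
    3 * a % d =
      if 3 * a < d then 3 * a else if 3 * a < 2 * d then 3 * a - d else 3 * a - 2 * d := by
  split_ifs with h2 h3
  · exact Nat.mod_eq_of_lt h2
  · rw [Nat.mod_eq_sub_mod (by omega), Nat.mod_eq_of_lt (by omega)]
  · rw [Nat.mod_eq_sub_mod (by omega), Nat.mod_eq_sub_mod (by omega), Nat.mod_eq_of_lt (by omega)]
    omega

variable {d : ℕ} [Fact d.Prime]

theorem congr {φ η : ℕ → ℤ} (h : ∀ a, 0 < a → a < d → φ a = η a) :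
    weightedSum d φ = weightedSum d η := by
  refine Finset.sum_congr rfl fun a ha => ?_
  rcases Nat.eq_zero_or_pos a with rfl | h0
  · simp
  · rw [h a h0 (Finset.mem_range.1 ha)]

theorem add (φ η : ℕ → ℤ) :
    weightedSum d (fun a => φ a + η a) = weightedSum d φ + weightedSum d η := by
  rw [weightedSum, weightedSum, weightedSum, ← Finset.sum_add_distrib]
  exact Finset.sum_congr rfl fun a _ => mul_add _ _ _

theorem mul_left (c : ℤ) (φ : ℕ → ℤ) :
    weightedSum d (fun a => c * φ a) = c * weightedSum d φ := by
  rw [weightedSum, weightedSum, Finset.mul_sum]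
  exact Finset.sum_congr rfl fun a _ => by ring

theorem comp_sub (hd : d % 4 = 3) (φ : ℕ → ℤ) :
    weightedSum d (fun a => φ (d - a)) = -weightedSum d φ := by
  have h : ∀ φ : ℕ → ℤ, weightedSum d φ =
      ∑ a ∈ Finset.range (d - 1), legendreSym d (a + 1 : ℕ) * φ (a + 1) := fun φ => by
    have hd1 : d = d - 1 + 1 := by omega
    rw [weightedSum, congrArg Finset.range hd1, Finset.sum_range_succ']
    simp
  rw [h, h, ← Finset.sum_range_reflect, ← Finset.sum_neg_distrib]
  refine Finset.sum_congr rfl fun a ha => ?_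
  have ha' := Finset.mem_range.1 ha
  rw [show d - (d - 1 - 1 - a + 1) = a + 1 by omega,
    show ((d - 1 - 1 - a + 1 : ℕ) : ℤ) = d + (-1) * ((a + 1 : ℕ) : ℤ) by omega, legendreSym.mod]
  rw [show ((d : ℤ) + -1 * ((a + 1 : ℕ) : ℤ)) % d = (-1 * ((a + 1 : ℕ) : ℤ)) % d by simp,
    ← legendreSym.mod, legendreSym.mul, legendreSym.at_neg_one (by omega),
    ZMod.χ₄_nat_three_mod_four hd]
  ring

theorem comp_mul {p : ℕ} (hp : ¬ d ∣ p) (φ : ℕ → ℤ) :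
    weightedSum d φ = legendreSym d p * weightedSum d (fun a => φ (p * a % d)) := by
  have h : ∀ φ : ℕ → ℤ, weightedSum d φ = ∑ x : ZMod d, quadraticChar (ZMod d) x * φ x.val :=
    fun φ => by
      rw [ZMod.sum_univ_eq_sum_range]
      refine Finset.sum_congr rfl fun a ha => ?_
      rw [ZMod.val_cast_of_lt (Finset.mem_range.1 ha), legendreSym, Int.cast_natCast]
  have hp0 : (p : ZMod d) ≠ 0 := fun h => hp ((ZMod.natCast_eq_zero_iff p d).1 h)
  rw [h, h, Finset.mul_sum]
  refine (Fintype.sum_equiv (Equiv.mulLeft₀ (p : ZMod d) hp0) _ _ fun x => ?_).symm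
  rw [Equiv.mulLeft₀_apply, map_mul, ZMod.val_mul, ZMod.val_natCast, Nat.mod_mul_mod, legendreSym,
    Int.cast_natCast, mul_assoc]

theorem comp_two_mul (hd : d % 8 = 3) (φ : ℕ → ℤ) :
    weightedSum d (fun a => φ (2 * a % d)) = -weightedSum d φ := by
  rw [comp_mul (p := 2) (fun h => by have := Nat.le_of_dvd (by norm_num) h; omega) φ,
    Nat.cast_ofNat, legendreSym_two_eq_neg_one hd]
  ring

theorem comp_three_mul (hd : d % 12 = 7) (φ : ℕ → ℤ) :
    weightedSum d (fun a => φ (3 * a % d)) = -weightedSum d φ := by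
  have : Fact (Nat.Prime 3) := ⟨Nat.prime_three⟩
  rw [comp_mul (p := 3) (fun h => by have := Nat.le_of_dvd (by norm_num) h; omega) φ]
  have h3 : legendreSym d (3 : ℕ) = -1 := by
    rw [legendreSym_prime_eq_neg (by omega) (by norm_num), legendreSym.mod]
    rw [show (-(d : ℤ)) % (3 : ℕ) = 2 by omega]
    exact legendreSym_two_eq_neg_one (by norm_num)
  rw [h3]
  ring

theorem emod_two_eq {u v : ℕ} (huv : u ≤ v) (hv : v < d) :
    weightedSum d (fun a => if u < a ∧ a ≤ v then 1 else 0) % 2 = ((v : ℤ) - u) % 2 := by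
  have h1 : weightedSum d (fun a => if u < a ∧ a ≤ v then 1 else 0) =
      ∑ a ∈ Finset.Ioc u v, legendreSym d a := by
    rw [weightedSum]
    simp only [mul_ite, mul_one, mul_zero]
    rw [← Finset.sum_filter]
    refine Finset.sum_congr ?_ fun _ _ => rfl
    ext a
    simp only [Finset.mem_filter, Finset.mem_range, Finset.mem_Ioc]
    omega
  rw [h1]
  change Int.ModEq 2 _ _
  rw [← Nat.cast_two, ← ZMod.intCast_eq_intCast_iff, Int.cast_sum]
  have h2 : ∀ a ∈ Finset.Ioc u v, ((legendreSym d a : ℤ) : ZMod 2) = 1 := fun a ha => by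
    have ha' := Finset.mem_Ioc.1 ha
    have : ((a : ℤ) : ZMod d) ≠ 0 := fun h => by
      rw [Int.cast_natCast, ZMod.natCast_eq_zero_iff] at h
      have := Nat.le_of_dvd (by omega) h
      omega
    rcases legendreSym.eq_one_or_neg_one d this with h | h <;> rw [h] <;> decide
  rw [Finset.sum_congr rfl h2, Finset.sum_const, Nat.card_Ioc, nsmul_one, Nat.cast_sub huv]
  push_cast
  rfl

/-- The indicator of the fraction `(u * d / m, v * d / m)` of the interval `(0, d)`. -/
def step (d m u v : ℕ) (a : ℕ) : ℤ := if u * d < m * a ∧ m * a < v * d then 1 else 0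

theorem half_eq (hd : d % 8 = 3) {σ : ℤ} (hσ : weightedSum d (fun a => a) = -(d * σ)) :
    weightedSum d (step d 2 0 1) = 3 * σ := by
  have h : weightedSum d (fun a => ((2 * a % d : ℕ) : ℤ)) =
      weightedSum d (fun a => 2 * (a : ℤ) + -d * step d 2 0 1 (d - a)) :=
    congr fun a h0 h1 => by
      rw [two_mul_mod h1]
      simp only [step]
      split_ifs <;> omega
  rw [comp_two_mul hd (fun a => (a : ℤ)), add, mul_left, mul_left, comp_sub (by omega), hσ] at h
  have hd0 : (d : ℤ) ≠ 0 := by omega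
  refine mul_left_cancel₀ hd0 ?_
  linear_combination -h

theorem octant_low (hd : d % 8 = 3) : weightedSum d (step d 8 0 2) = 0 := by
  have h : weightedSum d (fun a => step d 2 0 1 a + step d 2 0 1 (2 * a % d)) =
      weightedSum d (fun a => 2 * step d 8 0 2 a + (step d 8 2 4 a + step d 8 2 4 (d - a))) :=
    congr fun a h0 h1 => by
      rw [two_mul_mod h1]
      simp only [step]
      split_ifs <;> omega
  rw [add, comp_two_mul hd, add, add, mul_left, comp_sub (by omega)] at h
  omega

theorem octant_alternate (hd : d % 8 = 3) :
    weightedSum d (step d 8 1 2) + weightedSum d (step d 8 3 4) = 0 := by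
  have h : weightedSum d (fun a => step d 8 2 4 a + step d 8 2 4 (2 * a % d)) =
      weightedSum d (fun a => (step d 8 1 2 a + step d 8 3 4 a) +
        (step d 8 2 3 a + step d 8 2 3 (d - a))) :=
    congr fun a h0 h1 => by
      rw [two_mul_mod h1]
      simp only [step]
      split_ifs <;> omega
  rw [add, comp_two_mul hd, add, add, add, comp_sub (by omega)] at h
  omega

theorem exists_octant_eq (hd : d % 8 = 3) {σ : ℤ}
    (hσ : weightedSum d (fun a => a) = -(d * σ)) :
    ∃ v : ℤ, weightedSum d (step d 8 1 3) = 3 * σ + 2 * v ∧ v % 2 = ((d / 8 : ℕ) : ℤ) % 2 := by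
  refine ⟨weightedSum d (step d 8 1 2), ?_, ?_⟩
  · have h1 : weightedSum d (step d 8 1 3) =
        weightedSum d (fun a => step d 8 1 2 a + step d 8 2 3 a) := congr fun a h0 h1 => by
      simp only [step]
      split_ifs <;> omega
    have h2 : weightedSum d (step d 2 0 1) =
        weightedSum d (fun a => step d 8 0 2 a + (step d 8 2 3 a + step d 8 3 4 a)) :=
      congr fun a h0 h1 => by
        simp only [step]
        split_ifs <;> omega
    rw [add] at h1
    rw [add, add, octant_low hd, half_eq hd hσ] at h2
    have h3 := octant_alternate hd
    omega
  · rw [show weightedSum d (step d 8 1 2) =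
      weightedSum d (fun a => if d / 8 < a ∧ a ≤ 2 * (d / 8) then 1 else 0) from
        congr fun a h0 h1 => by
          simp only [step]
          split_ifs <;> omega, emod_two_eq (by omega) (by omega)]
    push_cast
    omega

theorem twelfth_doubling_low (hd : d % 24 = 19) : 2 * weightedSum d (step d 12 0 1) +
    weightedSum d (step d 12 1 2) - weightedSum d (step d 12 5 6) = 0 := by
  have h : weightedSum d (fun a => step d 12 0 2 a + step d 12 0 2 (2 * a % d)) =
      weightedSum d (fun a => 2 * step d 12 0 1 a + step d 12 1 2 a + step d 12 5 6 (d - a)) :=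
    congr fun a h0 h1 => by
      rw [two_mul_mod h1]
      simp only [step]
      split_ifs <;> omega
  rw [add, comp_two_mul (by omega), add, add, mul_left, comp_sub (by omega)] at h
  omega

theorem twelfth_doubling_middle (hd : d % 24 = 19) : weightedSum d (step d 12 1 2) +
    weightedSum d (step d 12 2 3) + weightedSum d (step d 12 3 4) -
      weightedSum d (step d 12 4 5) = 0 := by
  have h : weightedSum d (fun a => step d 12 2 4 a + step d 12 2 4 (2 * a % d)) =
      weightedSum d (fun a => step d 12 1 2 a + step d 12 2 3 a + step d 12 3 4 a +
        step d 12 4 5 (d - a)) :=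
    congr fun a h0 h1 => by
      rw [two_mul_mod h1]
      simp only [step]
      split_ifs <;> omega
  rw [add, comp_two_mul (by omega), add, add, add, comp_sub (by omega)] at h
  omega

theorem twelfth_doubling_high (hd : d % 24 = 19) : weightedSum d (step d 12 2 3) -
    weightedSum d (step d 12 3 4) + weightedSum d (step d 12 4 5) +
      weightedSum d (step d 12 5 6) = 0 := by
  have h : weightedSum d (fun a => step d 12 4 6 a + step d 12 4 6 (2 * a % d)) =
      weightedSum d (fun a => step d 12 2 3 a + step d 12 4 5 a + step d 12 5 6 a +
        step d 12 3 4 (d - a)) :=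
    congr fun a h0 h1 => by
      rw [two_mul_mod h1]
      simp only [step]
      split_ifs <;> omega
  rw [add, comp_two_mul (by omega), add, add, add, comp_sub (by omega)] at h
  omega

theorem twelfth_tripling (hd : d % 24 = 19) : weightedSum d (step d 12 1 2) -
    weightedSum d (step d 12 2 3) + weightedSum d (step d 12 3 4) +
      weightedSum d (step d 12 4 5) + 2 * weightedSum d (step d 12 5 6) = 0 := by
  have h : weightedSum d (fun a => step d 12 3 6 a + step d 12 3 6 (3 * a % d)) =
      weightedSum d (fun a => step d 12 1 2 a + step d 12 3 4 a + step d 12 4 5 a +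
        2 * step d 12 5 6 a + step d 12 2 3 (d - a)) :=
    congr fun a h0 h1 => by
      rw [three_mul_mod h1]
      simp only [step]
      split_ifs <;> omega
  rw [add, comp_three_mul (by omega), add, add, add, add, mul_left, comp_sub (by omega)] at h
  omega

theorem exists_twelfth_eq (hd : d % 24 = 19) {σ : ℤ}
    (hσ : weightedSum d (fun a => a) = -(d * σ)) :
    ∃ v : ℤ, weightedSum d (step d 12 1 5) = 2 * (2 * σ - v) ∧ v % 2 = 1 := by
  refine ⟨weightedSum d (step d 12 0 1), ?_, ?_⟩
  · have h1 : weightedSum d (step d 12 1 5) = weightedSum d (fun a => step d 12 1 2 a +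
        step d 12 2 3 a + step d 12 3 4 a + step d 12 4 5 a) := congr fun a h0 h1 => by
      simp only [step]
      split_ifs <;> omega
    have h2 : weightedSum d (step d 2 0 1) = weightedSum d (fun a => step d 12 0 1 a +
        step d 12 1 5 a + step d 12 5 6 a) :=
      congr fun a h0 h1 => by
        simp only [step]
        split_ifs <;> omega
    rw [add, add, add] at h1
    rw [add, add, half_eq (by omega) hσ] at h2
    have h3 := twelfth_doubling_low hd
    have h4 := twelfth_doubling_middle hd
    have h5 := twelfth_doubling_high hd
    have h6 := twelfth_tripling hd
    omega
  · rw [show weightedSum d (step d 12 0 1) =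
      weightedSum d (fun a => if 0 < a ∧ a ≤ d / 12 then 1 else 0) from
        congr fun a h0 h1 => by
          simp only [step]
          split_ifs <;> omega, emod_two_eq (by omega) (by omega)]
    push_cast
    omega

end weightedSum

section

open Filter Topology

theorem legendreSym_mul_cos_eq {d : ℕ} [Fact d.Prime] {σ : ℤ} (hσ : σ = 1 ∨ σ = -1)
    (hsum : ∀ n : ℤ, ∑ a ∈ Finset.range d, (legendreSym d a : ℝ) *
      Real.sin (2 * Real.pi * (n * (a / d))) = legendreSym d n * (σ * √d)) (t : ℝ) (n : ℤ) :
    Real.cos (2 * Real.pi * (n * t)) * legendreSym d n = σ / (2 * √d) *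
      ∑ a ∈ Finset.range d, (legendreSym d a : ℝ) * (Real.sin (2 * Real.pi * n * (a / d + t)) +
        Real.sin (2 * Real.pi * n * (a / d - t))) := by
  have hd : (0 : ℝ) < √d := Real.sqrt_pos.2 (by exact_mod_cast (Fact.out : d.Prime).pos)
  have h1 : ∑ a ∈ Finset.range d, (legendreSym d a : ℝ) *
      (Real.sin (2 * Real.pi * n * (a / d + t)) + Real.sin (2 * Real.pi * n * (a / d - t))) =
      2 * Real.cos (2 * Real.pi * (n * t)) * (legendreSym d n * (σ * √d)) := by
    rw [← hsum, Finset.mul_sum]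
    refine Finset.sum_congr rfl fun a _ => ?_
    rw [show 2 * Real.pi * n * ((a : ℝ) / d + t) =
      2 * Real.pi * (n * (a / d)) + 2 * Real.pi * (n * t) by ring,
      show 2 * Real.pi * n * ((a : ℝ) / d - t) =
      2 * Real.pi * (n * (a / d)) - 2 * Real.pi * (n * t) by ring, Real.sin_add, Real.sin_sub]
    ring
  have h2 : (σ : ℝ) * σ = 1 := by rcases hσ with rfl | rfl <;> norm_num
  rw [h1]
  field_simp
  linear_combination (-(legendreSym d n : ℝ) * Real.cos (2 * Real.pi * n * t)) * h2

theorem tendsto_tsum_cos_mul_legendreSym {d : ℕ} [Fact d.Prime] {σ : ℤ} (hσ : σ = 1 ∨ σ = -1)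
    (hsum : ∀ n : ℤ, ∑ a ∈ Finset.range d, (legendreSym d a : ℝ) *
      Real.sin (2 * Real.pi * (n * (a / d))) = legendreSym d n * (σ * √d)) {t : ℝ}
    (ht : ∀ a : ℕ, 0 < a → a < d → Int.fract ((a : ℝ) / d + t) ≠ 0 ∧
      Int.fract ((a : ℝ) / d - t) ≠ 0) :
    Tendsto (fun s : ℝ => ∑' n : ℕ, Real.cos (2 * Real.pi * (n * t)) * legendreSym d n *
      (n : ℝ) ^ (-s)) (𝓝[>] 1) (𝓝 (σ * Real.pi / (2 * √d) * ∑ a ∈ Finset.range d,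
        (legendreSym d a : ℝ) * ((1 / 2 - Int.fract ((a : ℝ) / d + t)) +
          (1 / 2 - Int.fract ((a : ℝ) / d - t))))) := by
  have hsin : ∀ x : ℝ, ∀ s : ℝ, 1 < s →
      Summable fun n : ℕ => Real.sin (2 * Real.pi * n * x) * (n : ℝ) ^ (-s) := fun x s hs =>
    summable_mul_rpow_neg (fun n => Real.abs_sin_le_one _) hs
  have h1 : Tendsto (fun s : ℝ => σ / (2 * √d) * ∑ a ∈ Finset.range d, (legendreSym d a : ℝ) *
      ((∑' n : ℕ, Real.sin (2 * Real.pi * n * (a / d + t)) * (n : ℝ) ^ (-s)) +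
        ∑' n : ℕ, Real.sin (2 * Real.pi * n * (a / d - t)) * (n : ℝ) ^ (-s))) (𝓝[>] 1)
      (𝓝 (σ / (2 * √d) * ∑ a ∈ Finset.range d, (legendreSym d a : ℝ) *
        (Real.pi * (1 / 2 - Int.fract ((a : ℝ) / d + t)) +
          Real.pi * (1 / 2 - Int.fract ((a : ℝ) / d - t))))) := by
    refine Tendsto.const_mul _ (tendsto_finsetSum _ fun a ha => ?_)
    rcases Nat.eq_zero_or_pos a with rfl | h0
    · simp
    · obtain ⟨h2, h3⟩ := ht a h0 (Finset.mem_range.1 ha)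
      exact ((tendsto_tsum_sin h2).add (tendsto_tsum_sin h3)).const_mul _
  have h4 : σ * Real.pi / (2 * √d) * ∑ a ∈ Finset.range d,
        (legendreSym d a : ℝ) * ((1 / 2 - Int.fract ((a : ℝ) / d + t)) +
          (1 / 2 - Int.fract ((a : ℝ) / d - t))) =
      σ / (2 * √d) * ∑ a ∈ Finset.range d, (legendreSym d a : ℝ) *
        (Real.pi * (1 / 2 - Int.fract ((a : ℝ) / d + t)) +
          Real.pi * (1 / 2 - Int.fract ((a : ℝ) / d - t))) := by
    rw [Finset.mul_sum, Finset.mul_sum]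
    refine Finset.sum_congr rfl fun a _ => ?_
    ring
  rw [h4]
  refine h1.congr' ?_
  filter_upwards [self_mem_nhdsWithin] with s hs
  have hs : 1 < s := hs
  have h5 : ∀ n : ℕ, Real.cos (2 * Real.pi * (n * t)) * legendreSym d n * (n : ℝ) ^ (-s) =
      σ / (2 * √d) * ∑ a ∈ Finset.range d, (legendreSym d a : ℝ) *
        (Real.sin (2 * Real.pi * n * (a / d + t)) * (n : ℝ) ^ (-s) +
          Real.sin (2 * Real.pi * n * (a / d - t)) * (n : ℝ) ^ (-s)) := fun n => by
    have := legendreSym_mul_cos_eq hσ hsum t n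
    rw [Int.cast_natCast] at this
    rw [this, mul_assoc, Finset.sum_mul]
    congr 1
    refine Finset.sum_congr rfl fun a _ => ?_
    ring
  rw [tsum_congr h5, tsum_mul_left, Summable.tsum_finsetSum fun a _ =>
    ((hsin _ s hs).add (hsin _ s hs)).mul_left _]
  congr 1
  refine Finset.sum_congr rfl fun a _ => ?_
  rw [tsum_mul_left, (hsin _ s hs).tsum_add (hsin _ s hs)]

theorem fract_add_of_lt {x t : ℝ} (hx0 : 0 < x) (hx1 : x < 1) (ht0 : 0 < t) (ht1 : t < 1) :
    Int.fract (x + t) = if x < 1 - t then x + t else x + t - 1 := by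
  split_ifs with h
  · exact Int.fract_eq_self.2 ⟨by linarith, by linarith⟩
  · rw [← Int.fract_sub_one]
    exact Int.fract_eq_self.2 ⟨by linarith, by linarith⟩

theorem fract_sub_of_lt {x t : ℝ} (hx0 : 0 < x) (hx1 : x < 1) (ht0 : 0 < t) (ht1 : t < 1) :
    Int.fract (x - t) = if x < t then x - t + 1 else x - t := by
  split_ifs with h
  · rw [← Int.fract_add_one]
    exact Int.fract_eq_self.2 ⟨by linarith, by linarith⟩
  · exact Int.fract_eq_self.2 ⟨by linarith, by linarith⟩

theorem sum_sawtooth_eq {x t u : ℝ} (hx0 : 0 < x) (hx1 : x < 1) (ht : 0 < t) (htu : t < u)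
    (hu : u < 1 / 2) (h1 : x ≠ t) (h2 : x ≠ 1 - u) :
    ((1 / 2 - Int.fract (x + t)) + (1 / 2 - Int.fract (x - t))) -
      ((1 / 2 - Int.fract (x + u)) + (1 / 2 - Int.fract (x - u))) =
      (if t < x ∧ x < u then 1 else 0) - if t < 1 - x ∧ 1 - x < u then 1 else 0 := by
  rw [fract_add_of_lt hx0 hx1 ht (by linarith), fract_sub_of_lt hx0 hx1 ht (by linarith),
    fract_add_of_lt hx0 hx1 (by linarith) (by linarith),
    fract_sub_of_lt hx0 hx1 (by linarith : 0 < u) (by linarith)]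
  have e1 : t < 1 - x ↔ x < 1 - t := by constructor <;> intro h <;> linarith
  have e2 : t < x ↔ ¬ x < t := ⟨fun h => by linarith, fun h => lt_of_le_of_ne (not_lt.1 h) h1.symm⟩
  have e3 : 1 - x < u ↔ ¬ x < 1 - u :=
    ⟨fun h => by linarith, fun h => by linarith [lt_of_le_of_ne (not_lt.1 h) h2.symm]⟩
  simp only [e1, e2, e3]
  by_cases h3 : x < t <;> by_cases h4 : x < u <;> by_cases h5 : x < 1 - u <;>
    by_cases h6 : x < 1 - t <;> simp only [h3, h4, h5, h6, if_true, if_false, and_true,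
      and_false, not_true, not_false_iff] <;> linarith

theorem natCast_div_add_ne_intCast {d m a : ℕ} (hcop : Nat.Coprime d m) (hm : 0 < m) (h0 : 0 < a)
    (h1 : a < d) (p z : ℤ) : (a : ℝ) / d + (p : ℝ) / m ≠ z := by
  intro h
  have hd : (d : ℝ) ≠ 0 := by
    have : d ≠ 0 := by omega
    exact_mod_cast this
  have hm' : (m : ℝ) ≠ 0 := by exact_mod_cast hm.ne'
  field_simp at h
  have h2 : (a : ℤ) * m + d * p = z * (d * m) := by
    have : (a : ℝ) * m + d * p = z * (d * m) := by linarith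
    exact_mod_cast this
  have h3 : (d : ℤ) ∣ a * m := ⟨z * m - p, by linear_combination h2⟩
  have h4 : d ∣ a * m := by exact_mod_cast h3
  exact absurd (Nat.le_of_dvd h0 (hcop.dvd_of_dvd_mul_right h4)) (by omega)

theorem fract_natCast_div_add_ne_zero {d m a : ℕ} (hcop : Nat.Coprime d m) (hm : 0 < m)
    (h0 : 0 < a) (h1 : a < d) (p : ℕ) : Int.fract ((a : ℝ) / d + (p : ℝ) / m) ≠ 0 ∧
      Int.fract ((a : ℝ) / d - (p : ℝ) / m) ≠ 0 := by
  refine ⟨fun h => ?_, fun h => ?_⟩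
  · obtain ⟨z, hz⟩ := Int.fract_eq_zero_iff.1 h
    exact natCast_div_add_ne_intCast hcop hm h0 h1 p z (by rw [hz]; simp)
  · obtain ⟨z, hz⟩ := Int.fract_eq_zero_iff.1 h
    exact natCast_div_add_ne_intCast hcop hm h0 h1 (-p) z (by rw [hz]; push_cast; ring)

theorem step_eq_ite {d m p q a : ℕ} (hd : 0 < d) (hm : 0 < m) :
    (weightedSum.step d m p q a : ℝ) =
      if (p : ℝ) / m < (a : ℝ) / d ∧ (a : ℝ) / d < (q : ℝ) / m then 1 else 0 := by
  have hd' : (0 : ℝ) < d := by exact_mod_cast hd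
  have hm' : (0 : ℝ) < m := by exact_mod_cast hm
  have e1 : (p : ℝ) / m < (a : ℝ) / d ↔ p * d < m * a := by
    rw [div_lt_div_iff₀ hm' hd', mul_comm (a : ℝ)]
    exact_mod_cast Iff.rfl
  have e2 : (a : ℝ) / d < (q : ℝ) / m ↔ m * a < q * d := by
    rw [div_lt_div_iff₀ hd' hm', mul_comm (a : ℝ)]
    exact_mod_cast Iff.rfl
  simp only [e1, e2, weightedSum.step]
  push_cast
  rfl

theorem sum_legendreSym_mul_sawtooth_eq {d : ℕ} [Fact d.Prime] (hd : d % 4 = 3) {m p q : ℕ}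
    (hp : 0 < p) (hpq : p < q) (hq : 2 * q < m) (hcop : Nat.Coprime d m) :
    ∑ a ∈ Finset.range d, (legendreSym d a : ℝ) *
        ((1 / 2 - Int.fract ((a : ℝ) / d + (p : ℝ) / m)) +
          (1 / 2 - Int.fract ((a : ℝ) / d - (p : ℝ) / m))) -
      ∑ a ∈ Finset.range d, (legendreSym d a : ℝ) *
        ((1 / 2 - Int.fract ((a : ℝ) / d + (q : ℝ) / m)) +
          (1 / 2 - Int.fract ((a : ℝ) / d - (q : ℝ) / m))) =
      2 * weightedSum d (weightedSum.step d m p q) := by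
  have hd0 : 0 < d := (Fact.out : d.Prime).pos
  have hd' : (0 : ℝ) < d := by exact_mod_cast hd0
  have hm : 0 < m := by omega
  have hm' : (0 : ℝ) < m := by exact_mod_cast hm
  have h := weightedSum.comp_sub hd (weightedSum.step d m p q)
  have h2 : (2 * weightedSum d (weightedSum.step d m p q) : ℝ) =
      weightedSum d (weightedSum.step d m p q) -
        weightedSum d (fun a => weightedSum.step d m p q (d - a)) := by
    rw [h]
    push_cast
    ring
  rw [h2, ← Finset.sum_sub_distrib, weightedSum, weightedSum]
  push_cast
  rw [← Finset.sum_sub_distrib]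
  refine Finset.sum_congr rfl fun a ha => ?_
  rcases Nat.eq_zero_or_pos a with rfl | h0
  · simp [legendreSym]
  have h1 := Finset.mem_range.1 ha
  rw [← mul_sub, ← mul_sub, sum_sawtooth_eq, step_eq_ite hd0 hm, step_eq_ite hd0 hm,
    Nat.cast_sub h1.le, sub_div, div_self hd'.ne']
  · have : (0 : ℝ) < a := by exact_mod_cast h0
    positivity
  · rw [div_lt_one hd']
    exact_mod_cast h1
  · have : (0 : ℝ) < p := by exact_mod_cast hp
    positivity
  · gcongr
  · rw [div_lt_div_iff₀ hm' two_pos]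
    have : (q : ℝ) * 2 < m := by exact_mod_cast (by omega : q * 2 < m)
    linarith
  · intro h
    refine natCast_div_add_ne_intCast hcop hm h0 h1 (-p) 0 ?_
    rw [h]
    push_cast
    ring
  · intro h
    refine natCast_div_add_ne_intCast hcop hm h0 h1 q 1 ?_
    rw [h]
    push_cast
    ring

theorem tendsto_tsum_cos_sub_mul_legendreSym {d : ℕ} [Fact d.Prime] (hd : d % 4 = 3) {σ : ℤ}
    (hσ : σ = 1 ∨ σ = -1) (hsum : ∀ n : ℤ, ∑ a ∈ Finset.range d, (legendreSym d a : ℝ) *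
      Real.sin (2 * Real.pi * (n * (a / d))) = legendreSym d n * (σ * √d)) {m p q : ℕ}
    (hp : 0 < p) (hpq : p < q) (hq : 2 * q < m) (hcop : Nat.Coprime d m) (γ : ℝ) :
    Tendsto (fun s : ℝ => ∑' n : ℕ, γ * (Real.cos (2 * Real.pi * (n * ((p : ℝ) / m))) -
      Real.cos (2 * Real.pi * (n * ((q : ℝ) / m)))) * legendreSym d n *
      (n : ℝ) ^ (-s)) (𝓝[>] 1)
      (𝓝 (γ * (σ * Real.pi / √d * weightedSum d (weightedSum.step d m p q)))) := by
  have hm : 0 < m := by omega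
  have h1 := ((tendsto_tsum_cos_mul_legendreSym hσ hsum fun a h0 h1 =>
    fract_natCast_div_add_ne_zero hcop hm h0 h1 p).sub
    (tendsto_tsum_cos_mul_legendreSym hσ hsum fun a h0 h1 =>
      fract_natCast_div_add_ne_zero hcop hm h0 h1 q)).const_mul γ
  rw [← mul_sub, sum_legendreSym_mul_sawtooth_eq hd hp hpq hq hcop] at h1
  have e : σ * Real.pi / (2 * √d) * (2 * weightedSum d (weightedSum.step d m p q)) =
      σ * Real.pi / √d * weightedSum d (weightedSum.step d m p q) := by
    field_simp
  rw [e] at h1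
  refine h1.congr' ?_
  filter_upwards [self_mem_nhdsWithin] with s hs
  have hs : 1 < s := hs
  have hsm : ∀ t : ℝ, Summable fun n : ℕ => Real.cos (2 * Real.pi * (n * t)) * legendreSym d n *
      (n : ℝ) ^ (-s) := fun t => summable_mul_rpow_neg (fun n => by
    rw [abs_mul]
    exact mul_le_one₀ (Real.abs_cos_le_one _) (abs_nonneg _) (abs_legendreSym_le_one d n)) hs
  rw [← (hsm _).tsum_sub (hsm _), ← tsum_mul_left]
  refine tsum_congr fun n => ?_
  ring

theorem cos_two_pi_mul_div_ne_one {m r : ℕ} (h0 : 0 < r) (h1 : r < m) :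
    Real.cos (2 * Real.pi * ((r : ℝ) / m)) ≠ 1 := by
  intro h
  have hm : (0 : ℝ) < m := by exact_mod_cast (by omega : 0 < m)
  have h0' : (0 : ℝ) < r := by exact_mod_cast h0
  have h2 : (r : ℝ) / m < 1 := by
    rw [div_lt_one hm]
    exact_mod_cast h1
  have h3 : 0 < (r : ℝ) / m := by positivity
  have := Real.pi_pos
  have := (Real.cos_eq_one_iff_of_lt_of_lt (by nlinarith) (by nlinarith)).1 h
  simp [Real.pi_ne_zero, h0.ne', hm.ne'] at this

theorem tendsto_tsum_cos_sub {m p q : ℕ} (hp : 0 < p) (hpq : p < q) (hq : 2 * q < m) (γ : ℝ) :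
    Tendsto (fun s : ℝ => ∑' n : ℕ, γ * (Real.cos (2 * Real.pi * (n * ((p : ℝ) / m))) -
      Real.cos (2 * Real.pi * (n * ((q : ℝ) / m)))) * (n : ℝ) ^ (-s)) (𝓝[>] 1)
      (𝓝 (γ * ((Real.log (2 - 2 * Real.cos (2 * Real.pi * ((q : ℝ) / m))) -
        Real.log (2 - 2 * Real.cos (2 * Real.pi * ((p : ℝ) / m)))) / 2))) := by
  have h1 := ((tendsto_tsum_cos (cos_two_pi_mul_div_ne_one hp (by omega : p < m))).sub
    (tendsto_tsum_cos
      (cos_two_pi_mul_div_ne_one (by omega : 0 < q) (by omega : q < m)))).const_mul γ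
  have e : γ * ((Real.log (2 - 2 * Real.cos (2 * Real.pi * ((q : ℝ) / m))) -
        Real.log (2 - 2 * Real.cos (2 * Real.pi * ((p : ℝ) / m)))) / 2) =
      γ * (-(Real.log (2 - 2 * Real.cos (2 * Real.pi * ((p : ℝ) / m))) / 2) -
        -(Real.log (2 - 2 * Real.cos (2 * Real.pi * ((q : ℝ) / m))) / 2)) := by ring
  rw [e]
  refine h1.congr' ?_
  filter_upwards [self_mem_nhdsWithin] with s hs
  have hs : 1 < s := hs
  have hsm : ∀ t : ℝ, Summable fun n : ℕ => Real.cos (n * t) * (n : ℝ) ^ (-s) := fun t =>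
    summable_mul_rpow_neg (fun n => Real.abs_cos_le_one _) hs
  rw [← (hsm _).tsum_sub (hsm _), ← tsum_mul_left]
  refine tsum_congr fun n => ?_
  rw [show (n : ℝ) * (2 * Real.pi * ((p : ℝ) / m)) = 2 * Real.pi * (n * ((p : ℝ) / m)) by ring,
    show (n : ℝ) * (2 * Real.pi * ((q : ℝ) / m)) = 2 * Real.pi * (n * ((q : ℝ) / m)) by ring]
  ring

end

section

open Filter Topology

theorem tendsto_tsum_succ_rpow {f : ℕ → ℝ} (hf : ∀ n, |f n| ≤ 1) :
    Tendsto (fun s : ℝ => ∑' n : ℕ, f (n + 1) * ((n + 1 : ℕ) : ℝ) ^ (-(2 * s))) (𝓝[>] 1)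
      (𝓝 (∑' n : ℕ, f (n + 1) / ((n + 1 : ℕ) : ℝ) ^ 2)) := by
  refine tendsto_tsum_of_dominated_convergence (bound := fun n : ℕ => ((n + 1 : ℕ) : ℝ) ^ (-2 : ℝ))
    (summable_succ_rpow_neg (by norm_num)) (fun n => ?_) ?_
  · have h0 : (0 : ℝ) < ((n + 1 : ℕ) : ℝ) := by positivity
    have h1 : Tendsto (fun s : ℝ => ((n + 1 : ℕ) : ℝ) ^ (-(2 * s))) (𝓝[>] 1)
        (𝓝 (((n + 1 : ℕ) : ℝ) ^ (-(2 * 1) : ℝ))) := by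
      refine Tendsto.mono_left (Continuous.tendsto ?_ 1) nhdsWithin_le_nhds
      exact Continuous.rpow continuous_const (by fun_prop) fun s => Or.inl h0.ne'
    have h2 : f (n + 1) / ((n + 1 : ℕ) : ℝ) ^ 2 =
        f (n + 1) * ((n + 1 : ℕ) : ℝ) ^ (-(2 * 1) : ℝ) := by
      rw [Real.rpow_neg h0.le, div_eq_mul_inv]
      norm_num
    rw [h2]
    exact h1.const_mul _
  · filter_upwards [self_mem_nhdsWithin] with s hs n
    have hs : 1 < s := hs
    have h1 : (1 : ℝ) ≤ ((n + 1 : ℕ) : ℝ) := by push_cast; linarith [n.cast_nonneg (α := ℝ)]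
    rw [norm_mul, Real.norm_eq_abs, Real.norm_of_nonneg (by positivity)]
    calc _ ≤ 1 * ((n + 1 : ℕ) : ℝ) ^ (-(2 * s)) :=
        mul_le_mul_of_nonneg_right (hf _) (by positivity)
      _ ≤ ((n + 1 : ℕ) : ℝ) ^ (-2 : ℝ) := by
        rw [one_mul]
        exact Real.rpow_le_rpow_of_exponent_le h1 (by linarith)

theorem tendsto_two_mul_sub_one : Tendsto (fun s : ℝ => 2 * s - 1) (𝓝[>] 1) (𝓝[>] 1) := by
  refine tendsto_nhdsWithin_iff.2 ⟨?_, ?_⟩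
  · refine Tendsto.mono_left ?_ nhdsWithin_le_nhds
    have : Continuous fun s : ℝ => 2 * s - 1 := by fun_prop
    convert this.tendsto 1 using 2
    norm_num
  · filter_upwards [self_mem_nhdsWithin] with s hs
    have hs : 1 < s := hs
    show 1 < 2 * s - 1
    linarith

theorem tendsto_rpow_mul_powIntegral {k : ℕ} (hk : 0 < k) {β : ℝ} (hβ : 1 ≤ β) :
    Tendsto (fun s : ℝ => (k : ℝ) ^ (-(2 * s)) * (β ^ (1 - 2 * s) * powIntegral s)) (𝓝[>] 1)
      (𝓝 (Real.pi / (k ^ 2 * β))) := by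
  have hk' : (0 : ℝ) < k := by exact_mod_cast hk
  have h1 : Tendsto (fun s : ℝ => (k : ℝ) ^ (-(2 * s))) (𝓝[>] 1)
      (𝓝 ((k : ℝ) ^ (-(2 * 1) : ℝ))) := by
    refine Tendsto.mono_left (Continuous.tendsto ?_ 1) nhdsWithin_le_nhds
    exact Continuous.rpow continuous_const (by fun_prop) fun s => Or.inl hk'.ne'
  have h2 : Tendsto (fun s : ℝ => β ^ (1 - 2 * s)) (𝓝[>] 1) (𝓝 (β ^ (1 - 2 * 1 : ℝ))) := by
    refine Tendsto.mono_left (Continuous.tendsto ?_ 1) nhdsWithin_le_nhds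
    exact Continuous.rpow continuous_const (by fun_prop) fun s => Or.inl (by linarith)
  convert h1.mul (h2.mul tendsto_powIntegral) using 2
  rw [Real.rpow_neg hk'.le, show (1 - 2 * 1 : ℝ) = -1 by norm_num, Real.rpow_neg (by linarith)]
  norm_num
  field_simp

section

variable {d : ℕ} [Fact d.Prime] {c : ℤ} [IsPrincipalIdealRing (QuadraticAlgebra ℤ (-c) 1)]

theorem mul_eq_of_tendsto (hd : d % 8 = 3) (hd3 : 3 < d)
    (hc : (d : ℤ) = 4 * c - 1) {χ : ℤ → ℝ} (hχ : ∀ m n, χ (m * n) = χ m * χ n)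
    (hχ1 : ∀ n, |χ n| ≤ 1) {k : ℕ} (hk : 0 < k) (hper : ∀ n j : ℤ, χ (n + k * j) = χ n)
    {β : ℝ} (hβ : 1 ≤ β) (hβc : 4 * (k : ℝ) ^ 2 * β ^ 2 = 4 * c - 1) {A B κ : ℝ}
    (hA : Tendsto (fun s : ℝ => ∑' n : ℕ, χ n * (n : ℝ) ^ (-s)) (𝓝[>] 1) (𝓝 A))
    (hB : Tendsto (fun s : ℝ => ∑' n : ℕ, χ n * legendreSym d n * (n : ℝ) ^ (-s))
      (𝓝[>] 1) (𝓝 B))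
    (hκ : Tendsto (fun s : ℝ => ∑' n : ℕ, rowCoeff χ c k (n + 1) * ((n + 1 : ℕ) : ℝ) ^ (-s))
      (𝓝[>] 1) (𝓝 κ)) :
    A * B = ∑' n : ℕ, χ (((n + 1 : ℕ) : ℤ) ^ 2) / ((n + 1 : ℕ) : ℝ) ^ 2 +
      Real.pi / (k ^ 2 * β) * (κ + ∑' n : ℕ, rowTail χ c k β (n + 1) / ((n + 1 : ℕ) : ℝ)) := by
  have hc1 : 1 ≤ c := by omega
  have h1 := ((tendsto_tsum_succ_rpow (f := fun n => χ ((n : ℤ) ^ 2)) fun n => hχ1 _).add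
    (tendsto_tsum_form hχ1 hc1 hk hper hβ hβc)).add
    ((tendsto_rpow_mul_powIntegral hk hβ).mul (hκ.comp tendsto_two_mul_sub_one))
  refine (tendsto_nhds_unique (hA.mul hB) (h1.congr' ?_)).trans (by ring)
  filter_upwards [self_mem_nhdsWithin] with s hs
  have h2 := tsum_form_eq hd hd3 hc hχ hχ1 hs
  have h3 := tsum_form_eq_add hc1 hχ1 hs
  simp only [Function.comp]
  linarith

theorem legendreSym_tendsto_value (hd : d % 8 = 3) (hd3 : 3 < d)
    (hc : (d : ℤ) = 4 * c - 1) {B : ℝ}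
    (hB : Tendsto (fun s : ℝ => ∑' n : ℕ, (legendreSym d n : ℝ) * (n : ℝ) ^ (-s))
      (𝓝[>] 1) (𝓝 B)) : B = Real.pi / √d := by
  have hd0 : (0 : ℝ) ≤ d := d.cast_nonneg
  have hc1 : 1 ≤ c := by omega
  have hd4 : (4 : ℝ) ≤ d := by exact_mod_cast hd3
  have hβ : (1 : ℝ) ≤ √d / 2 := by
    rw [le_div_iff₀ two_pos]
    exact Real.le_sqrt_of_sq_le (by linarith)
  have hcr : (d : ℝ) = 4 * c - 1 := by exact_mod_cast hc
  have hβc : 4 * ((1 : ℕ) : ℝ) ^ 2 * (√d / 2) ^ 2 = 4 * c - 1 := by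
    rw [div_pow, Real.sq_sqrt hd0, ← hcr]
    push_cast
    ring
  have h0 : Tendsto (fun s : ℝ => s - 1) (𝓝[>] 1) (𝓝 0) := by
    refine Tendsto.mono_left ?_ nhdsWithin_le_nhds
    have : Continuous fun s : ℝ => s - 1 := by fun_prop
    convert this.tendsto 1 using 2
    norm_num
  have hz : Tendsto (fun s : ℝ => (s - 1) * ∑' n : ℕ, (n : ℝ) ^ (-s)) (𝓝[>] 1) (𝓝 1) := by
    refine tendsto_sub_mul_tsum_nat_rpow.congr fun s => ?_
    congr 1
    exact tsum_congr fun n => by rw [Real.rpow_neg n.cast_nonneg, one_div]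
  have hz2 : Tendsto (fun s : ℝ => (s - 1) * ∑' n : ℕ, ((n + 1 : ℕ) : ℝ) ^ (-s)) (𝓝[>] 1)
      (𝓝 1) := by
    refine hz.congr' ?_
    filter_upwards [self_mem_nhdsWithin] with s hs
    have hs : 1 < s := hs
    rw [(Real.summable_nat_rpow.2 (by linarith)).tsum_eq_zero_add, Nat.cast_zero,
      Real.zero_rpow (by linarith), zero_add]
  have h1 := ((h0.mul (tendsto_tsum_succ_rpow (f := fun _ => 1) (by simp))).add
    (h0.mul (tendsto_tsum_form (χ := fun _ => 1) (by simp) hc1 one_pos (by simp) hβ hβc))).add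
    (((tendsto_rpow_mul_powIntegral one_pos hβ).mul (hz2.comp tendsto_two_mul_sub_one)).mul_const
      (1 / 2))
  have h2 := tendsto_nhds_unique (hz.mul hB) (h1.congr' (by
    filter_upwards [self_mem_nhdsWithin] with s hs
    have h2 := tsum_form_eq (χ := fun _ => 1) hd hd3 hc (by simp) (by simp) hs
    have h3 := tsum_form_eq_add (χ := fun _ => 1) hc1 (by simp) hs
    simp only [Function.comp, one_mul, rowCoeff, Finset.sum_const, Finset.card_range,
      one_smul] at h2 h3 ⊢
    linear_combination (s - 1) * (h2 - h3) / 2))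
  rw [one_mul] at h2
  rw [h2]
  simp only [zero_mul, zero_add, mul_one]
  push_cast
  field_simp

theorem weightedSum_self (hd : d % 8 = 3) (hd3 : 3 < d) (hc : (d : ℤ) = 4 * c - 1) {σ : ℤ}
    (hσ : σ = 1 ∨ σ = -1) (hsum : ∀ n : ℤ, ∑ a ∈ Finset.range d, (legendreSym d a : ℝ) *
      Real.sin (2 * Real.pi * (n * (a / d))) = legendreSym d n * (σ * √d)) :
    weightedSum d (fun a => a) = -(d * σ) := by
  have hd0 : (0 : ℝ) < d := by exact_mod_cast (Fact.out : d.Prime).pos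
  have hf : ∀ a : ℕ, 0 < a → a < d → Int.fract ((a : ℝ) / d) = a / d := fun a h0 h1 =>
    Int.fract_eq_self.2 ⟨by positivity, (div_lt_one hd0).2 (by exact_mod_cast h1)⟩
  have h1 := legendreSym_tendsto_value hd hd3 hc ((tendsto_tsum_cos_mul_legendreSym (t := 0) hσ hsum
    fun a h0 h1 => by
      rw [add_zero, sub_zero, hf a h0 h1]
      have : (0 : ℝ) < a := by exact_mod_cast h0
      exact ⟨by positivity, by positivity⟩).congr fun s => by simp)
  have h2 : ∑ a ∈ Finset.range d, (legendreSym d a : ℝ) *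
      ((1 / 2 - Int.fract ((a : ℝ) / d + 0)) + (1 / 2 - Int.fract ((a : ℝ) / d - 0))) =
      (weightedSum d (fun a => 1) : ℝ) - 2 / d * weightedSum d (fun a => a) := by
    rw [weightedSum, weightedSum]
    push_cast
    rw [Finset.mul_sum, ← Finset.sum_sub_distrib]
    refine Finset.sum_congr rfl fun a ha => ?_
    rcases Nat.eq_zero_or_pos a with rfl | h0
    · simp [legendreSym]
    · rw [add_zero, sub_zero, hf a h0 (Finset.mem_range.1 ha)]
      field_simp
      ring
  have h3 : weightedSum d (fun a => 1) = 0 := by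
    have := weightedSum.comp_sub (d := d) (by omega) (fun _ => 1)
    omega
  rw [h2, h3] at h1
  have hπ := Real.pi_pos
  have hs : √(d : ℝ) ≠ 0 := (Real.sqrt_pos.2 hd0).ne'
  have h4 : (weightedSum d (fun a => (a : ℤ)) : ℝ) = -(d * σ) := by
    have hσ2 : (σ : ℝ) * σ = 1 := by rcases hσ with rfl | rfl <;> norm_num
    field_simp at h1
    push_cast at h1
    linear_combination (-(σ : ℝ) / 2) * h1 - (weightedSum d (fun a => (a : ℤ)) : ℝ) * hσ2
  exact_mod_cast h4

end

end

/-- Coordinates of `2 * cos (n * π / 8)` with respect to `1`, `2 * cos (π / 8)`, `√2` and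
`2 * cos (3 * π / 8)`. -/
def cosSixteen : Fin 4 → ZMod 16 → ℤ :=
  ![![2, 0, 0, 0, 0, 0, 0, 0, -2, 0, 0, 0, 0, 0, 0, 0],
    ![0, 1, 0, 0, 0, 0, 0, -1, 0, -1, 0, 0, 0, 0, 0, 1],
    ![0, 0, 1, 0, 0, 0, -1, 0, 0, 0, -1, 0, 0, 0, 1, 0],
    ![0, 0, 0, 1, 0, -1, 0, 0, 0, 0, 0, -1, 0, 1, 0, 0]]

/-- Coordinates of `4 * cos (n * π / 12)` with respect to `1`, `√2`, `√3` and `√6`. -/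
def cosTwentyFour : Fin 4 → ZMod 24 → ℤ :=
  ![![4, 0, 0, 0, 2, 0, 0, 0, -2, 0, 0, 0, -4, 0, 0, 0, -2, 0, 0, 0, 2, 0, 0, 0],
    ![0, 1, 0, 2, 0, -1, 0, 1, 0, -2, 0, -1, 0, -1, 0, -2, 0, 1, 0, -1, 0, 2, 0, 1],
    ![0, 0, 2, 0, 0, 0, 0, 0, 0, 0, -2, 0, 0, 0, -2, 0, 0, 0, 0, 0, 0, 0, 2, 0],
    ![0, 1, 0, 0, 0, 1, 0, -1, 0, 0, 0, -1, 0, -1, 0, 0, 0, -1, 0, 1, 0, 0, 0, 1]]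

theorem cos_add_two_mul (n : ℕ) (θ : ℝ) : Real.cos ((n + 2 : ℕ) * θ) =
    2 * Real.cos θ * Real.cos ((n + 1 : ℕ) * θ) - Real.cos (n * θ) := by
  rw [show ((n + 2 : ℕ) : ℝ) * θ = (n + 1 : ℕ) * θ + θ by push_cast; ring,
    show (n : ℝ) * θ = (n + 1 : ℕ) * θ - θ by push_cast; ring, Real.cos_add, Real.cos_sub]
  ring

theorem cos_pi_div_eight_relations :
    (2 * Real.cos (Real.pi / 8)) * (2 * Real.cos (Real.pi / 8)) = 2 + √2 ∧
    (2 * Real.cos (Real.pi / 8)) * √2 =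
      2 * Real.cos (Real.pi / 8) + 2 * Real.cos (3 * Real.pi / 8) ∧
    (2 * Real.cos (Real.pi / 8)) * (2 * Real.cos (3 * Real.pi / 8)) = √2 := by
  have h4 := Real.cos_pi_div_four
  refine ⟨?_, ?_, ?_⟩
  · have := Real.cos_sq (Real.pi / 8)
    rw [show 2 * (Real.pi / 8) = Real.pi / 4 by ring, h4] at this
    linarith
  · have e1 := Real.cos_add (Real.pi / 4) (Real.pi / 8)
    have e2 := Real.cos_sub (Real.pi / 4) (Real.pi / 8)
    rw [h4, show Real.pi / 4 + Real.pi / 8 = 3 * Real.pi / 8 by ring] at e1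
    rw [h4, show Real.pi / 4 - Real.pi / 8 = Real.pi / 8 by ring] at e2
    linarith
  · have e1 := Real.cos_add (3 * Real.pi / 8) (Real.pi / 8)
    have e2 := Real.cos_sub (3 * Real.pi / 8) (Real.pi / 8)
    rw [show 3 * Real.pi / 8 + Real.pi / 8 = Real.pi / 2 by ring, Real.cos_pi_div_two] at e1
    rw [show 3 * Real.pi / 8 - Real.pi / 8 = Real.pi / 4 by ring, h4] at e2
    linarith

theorem two_mul_cos_eq (n : ℕ) : 2 * Real.cos (n * (Real.pi / 8)) =
    cosSixteen 0 n + cosSixteen 1 n * (2 * Real.cos (Real.pi / 8)) + cosSixteen 2 n * √2 +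
      cosSixteen 3 n * (2 * Real.cos (3 * Real.pi / 8)) := by
  obtain ⟨h1, h2, h3⟩ := cos_pi_div_eight_relations
  induction n using Nat.twoStepInduction with
  | zero =>
    rw [Nat.cast_zero, Nat.cast_zero, zero_mul, Real.cos_zero,
      (by decide : cosSixteen 0 0 = 2), (by decide : cosSixteen 1 0 = 0),
      (by decide : cosSixteen 2 0 = 0), (by decide : cosSixteen 3 0 = 0)]
    norm_num
  | one =>
    rw [Nat.cast_one, Nat.cast_one, one_mul,
      (by decide : cosSixteen 0 1 = 0), (by decide : cosSixteen 1 1 = 1),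
      (by decide : cosSixteen 2 1 = 0), (by decide : cosSixteen 3 1 = 0)]
    norm_num
  | more n ih1 ih2 =>
    have h0 : ∀ z : ZMod 16, cosSixteen 0 (z + 2) = 2 * cosSixteen 1 (z + 1) - cosSixteen 0 z ∧
        cosSixteen 1 (z + 2) = cosSixteen 0 (z + 1) + cosSixteen 2 (z + 1) - cosSixteen 1 z ∧
        cosSixteen 2 (z + 2) = cosSixteen 1 (z + 1) + cosSixteen 3 (z + 1) - cosSixteen 2 z ∧
        cosSixteen 3 (z + 2) = cosSixteen 2 (z + 1) - cosSixteen 3 z := by decide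
    obtain ⟨e0, e1, e2, e3⟩ := h0 n
    rw [cos_add_two_mul]
    push_cast at ih2 ⊢
    rw [e0, e1, e2, e3]
    push_cast
    linear_combination (2 * Real.cos (Real.pi / 8)) * ih2 - ih1 + (cosSixteen 1 (n + 1) : ℝ) * h1 +
      (cosSixteen 2 (n + 1) : ℝ) * h2 + (cosSixteen 3 (n + 1) : ℝ) * h3

theorem four_mul_cos_eq (n : ℕ) : 4 * Real.cos (n * (Real.pi / 12)) =
    cosTwentyFour 0 n + cosTwentyFour 1 n * √2 + cosTwentyFour 2 n * √3 +
      cosTwentyFour 3 n * (√2 * √3) := by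
  have h2 : √(2 : ℝ) * √2 = 2 := Real.mul_self_sqrt (by norm_num)
  have h3 : √(3 : ℝ) * √3 = 3 := Real.mul_self_sqrt (by norm_num)
  have h1 : 4 * Real.cos (Real.pi / 12) = √2 + √2 * √3 := by
    rw [show Real.pi / 12 = Real.pi / 3 - Real.pi / 4 by ring, Real.cos_sub, Real.cos_pi_div_three,
      Real.cos_pi_div_four, Real.sin_pi_div_three, Real.sin_pi_div_four]
    ring
  induction n using Nat.twoStepInduction with
  | zero =>
    rw [Nat.cast_zero, Nat.cast_zero, zero_mul, Real.cos_zero,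
      (by decide : cosTwentyFour 0 0 = 4), (by decide : cosTwentyFour 1 0 = 0),
      (by decide : cosTwentyFour 2 0 = 0), (by decide : cosTwentyFour 3 0 = 0)]
    norm_num
  | one =>
    rw [Nat.cast_one, Nat.cast_one, one_mul, h1,
      (by decide : cosTwentyFour 0 1 = 0), (by decide : cosTwentyFour 1 1 = 1),
      (by decide : cosTwentyFour 2 1 = 0), (by decide : cosTwentyFour 3 1 = 1)]
    norm_num
  | more n ih1 ih2 =>
    have h0 : ∀ z : ZMod 24,
        2 * cosTwentyFour 0 (z + 2) =
          2 * cosTwentyFour 1 (z + 1) + 6 * cosTwentyFour 3 (z + 1) - 2 * cosTwentyFour 0 z ∧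
        2 * cosTwentyFour 1 (z + 2) =
          cosTwentyFour 0 (z + 1) + 3 * cosTwentyFour 2 (z + 1) - 2 * cosTwentyFour 1 z ∧
        2 * cosTwentyFour 2 (z + 2) =
          2 * cosTwentyFour 1 (z + 1) + 2 * cosTwentyFour 3 (z + 1) - 2 * cosTwentyFour 2 z ∧
        2 * cosTwentyFour 3 (z + 2) =
          cosTwentyFour 0 (z + 1) + cosTwentyFour 2 (z + 1) - 2 * cosTwentyFour 3 z := by decide
    obtain ⟨e0, e1, e2, e3⟩ := h0 n
    replace e0 := congrArg (Int.cast (R := ℝ)) e0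
    replace e1 := congrArg (Int.cast (R := ℝ)) e1
    replace e2 := congrArg (Int.cast (R := ℝ)) e2
    replace e3 := congrArg (Int.cast (R := ℝ)) e3
    rw [cos_add_two_mul]
    push_cast at ih2 e0 e1 e2 e3 ⊢
    generalize Real.cos (((n : ℝ) + 1) * (Real.pi / 12)) = x at *
    generalize Real.cos (n * (Real.pi / 12)) = y at *
    generalize Real.cos (Real.pi / 12) = w at *
    generalize (cosTwentyFour 0 (n + 1) : ℝ) = a0 at *
    generalize (cosTwentyFour 1 (n + 1) : ℝ) = a1 at *
    generalize (cosTwentyFour 2 (n + 1) : ℝ) = a2 at *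
    generalize (cosTwentyFour 3 (n + 1) : ℝ) = a3 at *
    linear_combination (2 * x) * h1 + (√2 + √2 * √3) / 2 * ih2 - ih1 - (e0 + e1 * √2 + e2 * √3 +
      e3 * (√2 * √3)) / 2 + (a1 / 2 + a1 * √3 / 2 + a3 * √3 / 2 + a3 * √3 * √3 / 2) * h2 +
      (a2 * √2 / 2 + a3) * h3

section

open Filter Topology

/-- The real function on `ℤ` induced by an integer valued function on `ZMod k`. -/
def periodicLift {k : ℕ} (F : ZMod k → ℤ) (n : ℤ) : ℝ := (F n : ℝ)

/-- The even primitive quadratic character modulo `12`. -/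
def quadraticTwelve : ZMod 12 → ℤ := ![0, 1, 0, 0, 0, -1, 0, -1, 0, 0, 0, 1]

section

variable {k : ℕ} {F : ZMod k → ℤ}

theorem periodicLift_mul (hF : ∀ a b, F (a * b) = F a * F b) (m n : ℤ) :
    periodicLift F (m * n) = periodicLift F m * periodicLift F n := by
  simp [periodicLift, hF]

theorem abs_periodicLift_le (hF : ∀ a, |F a| ≤ 1) (n : ℤ) : |periodicLift F n| ≤ 1 := by
  rw [periodicLift]
  exact_mod_cast hF n

theorem periodicLift_add (n j : ℤ) : periodicLift F (n + k * j) = periodicLift F n := by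
  simp [periodicLift]

theorem rowCoeff_periodicLift (c : ℤ) (y : ℕ) : rowCoeff (periodicLift F) c k y =
    ((∑ r ∈ Finset.range k, F ((r : ZMod k) ^ 2 + r * y + c * (y : ZMod k) ^ 2) : ℤ) : ℝ) := by
  rw [rowCoeff]
  push_cast
  refine Finset.sum_congr rfl fun r _ => ?_
  simp [periodicLift, formValue]

end

theorem hasSum_dvd_inv_sq {m : ℕ} (hm : 0 < m) : HasSum
    (fun n : ℕ => (if m ∣ n then 1 else 0 : ℝ) / (n : ℝ) ^ 2) (Real.pi ^ 2 / 6 / m ^ 2) := by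
  have hinj : Function.Injective fun n : ℕ => m * n := fun a b h => Nat.eq_of_mul_eq_mul_left hm h
  refine (hinj.hasSum_iff fun n hn => ?_).1 ?_
  · rw [if_neg fun ⟨j, hj⟩ => hn ⟨j, hj.symm⟩, zero_div]
  · refine (hasSum_zeta_two.div_const ((m : ℝ) ^ 2)).congr_fun fun n => ?_
    simp only [Function.comp, dvd_mul_right, if_true]
    push_cast
    rw [mul_pow, div_div, mul_comm]

theorem tsum_succ_of_hasSum {f : ℕ → ℝ} {S : ℝ} (h : HasSum f S) (h0 : f 0 = 0) :
    ∑' n : ℕ, f (n + 1) = S := by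
  rw [← h.tsum_eq, h.summable.tsum_eq_zero_add, h0, zero_add]

theorem tsum_quadraticEight_sq : ∑' n : ℕ, periodicLift ZMod.χ₈ (((n + 1 : ℕ) : ℤ) ^ 2) /
    ((n + 1 : ℕ) : ℝ) ^ 2 = Real.pi ^ 2 / 8 := by
  have h := (hasSum_dvd_inv_sq one_pos).sub (hasSum_dvd_inv_sq two_pos)
  have h1 : ∀ n : ℕ, periodicLift ZMod.χ₈ ((n : ℤ) ^ 2) =
      (if 1 ∣ n then 1 else 0 : ℝ) - (if 2 ∣ n then 1 else 0 : ℝ) := fun n => by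
    have h2 : ∀ z : ZMod 8, ZMod.χ₈ (z ^ 2) = 1 - if z.val % 2 = 0 then 1 else 0 := by decide
    have h3 := h2 n
    rw [ZMod.val_natCast, Nat.mod_mod_of_dvd _ (by norm_num)] at h3
    rw [if_pos (one_dvd n), periodicLift]
    push_cast
    rw [h3]
    simp only [Nat.dvd_iff_mod_eq_zero]
    push_cast
    rfl
  have h2 := tsum_succ_of_hasSum
    (f := fun n : ℕ => periodicLift ZMod.χ₈ ((n : ℤ) ^ 2) / (n : ℝ) ^ 2)
    (h.congr_fun fun n => by rw [h1, sub_div]) (by simp)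
  rw [h2]
  norm_num
  ring

theorem tsum_quadraticTwelve_sq : ∑' n : ℕ, periodicLift quadraticTwelve (((n + 1 : ℕ) : ℤ) ^ 2) /
    ((n + 1 : ℕ) : ℝ) ^ 2 = Real.pi ^ 2 / 9 := by
  have h := (((hasSum_dvd_inv_sq one_pos).sub (hasSum_dvd_inv_sq two_pos)).sub
    (hasSum_dvd_inv_sq three_pos)).add (hasSum_dvd_inv_sq (m := 6) (by norm_num))
  have h1 : ∀ n : ℕ, periodicLift quadraticTwelve ((n : ℤ) ^ 2) =
      (if 1 ∣ n then 1 else 0 : ℝ) - (if 2 ∣ n then 1 else 0 : ℝ) -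
        (if 3 ∣ n then 1 else 0 : ℝ) + (if 6 ∣ n then 1 else 0 : ℝ) := fun n => by
    have h2 : ∀ z : ZMod 12, quadraticTwelve (z ^ 2) = 1 - (if z.val % 2 = 0 then 1 else 0) -
      (if z.val % 3 = 0 then 1 else 0) + (if z.val % 6 = 0 then 1 else 0) := by decide
    have h3 := h2 n
    rw [ZMod.val_natCast, Nat.mod_mod_of_dvd _ (by norm_num), Nat.mod_mod_of_dvd _ (by norm_num),
      Nat.mod_mod_of_dvd _ (by norm_num)] at h3
    rw [if_pos (one_dvd n), periodicLift]
    push_cast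
    rw [h3]
    simp only [Nat.dvd_iff_mod_eq_zero]
    push_cast
    rfl
  have h2 := tsum_succ_of_hasSum
    (f := fun n : ℕ => periodicLift quadraticTwelve ((n : ℤ) ^ 2) / (n : ℝ) ^ 2)
    (h.congr_fun fun n => by rw [h1, add_div, sub_div, sub_div]) (by simp)
  rw [h2]
  norm_num
  ring

theorem cos_two_pi_mul_div_eight (n p : ℕ) :
    2 * Real.cos (2 * Real.pi * (n * ((p : ℝ) / (8 : ℕ)))) =
    cosSixteen 0 (2 * n * p) + cosSixteen 2 (2 * n * p) * √2 := by
  have h := two_mul_cos_eq (2 * n * p)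
  have h1 : ∀ z : ZMod 16, cosSixteen 1 (2 * z) = 0 ∧ cosSixteen 3 (2 * z) = 0 := by decide
  have h2 := h1 (n * p)
  rw [← mul_assoc] at h2
  push_cast at h
  rw [h2.1, h2.2] at h
  rw [← show 2 * (n : ℝ) * p * (Real.pi / 8) = 2 * Real.pi * (n * ((p : ℝ) / (8 : ℕ))) by
    push_cast; ring, h]
  push_cast
  ring

theorem cos_two_pi_mul_div_twelve (n p : ℕ) :
    4 * Real.cos (2 * Real.pi * (n * ((p : ℝ) / (12 : ℕ)))) =
    cosTwentyFour 0 (2 * n * p) + cosTwentyFour 2 (2 * n * p) * √3 := by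
  have h := four_mul_cos_eq (2 * n * p)
  have h1 : ∀ z : ZMod 24, cosTwentyFour 1 (2 * z) = 0 ∧ cosTwentyFour 3 (2 * z) = 0 := by decide
  have h2 := h1 (n * p)
  rw [← mul_assoc] at h2
  push_cast at h
  rw [h2.1, h2.2] at h
  rw [← show 2 * (n : ℝ) * p * (Real.pi / 12) = 2 * Real.pi * (n * ((p : ℝ) / (12 : ℕ))) by
    push_cast; ring, h]
  push_cast
  ring

theorem periodicLift_quadraticEight (n : ℕ) : periodicLift ZMod.χ₈ n =
    1 / √2 * (Real.cos (2 * Real.pi * (n * (((1 : ℕ) : ℝ) / (8 : ℕ)))) -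
      Real.cos (2 * Real.pi * (n * (((3 : ℕ) : ℝ) / (8 : ℕ))))) := by
  have h1 := cos_two_pi_mul_div_eight n 1
  have h2 := cos_two_pi_mul_div_eight n 3
  have h3 : ∀ z : ZMod 16, cosSixteen 0 (2 * z * 1) = cosSixteen 0 (2 * z * 3) ∧
      cosSixteen 2 (2 * z * 1) - cosSixteen 2 (2 * z * 3) =
        2 * ZMod.χ₈ (ZMod.castHom (by norm_num : 8 ∣ 16) (ZMod 8) z) := by decide
  obtain ⟨h4, h5⟩ := h3 n
  rw [map_natCast] at h5
  have h5' := congrArg (Int.cast (R := ℝ)) h5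
  push_cast at h1 h2 h5'
  rw [h4] at h1
  have h6 : √(2 : ℝ) ≠ 0 := by positivity
  rw [periodicLift, Int.cast_natCast]
  push_cast
  generalize Real.cos (2 * Real.pi * (n * (1 / 8))) = x at *
  generalize Real.cos (2 * Real.pi * (n * (3 / 8))) = y at *
  field_simp
  linear_combination (-√2 / 2) * h5' - (h1 - h2) / 2

theorem periodicLift_quadraticTwelve (n : ℕ) : periodicLift quadraticTwelve n =
    1 / √3 * (Real.cos (2 * Real.pi * (n * (((1 : ℕ) : ℝ) / (12 : ℕ)))) -
      Real.cos (2 * Real.pi * (n * (((5 : ℕ) : ℝ) / (12 : ℕ))))) := by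
  have h1 := cos_two_pi_mul_div_twelve n 1
  have h2 := cos_two_pi_mul_div_twelve n 5
  have h3 : ∀ z : ZMod 24, cosTwentyFour 0 (2 * z * 1) = cosTwentyFour 0 (2 * z * 5) ∧
      cosTwentyFour 2 (2 * z * 1) - cosTwentyFour 2 (2 * z * 5) =
        4 * quadraticTwelve (ZMod.castHom (by norm_num : 12 ∣ 24) (ZMod 12) z) := by decide
  obtain ⟨h4, h5⟩ := h3 n
  rw [map_natCast] at h5
  have h5' := congrArg (Int.cast (R := ℝ)) h5
  push_cast at h1 h2 h5'
  rw [h4] at h1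
  have h6 : √(3 : ℝ) ≠ 0 := by positivity
  rw [periodicLift, Int.cast_natCast]
  push_cast
  generalize Real.cos (2 * Real.pi * (n * (1 / 12))) = x at *
  generalize Real.cos (2 * Real.pi * (n * (5 / 12))) = y at *
  field_simp
  linear_combination (-√3 / 4) * h5' - (h1 - h2) / 4

theorem rowCoeff_quadraticEight {c : ℤ} (hc : c % 2 = 1) (y : ℕ) :
    rowCoeff (periodicLift ZMod.χ₈) c 8 y =
      2 * (Real.cos (2 * Real.pi * (y * (((1 : ℕ) : ℝ) / (8 : ℕ)))) +
        Real.cos (2 * Real.pi * (y * (((3 : ℕ) : ℝ) / (8 : ℕ))))) := by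
  have h1 := cos_two_pi_mul_div_eight y 1
  have h2 := cos_two_pi_mul_div_eight y 3
  have h3 : ∀ z : ZMod 16, ∀ e : ZMod 8, e.val % 2 = 1 →
      cosSixteen 2 (2 * z * 1) = -cosSixteen 2 (2 * z * 3) ∧
      ∑ r ∈ Finset.range 8, ZMod.χ₈ ((r : ZMod 8) ^ 2 +
        r * ZMod.castHom (by norm_num : 8 ∣ 16) (ZMod 8) z +
        e * ZMod.castHom (by norm_num : 8 ∣ 16) (ZMod 8) z ^ 2) =
      cosSixteen 0 (2 * z * 1) + cosSixteen 0 (2 * z * 3) := by decide +kernel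
  have he : (c : ZMod 8).val % 2 = 1 := by
    have := ZMod.val_intCast (n := 8) c
    omega
  obtain ⟨h4, h5⟩ := h3 y c he
  rw [map_natCast] at h5
  rw [rowCoeff_periodicLift, h5]
  push_cast at h1 h2 ⊢
  rw [h4] at h1
  push_cast at h1
  linear_combination -h1 - h2

theorem rowCoeff_quadraticTwelve {c : ℤ} (hc : c % 12 = 5 ∨ c % 12 = 11) (y : ℕ) :
    rowCoeff (periodicLift quadraticTwelve) c 12 y =
      2 * (Real.cos (2 * Real.pi * (y * (((1 : ℕ) : ℝ) / (12 : ℕ)))) +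
        Real.cos (2 * Real.pi * (y * (((5 : ℕ) : ℝ) / (12 : ℕ))))) := by
  have h1 := cos_two_pi_mul_div_twelve y 1
  have h2 := cos_two_pi_mul_div_twelve y 5
  have h3 : ∀ z : ZMod 24, ∀ e : ZMod 12, e.val = 5 ∨ e.val = 11 →
      cosTwentyFour 2 (2 * z * 1) = -cosTwentyFour 2 (2 * z * 5) ∧
      2 * ∑ r ∈ Finset.range 12, quadraticTwelve ((r : ZMod 12) ^ 2 +
        r * ZMod.castHom (by norm_num : 12 ∣ 24) (ZMod 12) z +
        e * ZMod.castHom (by norm_num : 12 ∣ 24) (ZMod 12) z ^ 2) =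
      cosTwentyFour 0 (2 * z * 1) + cosTwentyFour 0 (2 * z * 5) := by decide +kernel
  have he : (c : ZMod 12).val = 5 ∨ (c : ZMod 12).val = 11 := by
    have := ZMod.val_intCast (n := 12) c
    omega
  obtain ⟨h4, h5⟩ := h3 y c he
  rw [map_natCast] at h5
  have h5' := congrArg (Int.cast (R := ℝ)) h5
  rw [rowCoeff_periodicLift]
  push_cast at h1 h2 h5' ⊢
  rw [h4] at h1
  push_cast at h1
  linear_combination h5' / 2 - (h1 + h2) / 2

end

section

open Filter Topology

theorem tendsto_quadraticEight : Tendsto (fun s : ℝ => ∑' n : ℕ, periodicLift ZMod.χ₈ n *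
    (n : ℝ) ^ (-s)) (𝓝[>] 1) (𝓝 (Real.log (1 + √2) / √2)) := by
  have h := tendsto_tsum_cos_sub (m := 8) one_pos (by norm_num : 1 < 3) (by norm_num) (1 / √2)
  simp only [← periodicLift_quadraticEight] at h
  convert h using 2
  have h2 : √(2 : ℝ) * √2 = 2 := Real.mul_self_sqrt (by norm_num)
  have h3 : √(2 : ℝ) < 2 := by nlinarith [Real.sqrt_nonneg 2]
  have h0 : 0 < √(2 : ℝ) := by positivity
  have e1 : Real.cos (2 * Real.pi * (((1 : ℕ) : ℝ) / (8 : ℕ))) = √2 / 2 := by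
    rw [← Real.cos_pi_div_four]
    congr 1
    push_cast
    ring
  have e2 : Real.cos (2 * Real.pi * (((3 : ℕ) : ℝ) / (8 : ℕ))) = -(√2 / 2) := by
    rw [← Real.cos_pi_div_four, ← Real.cos_pi_sub]
    congr 1
    push_cast
    ring
  rw [e1, e2, show 2 - 2 * -(√(2 : ℝ) / 2) = 2 + √2 by ring,
    show 2 - 2 * (√(2 : ℝ) / 2) = 2 - √2 by ring,
    show 2 + √(2 : ℝ) = (2 - √2) * (1 + √2) ^ 2 by linear_combination √2 * h2,
    Real.log_mul (by linarith) (by positivity), Real.log_pow]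
  push_cast
  ring

theorem tendsto_quadraticTwelve : Tendsto (fun s : ℝ => ∑' n : ℕ, periodicLift quadraticTwelve n *
    (n : ℝ) ^ (-s)) (𝓝[>] 1) (𝓝 (Real.log (2 + √3) / √3)) := by
  have h := tendsto_tsum_cos_sub (m := 12) one_pos (by norm_num : 1 < 5) (by norm_num) (1 / √3)
  simp only [← periodicLift_quadraticTwelve] at h
  convert h using 2
  have h2 : √(3 : ℝ) * √3 = 3 := Real.mul_self_sqrt (by norm_num)
  have h3 : √(3 : ℝ) < 2 := by nlinarith [Real.sqrt_nonneg 3]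
  have h0 : 0 < √(3 : ℝ) := by positivity
  have e1 : Real.cos (2 * Real.pi * (((1 : ℕ) : ℝ) / (12 : ℕ))) = √3 / 2 := by
    rw [← Real.cos_pi_div_six]
    congr 1
    push_cast
    ring
  have e2 : Real.cos (2 * Real.pi * (((5 : ℕ) : ℝ) / (12 : ℕ))) = -(√3 / 2) := by
    rw [← Real.cos_pi_div_six, ← Real.cos_pi_sub]
    congr 1
    push_cast
    ring
  rw [e1, e2, show 2 - 2 * -(√(3 : ℝ) / 2) = 2 + √3 by ring,
    show 2 - 2 * (√(3 : ℝ) / 2) = (2 + √3)⁻¹ by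
      refine eq_inv_of_mul_eq_one_left ?_
      linear_combination -h2,
    Real.log_inv]
  ring

theorem tendsto_tsum_cos_add {m p q : ℕ} (hp : 0 < p) (hpq : p < q) (hq : 2 * q < m) :
    Tendsto (fun s : ℝ => ∑' n : ℕ, 2 * (Real.cos (2 * Real.pi * ((n + 1 : ℕ) * ((p : ℝ) / m))) +
      Real.cos (2 * Real.pi * ((n + 1 : ℕ) * ((q : ℝ) / m)))) * ((n + 1 : ℕ) : ℝ) ^ (-s)) (𝓝[>] 1)
      (𝓝 (-Real.log ((2 - 2 * Real.cos (2 * Real.pi * ((p : ℝ) / m))) *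
        (2 - 2 * Real.cos (2 * Real.pi * ((q : ℝ) / m)))))) := by
  have hm : (0 : ℝ) < m := by exact_mod_cast (by omega : 0 < m)
  have hc : ∀ r : ℕ, 0 < r → 2 * r < m → Real.cos (2 * Real.pi * ((r : ℝ) / m)) ≠ 1 :=
    fun r h0 h1 => cos_two_pi_mul_div_ne_one h0 (by omega)
  have hc' : ∀ r : ℕ, 0 < r → 2 * r < m → 2 - 2 * Real.cos (2 * Real.pi * ((r : ℝ) / m)) ≠ 0 :=
    fun r h0 h1 h => hc r h0 h1 (by linarith)
  have h1 := ((tendsto_tsum_cos (hc p hp (by omega))).add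
    (tendsto_tsum_cos (hc q (by omega) hq))).const_mul 2
  rw [Real.log_mul (hc' p hp (by omega)) (hc' q (by omega) hq)]
  have e : ∀ x y : ℝ, -(x + y) = 2 * (-(x / 2) + -(y / 2)) := fun x y => by ring
  rw [e]
  refine h1.congr' ?_
  filter_upwards [self_mem_nhdsWithin] with s hs
  have hs : 1 < s := hs
  have hsm : ∀ t : ℝ, Summable fun n : ℕ => Real.cos (n * t) * (n : ℝ) ^ (-s) := fun t =>
    summable_mul_rpow_neg (fun n => Real.abs_cos_le_one _) hs
  have h0 : ∀ t : ℝ, ∑' n : ℕ, Real.cos (n * t) * (n : ℝ) ^ (-s) =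
      ∑' n : ℕ, Real.cos ((n + 1 : ℕ) * t) * ((n + 1 : ℕ) : ℝ) ^ (-s) := fun t => by
    rw [(hsm t).tsum_eq_zero_add, Nat.cast_zero, Real.zero_rpow (by linarith), mul_zero, zero_add]
  have hsm' : ∀ t : ℝ, Summable fun n : ℕ => Real.cos ((n + 1 : ℕ) * t) *
      ((n + 1 : ℕ) : ℝ) ^ (-s) := fun t => (summable_nat_add_iff 1).2 (hsm t)
  rw [h0, h0, ← (hsm' _).tsum_add (hsm' _), ← tsum_mul_left]
  refine tsum_congr fun n => ?_
  rw [show ((n + 1 : ℕ) : ℝ) * (2 * Real.pi * ((p : ℝ) / m)) =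
      2 * Real.pi * ((n + 1 : ℕ) * ((p : ℝ) / m)) by ring,
    show ((n + 1 : ℕ) : ℝ) * (2 * Real.pi * ((q : ℝ) / m)) =
      2 * Real.pi * ((n + 1 : ℕ) * ((q : ℝ) / m)) by ring]
  ring

theorem tendsto_rowCoeff_quadraticEight {c : ℤ} (hc : c % 2 = 1) : Tendsto (fun s : ℝ => ∑' n : ℕ,
    rowCoeff (periodicLift ZMod.χ₈) c 8 (n + 1) * ((n + 1 : ℕ) : ℝ) ^ (-s)) (𝓝[>] 1)
      (𝓝 (-Real.log 2)) := by
  simp only [rowCoeff_quadraticEight hc]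
  convert tendsto_tsum_cos_add (m := 8) one_pos (by norm_num : 1 < 3) (by norm_num) using 4
  have e1 := cos_two_pi_mul_div_eight 1 1
  have e2 := cos_two_pi_mul_div_eight 1 3
  rw [Nat.cast_one, one_mul, Nat.cast_one, (by decide : cosSixteen 0 (2 * 1 * 1) = 0),
    (by decide : cosSixteen 2 (2 * 1 * 1) = 1)] at e1
  rw [Nat.cast_one, one_mul, Nat.cast_one, Nat.cast_ofNat (R := ZMod 16),
    (by decide : cosSixteen 0 (2 * 1 * 3) = 0), (by decide : cosSixteen 2 (2 * 1 * 3) = -1)] at e2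
  rw [Nat.cast_one, e1, e2]
  push_cast
  have h2 : √(2 : ℝ) * √2 = 2 := Real.mul_self_sqrt (by norm_num)
  linear_combination h2

theorem tendsto_rowCoeff_quadraticTwelve {c : ℤ} (hc : c % 12 = 5 ∨ c % 12 = 11) :
    Tendsto (fun s : ℝ => ∑' n : ℕ,
    rowCoeff (periodicLift quadraticTwelve) c 12 (n + 1) * ((n + 1 : ℕ) : ℝ) ^ (-s)) (𝓝[>] 1)
      (𝓝 0) := by
  simp only [rowCoeff_quadraticTwelve hc]
  have h := tendsto_tsum_cos_add (m := 12) one_pos (by norm_num : 1 < 5) (by norm_num)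
  have e1 := cos_two_pi_mul_div_twelve 1 1
  have e2 := cos_two_pi_mul_div_twelve 1 5
  rw [Nat.cast_one, one_mul, Nat.cast_one, (by decide : cosTwentyFour 0 (2 * 1 * 1) = 0),
    (by decide : cosTwentyFour 2 (2 * 1 * 1) = 2)] at e1
  rw [Nat.cast_one, one_mul, Nat.cast_one, Nat.cast_ofNat (R := ZMod 24),
    (by decide : cosTwentyFour 0 (2 * 1 * 5) = 0),
    (by decide : cosTwentyFour 2 (2 * 1 * 5) = -2)] at e2
  have h2 : √(3 : ℝ) * √3 = 3 := Real.mul_self_sqrt (by norm_num)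
  have e3 : (2 - 2 * Real.cos (2 * Real.pi * (((1 : ℕ) : ℝ) / (12 : ℕ)))) *
      (2 - 2 * Real.cos (2 * Real.pi * (((5 : ℕ) : ℝ) / (12 : ℕ)))) = 1 := by
    rw [Nat.cast_one]
    push_cast at e1 e2 ⊢
    generalize Real.cos (2 * Real.pi * (1 / 12)) = x at *
    generalize Real.cos (2 * Real.pi * (5 / 12)) = y at *
    have hx : x = √3 / 2 := by linarith
    have hy : y = -(√3 / 2) := by linarith
    rw [hx, hy]
    linear_combination -h2
  rwa [e3, Real.log_one, neg_zero] at h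

section

variable {d : ℕ} [Fact d.Prime] {c : ℤ} [IsPrincipalIdealRing (QuadraticAlgebra ℤ (-c) 1)]

theorem octant_mul_log_eq (hd : d % 24 = 19) (hd1 : 10000 ≤ d) (hc : (d : ℤ) = 4 * c - 1) {σ : ℤ}
    (hσ : σ = 1 ∨ σ = -1) (hsum : ∀ n : ℤ, ∑ a ∈ Finset.range d, (legendreSym d a : ℝ) *
      Real.sin (2 * Real.pi * (n * (a / d))) = legendreSym d n * (σ * √d)) :
    σ * weightedSum d (weightedSum.step d 8 1 3) * Real.log (1 + √2) = Real.pi * √d / 4 +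
      (-Real.log 2 + ∑' n : ℕ, rowTail (periodicLift ZMod.χ₈) c 8 (√d / 16) (n + 1) /
        ((n + 1 : ℕ) : ℝ)) / 2 := by
  have hs : (100 : ℝ) ≤ √d := Real.le_sqrt_of_sq_le (by
    have : (10000 : ℝ) ≤ d := by exact_mod_cast hd1
    linarith)
  have hcr : (d : ℝ) = 4 * c - 1 := by exact_mod_cast hc
  have h := mul_eq_of_tendsto (by omega) (by omega) hc (k := 8) (β := √d / 16)
    (periodicLift_mul (F := ZMod.χ₈) (map_mul _)) (abs_periodicLift_le (by decide))
    (by norm_num) periodicLift_add (by linarith)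
    (by rw [div_pow, Real.sq_sqrt (Nat.cast_nonneg d), ← hcr]; push_cast; ring)
    tendsto_quadraticEight
    (by
      have := tendsto_tsum_cos_sub_mul_legendreSym (by omega) hσ hsum (m := 8) one_pos
        (by norm_num : 1 < 3) (by norm_num)
        (Nat.Coprime.symm (Nat.Coprime.pow_left 3 (Nat.coprime_two_left.2
          (Nat.odd_iff.2 (by omega)))) : Nat.Coprime d 8) (1 / √2)
      simpa only [← periodicLift_quadraticEight] using this)
    (tendsto_rowCoeff_quadraticEight (by omega))
  rw [tsum_quadraticEight_sq] at h
  generalize ∑' n : ℕ, rowTail (periodicLift ZMod.χ₈) c 8 (√d / 16) (n + 1) /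
    ((n + 1 : ℕ) : ℝ) = T at *
  have hπ := Real.pi_pos
  have h2 : √(2 : ℝ) * √2 = 2 := Real.mul_self_sqrt (by norm_num)
  have hs0 : √(d : ℝ) ≠ 0 := by positivity
  have e : Real.log (1 + √2) / √2 * (1 / √2 * (σ * Real.pi / √d *
      weightedSum d (weightedSum.step d 8 1 3))) = Real.pi / (2 * √d) *
      (σ * weightedSum d (weightedSum.step d 8 1 3) * Real.log (1 + √2)) := by
    field_simp
    linear_combination (-(Real.log (1 + √2) * σ *
      weightedSum d (weightedSum.step d 8 1 3))) * h2
  rw [e] at h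
  generalize σ * (weightedSum d (weightedSum.step d 8 1 3) : ℝ) * Real.log (1 + √2) = X at *
  push_cast at h
  field_simp at h
  linarith

theorem twelfth_mul_log_eq (hd : d % 24 = 19) (hd1 : 10000 ≤ d) (hc : (d : ℤ) = 4 * c - 1) {σ : ℤ}
    (hσ : σ = 1 ∨ σ = -1) (hsum : ∀ n : ℤ, ∑ a ∈ Finset.range d, (legendreSym d a : ℝ) *
      Real.sin (2 * Real.pi * (n * (a / d))) = legendreSym d n * (σ * √d)) :
    σ * weightedSum d (weightedSum.step d 12 1 5) / 2 * Real.log (2 + √3) = Real.pi * √d / 6 +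
      (∑' n : ℕ, rowTail (periodicLift quadraticTwelve) c 12 (√d / 24) (n + 1) /
        ((n + 1 : ℕ) : ℝ)) / 4 := by
  have hs : (100 : ℝ) ≤ √d := Real.le_sqrt_of_sq_le (by
    have : (10000 : ℝ) ≤ d := by exact_mod_cast hd1
    linarith)
  have hcr : (d : ℝ) = 4 * c - 1 := by exact_mod_cast hc
  have h := mul_eq_of_tendsto (by omega) (by omega) hc (k := 12) (β := √d / 24)
    (periodicLift_mul (F := quadraticTwelve) (by decide)) (abs_periodicLift_le (by decide))
    (by norm_num) periodicLift_add (by linarith)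
    (by rw [div_pow, Real.sq_sqrt (Nat.cast_nonneg d), ← hcr]; push_cast; ring)
    tendsto_quadraticTwelve
    (by
      have := tendsto_tsum_cos_sub_mul_legendreSym (by omega) hσ hsum (m := 12) one_pos
        (by norm_num : 1 < 5) (by norm_num)
        (Nat.Coprime.symm (Nat.Coprime.mul_left (Nat.Coprime.pow_left 2 (Nat.coprime_two_left.2
          (Nat.odd_iff.2 (by omega)))) ((Nat.Prime.coprime_iff_not_dvd Nat.prime_three).2
            (by omega))) : Nat.Coprime d 12) (1 / √3)
      simpa only [← periodicLift_quadraticTwelve] using this)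
    (tendsto_rowCoeff_quadraticTwelve (by omega))
  rw [tsum_quadraticTwelve_sq] at h
  generalize ∑' n : ℕ, rowTail (periodicLift quadraticTwelve) c 12 (√d / 24) (n + 1) /
    ((n + 1 : ℕ) : ℝ) = T at *
  have hπ := Real.pi_pos
  have h2 : √(3 : ℝ) * √3 = 3 := Real.mul_self_sqrt (by norm_num)
  have hs0 : √(d : ℝ) ≠ 0 := by positivity
  have e : Real.log (2 + √3) / √3 * (1 / √3 * (σ * Real.pi / √d *
      weightedSum d (weightedSum.step d 12 1 5))) = 2 * Real.pi / (3 * √d) *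
      (σ * weightedSum d (weightedSum.step d 12 1 5) / 2 * Real.log (2 + √3)) := by
    field_simp
    linear_combination (-(Real.log (2 + √3) * σ *
      weightedSum d (weightedSum.step d 12 1 5))) * h2
  rw [e] at h
  generalize σ * (weightedSum d (weightedSum.step d 12 1 5) : ℝ) / 2 * Real.log (2 + √3) = X at *
  push_cast at h
  field_simp at h
  linarith

end

end

/-- The coefficient of `q ^ (m * y)` in half of `rowTail`. -/
noncomputable def rowCos (χ : ℤ → ℝ) (c : ℤ) (k m y : ℕ) : ℝ :=
  ∑ r ∈ Finset.range k, χ (formValue c r y) * Real.cos ((m * (2 * r + y) : ℕ) * (Real.pi / k))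

theorem norm_rowNome (k : ℕ) (β : ℝ) (r y : ℕ) :
    ‖rowNome k β r y‖ = Real.exp (-(2 * Real.pi * β)) ^ y := by
  rw [rowNome, Complex.norm_exp, ← Real.exp_nat_mul]
  congr 1
  simp
  ring

theorem rowNome_pow_re {k : ℕ} (hk : 0 < k) (β : ℝ) (r y m : ℕ) : (rowNome k β r y ^ m).re =
    Real.exp (-(2 * Real.pi * β)) ^ (m * y) *
      Real.cos ((m * (2 * r + y) : ℕ) * (Real.pi / k)) := by
  have hk' : (k : ℂ) ≠ 0 := by exact_mod_cast hk.ne'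
  rw [rowNome, ← Complex.exp_nat_mul, ← Real.exp_nat_mul]
  have e : (m : ℂ) * (2 * Real.pi * Complex.I * (((((r : ℝ) + y / 2) / k : ℝ) : ℂ) +
      ((β * y : ℝ) : ℂ) * Complex.I)) = (((m * y : ℕ) * -(2 * Real.pi * β) : ℝ) : ℂ) +
      (((m * (2 * r + y) : ℕ) * (Real.pi / k) : ℝ) : ℂ) * Complex.I := by
    push_cast
    field_simp
    linear_combination (2 * (m : ℂ) * k * β * y) * Complex.I_sq
  rw [e, Complex.exp_add, ← Complex.ofReal_exp, Complex.re_ofReal_mul, Complex.exp_ofReal_mul_I_re]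

theorem abs_rowTail_sub_le {χ : ℤ → ℝ} (hχ : ∀ n, |χ n| ≤ 1) (c : ℤ) {k : ℕ} (hk : 0 < k) {β Q : ℝ}
    (hQ : Q = Real.exp (-(2 * Real.pi * β))) (hQ1 : Q ≤ 1 / 100) {y : ℕ} (hy : 0 < y) (N : ℕ) :
    |rowTail χ c k β y - 2 * ∑ m ∈ Finset.range N, rowCos χ c k (m + 1) y * Q ^ ((m + 1) * y)| ≤
      2 * k * (102 / 100 * Q ^ ((N + 1) * y)) := by
  have hQ0 : 0 ≤ Q := hQ ▸ (Real.exp_pos _).le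
  have hQy : Q ^ y ≤ 1 / 100 := (pow_le_of_le_one hQ0 (by linarith) hy.ne').trans hQ1
  have h1 : rowTail χ c k β y -
      2 * ∑ m ∈ Finset.range N, rowCos χ c k (m + 1) y * Q ^ ((m + 1) * y) =
      ∑ r ∈ Finset.range k, χ (formValue c r y) *
        (2 * (rowNome k β r y ^ (N + 1) / (1 - rowNome k β r y)).re) := by
    simp only [rowTail, rowCos, Finset.sum_mul]
    rw [Finset.sum_comm, Finset.mul_sum, ← Finset.sum_sub_distrib]
    refine Finset.sum_congr rfl fun r _ => ?_
    have h2 : rowNome k β r y / (1 - rowNome k β r y) =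
        ∑ m ∈ Finset.range N, rowNome k β r y ^ (m + 1) +
          rowNome k β r y ^ (N + 1) / (1 - rowNome k β r y) := by
      have h3 : 1 - rowNome k β r y ≠ 0 := by
        intro h
        have := norm_rowNome k β r y
        rw [← sub_eq_zero.1 h, norm_one, ← hQ] at this
        linarith
      have h4 := mul_neg_geom_sum (rowNome k β r y) N
      simp only [pow_succ']
      rw [← Finset.mul_sum]
      field_simp
      linear_combination -rowNome k β r y * h4
    rw [h2, Complex.add_re, Complex.re_sum]
    simp only [rowNome_pow_re hk, ← hQ]
    rw [mul_add, mul_add, Finset.mul_sum, Finset.mul_sum, Finset.mul_sum, add_sub_right_comm,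
      ← Finset.sum_sub_distrib]
    rw [Finset.sum_eq_zero fun m _ => by ring, zero_add]
  rw [h1]
  refine (Finset.abs_sum_le_sum_abs _ _).trans ((Finset.sum_le_card_nsmul _ _
    (2 * (102 / 100 * Q ^ ((N + 1) * y))) fun r _ => ?_).trans_eq (by simp; ring))
  have h5 : ‖rowNome k β r y‖ = Q ^ y := by rw [norm_rowNome, hQ]
  have h6 : 99 / 100 ≤ ‖1 - rowNome k β r y‖ := by
    have := norm_sub_norm_le (1 : ℂ) (rowNome k β r y)
    rw [norm_one, h5] at this
    linarith
  rw [abs_mul, abs_mul, abs_two]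
  calc _ ≤ 1 * (2 * ‖rowNome k β r y ^ (N + 1) / (1 - rowNome k β r y)‖) := by
        gcongr
        · exact hχ _
        · exact Complex.abs_re_le_norm _
    _ = 2 * (Q ^ ((N + 1) * y) / ‖1 - rowNome k β r y‖) := by
        rw [norm_div, norm_pow, h5, ← pow_mul, mul_comm y]
        ring
    _ ≤ 2 * (102 / 100 * Q ^ ((N + 1) * y)) := by
        gcongr
        rw [div_le_iff₀ (by linarith)]
        have : 0 ≤ Q ^ ((N + 1) * y) := by positivity
        linarith [mul_nonneg this (sub_nonneg.2 h6)]

theorem abs_tsum_rowTail_sub_le {χ : ℤ → ℝ} (hχ : ∀ n, |χ n| ≤ 1) (c : ℤ) {k : ℕ} (hk : 0 < k)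
    {β Q : ℝ} (hQ : Q = Real.exp (-(2 * Real.pi * β))) (hQ1 : Q ≤ 1 / 100) :
    |∑' n : ℕ, rowTail χ c k β (n + 1) / ((n + 1 : ℕ) : ℝ) -
      (2 * (rowCos χ c k 1 1 * Q + rowCos χ c k 2 1 * Q ^ 2 + rowCos χ c k 3 1 * Q ^ 3) +
        rowCos χ c k 1 2 * Q ^ 2 + 2 / 3 * rowCos χ c k 1 3 * Q ^ 3)| ≤ 5 * k * Q ^ 4 := by
  have hQ0 : 0 ≤ Q := hQ ▸ (Real.exp_pos _).le
  have h1 := abs_rowTail_sub_le hχ c hk hQ hQ1 (y := 1) (by norm_num) 3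
  have h2 := abs_rowTail_sub_le hχ c hk hQ hQ1 (y := 2) (by norm_num) 1
  have h3 := abs_rowTail_sub_le hχ c hk hQ hQ1 (y := 3) (by norm_num) 1
  have h4 : ∀ n : ℕ, |rowTail χ c k β (n + 1) / ((n + 1 : ℕ) : ℝ)| ≤
      2 * k * (102 / 100) * Q * Q ^ n := fun n => by
    have h := abs_rowTail_sub_le hχ c hk hQ hQ1 (y := n + 1) (by omega) 0
    rw [Finset.range_zero, Finset.sum_empty, mul_zero, sub_zero, zero_add, one_mul, pow_succ'] at h
    rw [abs_div, Nat.abs_cast]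
    refine (div_le_self (abs_nonneg _) (by push_cast; linarith [n.cast_nonneg (α := ℝ)])).trans ?_
    linarith
  have hg : Summable fun n : ℕ => 2 * k * (102 / 100) * Q * Q ^ n :=
    (summable_geometric_of_lt_one hQ0 (by linarith)).mul_left _
  have hs : Summable fun n : ℕ => rowTail χ c k β (n + 1) / ((n + 1 : ℕ) : ℝ) :=
    Summable.of_norm_bounded hg h4
  have h5 : |∑' n : ℕ, rowTail χ c k β (n + 3 + 1) / ((n + 3 + 1 : ℕ) : ℝ)| ≤
      2 * k * (102 / 100) ^ 2 * Q ^ 4 / 4 := by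
    have h6 : HasSum (fun n : ℕ => 2 * k * (102 / 100) * Q ^ 4 / 4 * Q ^ n)
        (2 * k * (102 / 100) * Q ^ 4 / 4 * (1 - Q)⁻¹) :=
      (hasSum_geometric_of_lt_one hQ0 (by linarith)).mul_left _
    have h9 : ∀ n : ℕ, ‖rowTail χ c k β (n + 3 + 1) / ((n + 3 + 1 : ℕ) : ℝ)‖ ≤
        2 * k * (102 / 100) * Q ^ 4 / 4 * Q ^ n := fun n => by
      have h := abs_rowTail_sub_le hχ c hk hQ hQ1 (y := n + 3 + 1) (by omega) 0
      rw [Finset.range_zero, Finset.sum_empty, mul_zero, sub_zero, zero_add, one_mul,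
        show n + 3 + 1 = 4 + n by omega, pow_add] at h
      rw [Real.norm_eq_abs, abs_div, Nat.abs_cast, show n + 3 + 1 = 4 + n by omega]
      have h7 : (4 : ℝ) ≤ ((4 + n : ℕ) : ℝ) := by push_cast; linarith [n.cast_nonneg (α := ℝ)]
      refine (div_le_div_of_nonneg_left (abs_nonneg _) (by norm_num) h7).trans ?_
      linarith
    rw [← Real.norm_eq_abs]
    refine (tsum_of_norm_bounded h6 h9).trans ?_
    rw [← div_eq_mul_inv, div_le_iff₀ (by linarith)]
    have : (0 : ℝ) ≤ k * Q ^ 4 := by positivity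
    nlinarith
  have h6 := hs.sum_add_tsum_nat_add 3
  simp only [Finset.sum_range_succ, Finset.sum_range_zero] at h6 h1 h2 h3
  norm_num at h6 h1 h2 h3 h5
  push_cast
  rw [← h6]
  have h7 : k * Q ^ 6 ≤ k * Q ^ 4 / 100 := by
    have : (0 : ℝ) ≤ k * Q ^ 4 := by positivity
    have hQ2 : Q ^ 2 ≤ 1 / 100 := (pow_le_of_le_one hQ0 (by linarith) two_ne_zero).trans hQ1
    linarith [mul_le_mul_of_nonneg_left hQ2 this]
  have h8 : (0 : ℝ) ≤ k * Q ^ 4 := by positivity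
  rw [abs_le] at *
  constructor <;> linarith

theorem abs_rowCos_le {χ : ℤ → ℝ} (hχ : ∀ n, |χ n| ≤ 1) (c : ℤ) (k m y : ℕ) :
    |rowCos χ c k m y| ≤ k := by
  refine (Finset.abs_sum_le_sum_abs _ _).trans ((Finset.sum_le_card_nsmul _ _ 1
    fun r _ => ?_).trans_eq (by simp))
  rw [abs_mul]
  exact mul_le_one₀ (hχ _) (abs_nonneg _) (Real.abs_cos_le_one _)

theorem two_mul_rowCos_quadraticEight (c : ℤ) (m y : ℕ) :
    2 * rowCos (periodicLift ZMod.χ₈) c 8 m y =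
      (∑ r ∈ Finset.range 8, ZMod.χ₈ ((r : ZMod 8) ^ 2 + r * y + c * (y : ZMod 8) ^ 2) *
        cosSixteen 0 ((m * (2 * r + y) : ℕ) : ZMod 16) : ℤ) +
      (∑ r ∈ Finset.range 8, ZMod.χ₈ ((r : ZMod 8) ^ 2 + r * y + c * (y : ZMod 8) ^ 2) *
        cosSixteen 1 ((m * (2 * r + y) : ℕ) : ZMod 16) : ℤ) * (2 * Real.cos (Real.pi / 8)) +
      (∑ r ∈ Finset.range 8, ZMod.χ₈ ((r : ZMod 8) ^ 2 + r * y + c * (y : ZMod 8) ^ 2) *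
        cosSixteen 2 ((m * (2 * r + y) : ℕ) : ZMod 16) : ℤ) * √2 +
      (∑ r ∈ Finset.range 8, ZMod.χ₈ ((r : ZMod 8) ^ 2 + r * y + c * (y : ZMod 8) ^ 2) *
        cosSixteen 3 ((m * (2 * r + y) : ℕ) : ZMod 16) : ℤ) * (2 * Real.cos (3 * Real.pi / 8)) := by
  rw [rowCos, Finset.mul_sum, Int.cast_sum, Int.cast_sum, Int.cast_sum, Int.cast_sum,
    Finset.sum_mul, Finset.sum_mul, Finset.sum_mul, ← Finset.sum_add_distrib,
    ← Finset.sum_add_distrib, ← Finset.sum_add_distrib]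
  refine Finset.sum_congr rfl fun r _ => ?_
  have h := two_mul_cos_eq (m * (2 * r + y))
  have e : periodicLift ZMod.χ₈ (formValue c r y) =
      (ZMod.χ₈ ((r : ZMod 8) ^ 2 + r * y + c * (y : ZMod 8) ^ 2) : ℤ) := by
    simp [periodicLift, formValue]
  rw [e, mul_left_comm, show ((8 : ℕ) : ℝ) = 8 by norm_num, h, Int.cast_mul, Int.cast_mul,
    Int.cast_mul, Int.cast_mul]
  ring

theorem four_mul_rowCos_quadraticTwelve (c : ℤ) (m y : ℕ) :
    4 * rowCos (periodicLift quadraticTwelve) c 12 m y =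
      (∑ r ∈ Finset.range 12, quadraticTwelve ((r : ZMod 12) ^ 2 + r * y + c * (y : ZMod 12) ^ 2) *
        cosTwentyFour 0 ((m * (2 * r + y) : ℕ) : ZMod 24) : ℤ) +
      (∑ r ∈ Finset.range 12, quadraticTwelve ((r : ZMod 12) ^ 2 + r * y + c * (y : ZMod 12) ^ 2) *
        cosTwentyFour 1 ((m * (2 * r + y) : ℕ) : ZMod 24) : ℤ) * √2 +
      (∑ r ∈ Finset.range 12, quadraticTwelve ((r : ZMod 12) ^ 2 + r * y + c * (y : ZMod 12) ^ 2) *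
        cosTwentyFour 2 ((m * (2 * r + y) : ℕ) : ZMod 24) : ℤ) * √3 +
      (∑ r ∈ Finset.range 12, quadraticTwelve ((r : ZMod 12) ^ 2 + r * y + c * (y : ZMod 12) ^ 2) *
        cosTwentyFour 3 ((m * (2 * r + y) : ℕ) : ZMod 24) : ℤ) * (√2 * √3) := by
  rw [rowCos, Finset.mul_sum, Int.cast_sum, Int.cast_sum, Int.cast_sum, Int.cast_sum,
    Finset.sum_mul, Finset.sum_mul, Finset.sum_mul, ← Finset.sum_add_distrib,
    ← Finset.sum_add_distrib, ← Finset.sum_add_distrib]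
  refine Finset.sum_congr rfl fun r _ => ?_
  have h := four_mul_cos_eq (m * (2 * r + y))
  have e : periodicLift quadraticTwelve (formValue c r y) =
      (quadraticTwelve ((r : ZMod 12) ^ 2 + r * y + c * (y : ZMod 12) ^ 2) : ℤ) := by
    simp [periodicLift, formValue]
  rw [e, mul_left_comm, show ((12 : ℕ) : ℝ) = 12 by norm_num, h, Int.cast_mul, Int.cast_mul,
    Int.cast_mul, Int.cast_mul]
  ring

/-- The sign `1` or `-1` according to whether `c ≡ 3` or `c ≡ 1` modulo `4`. -/
def signModFour (c : ℤ) : ℤ := if c % 4 = 3 then 1 else -1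

theorem rowCos_quadraticEight {c : ℤ} (hc : c % 2 = 1) :
    rowCos (periodicLift ZMod.χ₈) c 8 2 1 = 0 ∧ rowCos (periodicLift ZMod.χ₈) c 8 1 2 = 0 ∧
    rowCos (periodicLift ZMod.χ₈) c 8 1 1 ^ 2 = 16 + 8 * signModFour c * √2 := by
  have h21 := two_mul_rowCos_quadraticEight c 2 1
  have h12 := two_mul_rowCos_quadraticEight c 1 2
  have h11 := two_mul_rowCos_quadraticEight c 1 1
  obtain ⟨r1, r2, r3⟩ := cos_pi_div_eight_relations
  generalize 2 * Real.cos (Real.pi / 8) = a at *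
  generalize 2 * Real.cos (3 * Real.pi / 8) = b at *
  have h : ∀ z : ZMod 8, z.val % 2 = 1 →
      (∀ i, ∑ r ∈ Finset.range 8, ZMod.χ₈ ((r : ZMod 8) ^ 2 + r * (1 : ℕ) +
          z * ((1 : ℕ) : ZMod 8) ^ 2) * cosSixteen i ((2 * (2 * r + 1) : ℕ) : ZMod 16) = 0) ∧
      (∀ i, ∑ r ∈ Finset.range 8, ZMod.χ₈ ((r : ZMod 8) ^ 2 + r * (2 : ℕ) +
          z * ((2 : ℕ) : ZMod 8) ^ 2) * cosSixteen i ((1 * (2 * r + 2) : ℕ) : ZMod 16) = 0) ∧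
      (∑ r ∈ Finset.range 8, ZMod.χ₈ ((r : ZMod 8) ^ 2 + r * (1 : ℕ) +
          z * ((1 : ℕ) : ZMod 8) ^ 2) * cosSixteen 0 ((1 * (2 * r + 1) : ℕ) : ZMod 16) = 0) ∧
      (∑ r ∈ Finset.range 8, ZMod.χ₈ ((r : ZMod 8) ^ 2 + r * (1 : ℕ) +
          z * ((1 : ℕ) : ZMod 8) ^ 2) * cosSixteen 2 ((1 * (2 * r + 1) : ℕ) : ZMod 16) = 0) ∧
      (∑ r ∈ Finset.range 8, ZMod.χ₈ ((r : ZMod 8) ^ 2 + r * (1 : ℕ) +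
          z * ((1 : ℕ) : ZMod 8) ^ 2) * cosSixteen 1 ((1 * (2 * r + 1) : ℕ) : ZMod 16)) ^ 2 = 16 ∧
      (∑ r ∈ Finset.range 8, ZMod.χ₈ ((r : ZMod 8) ^ 2 + r * (1 : ℕ) +
          z * ((1 : ℕ) : ZMod 8) ^ 2) * cosSixteen 3 ((1 * (2 * r + 1) : ℕ) : ZMod 16)) =
        (if z.val % 4 = 3 then 1 else -1) * (∑ r ∈ Finset.range 8, ZMod.χ₈ ((r : ZMod 8) ^ 2 +
          r * (1 : ℕ) + z * ((1 : ℕ) : ZMod 8) ^ 2) *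
            cosSixteen 1 ((1 * (2 * r + 1) : ℕ) : ZMod 16)) := by decide +kernel
  have hv := ZMod.val_intCast (n := 8) c
  obtain ⟨k1, k2, k3, k4, k5, k6⟩ := h c (by omega)
  have e : (if (c : ZMod 8).val % 4 = 3 then 1 else -1 : ℤ) = signModFour c := by
    rw [signModFour]
    congr 1
    exact propext ⟨by omega, by omega⟩
  have hs : signModFour c ^ 2 = 1 := by rw [signModFour]; split_ifs <;> rfl
  rw [e] at k6
  rw [k1, k1, k1, k1] at h21
  rw [k2, k2, k2, k2] at h12
  rw [k3, k4, k6] at h11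
  refine ⟨by simpa using h21, by simpa using h12, ?_⟩
  generalize ∑ r ∈ Finset.range 8, ZMod.χ₈ ((r : ZMod 8) ^ 2 + r * (1 : ℕ) +
          c * ((1 : ℕ) : ZMod 8) ^ 2) * cosSixteen 1 ((1 * (2 * r + 1) : ℕ) : ZMod 16) = A at *
  have k5' : (A : ℝ) ^ 2 = 16 := by exact_mod_cast k5
  have hs' : (signModFour c : ℝ) ^ 2 = 1 := by exact_mod_cast hs
  have hb : b * b = 2 - √2 := by
    have h2 : √(2 : ℝ) * √2 = 2 := Real.mul_self_sqrt (by norm_num)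
    linear_combination (-b) * r2 + (√2 - 1) * r3 + h2
  push_cast at h11
  have h : rowCos (periodicLift ZMod.χ₈) c 8 1 1 = A * (a + signModFour c * b) / 2 := by linarith
  rw [h]
  linear_combination ((a + signModFour c * b) ^ 2 / 4) * k5' + 4 * r1 + 4 * hb +
    8 * signModFour c * r3 + 4 * b ^ 2 * hs'

theorem rowCos_quadraticTwelve {c : ℤ} (hc : c % 12 = 5 ∨ c % 12 = 11) :
    rowCos (periodicLift quadraticTwelve) c 12 2 1 = 0 ∧
    rowCos (periodicLift quadraticTwelve) c 12 1 2 = 0 ∧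
    rowCos (periodicLift quadraticTwelve) c 12 1 1 = signModFour c * (4 * √2) ∧
    rowCos (periodicLift quadraticTwelve) c 12 3 1 = signModFour c * (2 * √2) ∧
    rowCos (periodicLift quadraticTwelve) c 12 1 3 = signModFour c * (2 * √2) := by
  have hz : (c : ZMod 12) = 5 ∧ signModFour c = -1 ∨ (c : ZMod 12) = 11 ∧ signModFour c = 1 := by
    rcases hc with hc | hc
    · exact .inl ⟨(ZMod.intCast_eq_intCast_iff' c 5 12).2 hc, if_neg (by omega)⟩
    · exact .inr ⟨(ZMod.intCast_eq_intCast_iff' c 11 12).2 hc, if_pos (by omega)⟩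
  have h : ∀ z : ZMod 12, ∀ m y : ℕ, ∀ u v : ℤ, z = 5 ∧ u = -1 ∨ z = 11 ∧ u = 1 →
      (m, y, v) ∈ [(2, 1, 0), (1, 2, 0), (1, 1, 16), (3, 1, 8), (1, 3, 8)] → ∀ i,
      ∑ r ∈ Finset.range 12, quadraticTwelve ((r : ZMod 12) ^ 2 + r * y + z * (y : ZMod 12) ^ 2) *
        cosTwentyFour i ((m * (2 * r + y) : ℕ) : ZMod 24) = if i = 1 then u * v else 0 := by
    intro z m y u v hz hv
    simp only [List.mem_cons, Prod.mk.injEq, List.not_mem_nil, or_false] at hv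
    rcases hz with ⟨rfl, rfl⟩ | ⟨rfl, rfl⟩ <;>
    rcases hv with ⟨rfl, rfl, rfl⟩ | ⟨rfl, rfl, rfl⟩ | ⟨rfl, rfl, rfl⟩ | ⟨rfl, rfl, rfl⟩ |
      ⟨rfl, rfl, rfl⟩ <;> decide +kernel
  have h' : ∀ m y : ℕ, ∀ v : ℤ,
      (m, y, v) ∈ [(2, 1, 0), (1, 2, 0), (1, 1, 16), (3, 1, 8), (1, 3, 8)] →
      4 * rowCos (periodicLift quadraticTwelve) c 12 m y = signModFour c * v * √2 := by
    intro m y v hv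
    have e := h c m y _ v hz hv
    rw [four_mul_rowCos_quadraticTwelve, e, e, e, e]
    simp
  have h21 := h' 2 1 0 (by simp)
  have h12 := h' 1 2 0 (by simp)
  have h11 := h' 1 1 16 (by simp)
  have h31 := h' 3 1 8 (by simp)
  have h13 := h' 1 3 8 (by simp)
  push_cast at h21 h12 h11 h31 h13
  refine ⟨?_, ?_, ?_, ?_, ?_⟩ <;> linarith

theorem exp_neg_le_of_ten_thousand_le {d : ℕ} (hd : 10000 ≤ d) :
    Real.exp (-(Real.pi * √d / 24)) ≤ 1 / 10 ^ 4 := by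
  have hs : (100 : ℝ) ≤ √d := Real.le_sqrt_of_sq_le (by
    have : (10000 : ℝ) ≤ d := by exact_mod_cast hd
    linarith)
  have hp : 12 ≤ Real.pi * √d / 24 := by nlinarith [Real.pi_gt_three]
  have h1 : (2.7 : ℝ) ^ 12 ≤ Real.exp 12 := by
    rw [← Real.exp_one_rpow 12, show (12 : ℝ) = (12 : ℕ) by norm_num, Real.rpow_natCast]
    exact pow_le_pow_left₀ (by norm_num) (by linarith [Real.exp_one_gt_d9]) _
  rw [Real.exp_neg, one_div]
  refine inv_anti₀ (by norm_num) ?_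
  exact (by norm_num : (10 : ℝ) ^ 4 ≤ 2.7 ^ 12).trans (h1.trans (Real.exp_le_exp.2 hp))

section

variable {d : ℕ} [Fact d.Prime] {c : ℤ} [IsPrincipalIdealRing (QuadraticAlgebra ℤ (-c) 1)]

theorem false_of_isPrincipalIdealRing (hd : d % 24 = 19) (hd1 : 10000 ≤ d)
    (hc : (d : ℤ) = 4 * c - 1) : False := by
  obtain ⟨σ, hσ, hsum⟩ := exists_sum_legendreSym_mul_sin (d := d) (by omega)
  have hself := weightedSum_self (by omega) (by omega) hc hσ hsum
  obtain ⟨v, hv, hv2⟩ := weightedSum.exists_octant_eq (by omega) hself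
  obtain ⟨w, hw, hw2⟩ := weightedSum.exists_twelfth_eq hd hself
  have h8 := octant_mul_log_eq hd hd1 hc hσ hsum
  have h12 := twelfth_mul_log_eq hd hd1 hc hσ hsum
  have hh := exp_neg_le_of_ten_thousand_le hd1
  have h0 := Real.exp_pos (-(Real.pi * √d / 24))
  set h := Real.exp (-(Real.pi * √d / 24)) with hdef
  have hP : h ^ 2 = Real.exp (-(2 * Real.pi * (√d / 24))) := by
    rw [hdef, ← Real.exp_nat_mul]
    congr 1
    push_cast
    ring
  have hQ : h ^ 3 = Real.exp (-(2 * Real.pi * (√d / 16))) := by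
    rw [hdef, ← Real.exp_nat_mul]
    congr 1
    push_cast
    ring
  have hh1 : h ≤ 1 := hh.trans (by norm_num)
  have hP1 : h ^ 2 ≤ 1 / 100 :=
    (pow_le_of_le_one h0.le hh1 (by norm_num)).trans (hh.trans (by norm_num))
  have hQ1 : h ^ 3 ≤ 1 / 100 :=
    (pow_le_of_le_one h0.le hh1 (by norm_num)).trans (hh.trans (by norm_num))
  have hχ8 : ∀ n, |periodicLift ZMod.χ₈ n| ≤ 1 := abs_periodicLift_le (by decide)
  have hχ12 : ∀ n, |periodicLift quadraticTwelve n| ≤ 1 := abs_periodicLift_le (by decide)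
  have t8 := abs_tsum_rowTail_sub_le hχ8 c (by norm_num : 0 < 8) hQ hQ1
  have t12 := abs_tsum_rowTail_sub_le hχ12 c (by norm_num : 0 < 12) hP hP1
  obtain ⟨e21, e12, e11⟩ := rowCos_quadraticEight (c := c) (by omega)
  obtain ⟨f21, f12, f11, f31, f13⟩ := rowCos_quadraticTwelve (c := c) (by omega)
  have b31 := abs_rowCos_le hχ8 c 8 3 1
  have b13 := abs_rowCos_le hχ8 c 8 1 3
  rw [e21, e12] at t8
  rw [f21, f12, f11, f31, f13] at t12
  generalize rowCos (periodicLift ZMod.χ₈) c 8 1 1 = C at *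
  generalize rowCos (periodicLift ZMod.χ₈) c 8 3 1 = C₃ at *
  generalize rowCos (periodicLift ZMod.χ₈) c 8 1 3 = C₃' at *
  generalize ∑' n : ℕ, rowTail (periodicLift ZMod.χ₈) c 8 (√d / 16) (n + 1) /
    ((n + 1 : ℕ) : ℝ) = T₈ at *
  generalize ∑' n : ℕ, rowTail (periodicLift quadraticTwelve) c 12 (√d / 24) (n + 1) /
    ((n + 1 : ℕ) : ℝ) = T₁₂ at *
  have hτ : signModFour c = 1 ∧ c % 4 = 3 ∨ signModFour c = -1 ∧ c % 4 = 1 := by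
    rw [signModFour]
    split_ifs
    · exact .inl ⟨rfl, ‹_›⟩
    · exact .inr ⟨rfl, by omega⟩
  generalize signModFour c = τ at *
  have hlogP : Real.log (h ^ 2) = -(Real.pi * √d / 12) := by rw [hP, Real.log_exp]; ring
  have hlogQ : Real.log (h ^ 3) = -(Real.pi * √d / 8) := by rw [hQ, Real.log_exp]; ring
  have hC0 : C ≠ 0 := by
    rintro rfl
    have h2 : √(2 : ℝ) < 2 := by
      rw [Real.sqrt_lt' (by norm_num)]
      norm_num
    rcases hτ with ⟨rfl, -⟩ | ⟨rfl, -⟩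
    · push_cast at e11
      linarith [Real.sqrt_nonneg (2 : ℝ)]
    · push_cast at e11
      linarith
  obtain ⟨s, hs, hs0⟩ : ∃ s : ℤ, (s = 1 ∨ s = -1) ∧ 0 < C * (τ * s) := by
    rcases hτ with ⟨rfl, -⟩ | ⟨rfl, -⟩ <;> rcases hC0.lt_or_gt with h | h
    · exact ⟨-1, .inr rfl, by push_cast; linarith⟩
    · exact ⟨1, .inl rfl, by push_cast; linarith⟩
    · exact ⟨1, .inl rfl, by push_cast; linarith⟩
    · exact ⟨-1, .inr rfl, by push_cast; linarith⟩
  obtain ⟨n, hn⟩ : ∃ n : ℤ, σ * weightedSum d (weightedSum.step d 8 1 3) = 4 * n + τ := by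
    rw [hv]
    rcases hσ with rfl | rfl <;> rcases hτ with ⟨rfl, hc4⟩ | ⟨rfl, hc4⟩
    · exact ⟨(2 + 2 * v) / 4, by omega⟩
    · exact ⟨(4 + 2 * v) / 4, by omega⟩
    · exact ⟨(2 - 2 * v) / 4, by omega⟩
    · exact ⟨(4 - 2 * v) / 4, by omega⟩
  obtain ⟨m, hm⟩ : ∃ m : ℤ, σ * weightedSum d (weightedSum.step d 12 1 5) = 2 * (2 * m + 1) := by
    rw [hw]
    rcases hσ with rfl | rfl
    · exact ⟨(1 - w) / 2, by omega⟩
    · exact ⟨(1 + w) / 2, by omega⟩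
  have hn' : (σ : ℝ) * weightedSum d (weightedSum.step d 8 1 3) = 4 * n + τ := by exact_mod_cast hn
  have hm' : (σ : ℝ) * weightedSum d (weightedSum.step d 12 1 5) = 2 * (2 * m + 1) := by
    exact_mod_cast hm
  rw [hn'] at h8
  rw [hm'] at h12
  refine false_of_log_relations (hτ.imp And.left And.left) hs h0 hh rfl rfl e11 hs0
    (ε₁ := T₈ / 2 - C * h ^ 3)
    (ε₂ := T₁₂ / 4 - τ * (2 * √2 * h ^ 2 + 4 * √2 / 3 * (h ^ 2) ^ 3)) ?_ ?_ (n := n) (m := m) ?_ ?_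
  · clear h8 h12 t12
    have hq : 0 ≤ h ^ 3 := by positivity
    generalize h ^ 3 = Q at *
    have h3 : 0 ≤ Q ^ 3 := by positivity
    have h4 : Q ^ 4 ≤ Q ^ 3 := pow_le_pow_of_le_one hq (by linarith) (by norm_num)
    have k1 : |C₃ * Q ^ 3| ≤ 8 * Q ^ 3 := by
      rw [abs_mul, abs_of_nonneg h3]
      exact mul_le_mul_of_nonneg_right b31 h3
    have k2 : |C₃' * Q ^ 3| ≤ 8 * Q ^ 3 := by
      rw [abs_mul, abs_of_nonneg h3]
      exact mul_le_mul_of_nonneg_right b13 h3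
    rw [abs_le] at *
    push_cast at t8
    constructor <;> linarith
  · clear h8 h12 t8
    have hp : 0 ≤ (h ^ 2) ^ 4 := by positivity
    generalize h ^ 2 = P at *
    rw [abs_le] at *
    push_cast at t12
    constructor <;> linarith
  · rw [h8, hlogQ]
    ring
  · rw [mul_div_cancel_left₀ _ two_ne_zero] at h12
    rw [h12, hlogP]
    ring

end

/-- **The class number one problem (Baker 1966; Stark; Heegner).**
Let `d` be a squarefree positive integer and let `K` be the imaginary quadratic field
`ℚ(√−d)` (a number field generated over `ℚ` by a square root `α` of `−d`). Then the
class number of `K` is `1` if and only if `d ∈ {1, 2, 3, 7, 11, 19, 43, 67, 163}`. -/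
theorem baker_class_number_one (d : ℕ) (hd0 : 0 < d) (hd : Squarefree d)
    (K : Type*) [Field K] [NumberField K] (α : K) (hα : α ^ 2 = -(d : K))
    (hgen : IntermediateField.adjoin ℚ {α} = ⊤) :
    NumberField.classNumber K = 1 ↔ d ∈ ({1, 2, 3, 7, 11, 19, 43, 67, 163} : Set ℕ) := by
  refine ⟨fun h => ?_, fun h => classNumber_eq_one_of_mem hα hgen hd h⟩
  have h4 : d % 4 ≠ 0 := fun h0 => by
    have := hd 2 (Nat.dvd_of_mod_eq_zero h0)
    simp at this
  by_cases h3 : d % 4 = 3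
  · obtain ⟨c, hc⟩ : ∃ c : ℤ, (d : ℤ) = 4 * c - 1 := ⟨(d + 1) / 4, by omega⟩
    have := (classNumber_eq_one_iff_of_eq_four_mul_sub_one hα hgen hd0 hd hc).1 h
    rcases QuadraticAlgebra.forward_of_isPrincipalIdealRing hc with hm | ⟨h1, h2, hp⟩
    · exact hm
    · have := Fact.mk hp
      exact (false_of_isPrincipalIdealRing h2 h1 hc).elim
  · have h12 : d % 4 = 1 ∨ d % 4 = 2 := by omega
    have := (classNumber_eq_one_iff_of_mod_four_ne_three hα hgen hd0 hd h12).1 h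
    have := QuadraticAlgebra.le_two_of_isPrincipalIdealRing hd0 h12
    interval_cases d <;> simp
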